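/- arXiv:2502.02554 — 2 statements merged into one kernel-verified Lean document; each statement's English description precedes it below -/
import Mathlib

section
/- Fix an integer L ≥ 2, a real β with 0 < β < 2, and a real a > 0. Define v_N^{(N)}(φ) := a·L^{−N(2−β)}·cos(√β·φ) and v_n^{(N)} := R^{N−n} v_N^{(N)} for 1 ≤ n ≤ N. Then for each n ≥ 1 there exist real constants c_n^{(N)} such that v_n^{(N)} − c_n^{(N)} converges uniformly on ℝ, as N → ∞, to a bounded continuous function v_n^∞; the limit potentials are compatible under the RG flow up to additive constants, i.e. for each n ≥ 2 the function R(v_n^∞) − v_{n−1}^∞ is constant; moreover, setting μ_n := a·L^{−n(2−β)}, there is a constant C = C(a,L,β) < ∞ and, for each n ≥ 1, reals μ_{1,n},…,μ_{p,n} and a bounded function w_n such that v_n^∞(φ) = Σ_{k=1}^p μ_{k,n}·cos(k√β·φ) + w_n(φ), with |μ_{1,n} − μ_n| ≤ C·μ_n^{3/2}, |μ_{k,n}| ≤ C·μ_n^{2k/3} for 2 ≤ k ≤ p, and ‖w_n‖_∞ ≤ C·μ_n^{2p/3}. -/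
open MeasureTheory ProbabilityTheory Filter

/-- The hierarchical Sine-Gordon RG map:
`(Rv)(φ) = -L² log ∫ e^{-v(φ+z)} dγ(z)` with `γ` centered Gaussian of variance `2 log L`. -/
noncomputable def SGRG (L : ℕ) (v : ℝ → ℝ) : ℝ → ℝ := fun φ =>
  -(L : ℝ) ^ 2 *
    Real.log (∫ z, Real.exp (-(v (φ + z))) ∂(gaussianReal 0 (2 * Real.log L).toNNReal))

/-- `p(β)`: the smallest positive integer with `(2/3)·p·(2-β) > 2`. -/
noncomputable def pSG (β : ℝ) : ℕ := sInf {p : ℕ | 0 < p ∧ 2 < (2 / 3 : ℝ) * p * (2 - β)}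

/-- The effective potential `v_n^{(N)} = R^{N-n} v_N^{(N)}` with initial potential
`v_N^{(N)}(φ) = a·L^{-N(2-β)}·cos(√β φ)`. -/
noncomputable def SGv (L : ℕ) (β a : ℝ) (N n : ℕ) : ℝ → ℝ :=
  (SGRG L)^[N - n] fun φ => a * (L : ℝ) ^ (-(N : ℝ) * (2 - β)) * Real.cos (Real.sqrt β * φ)

/-- index set -/
abbrev SGI := Fin 2 →₀ ℕ

theorem sg_aux {ι : Type*} [AddCommMonoid ι] [Finset.HasAntidiagonal ι] {f g : ι → ℝ}
    (h : Summable fun x : ι × ι => f x.1 * g x.2) :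
    Summable fun n : ι => ∑ kl ∈ Finset.HasAntidiagonal.antidiagonal n, f kl.1 * g kl.2 :=
  summable_sum_mul_antidiagonal_of_summable_mul (A := ι) (α := ℝ) (f := f) (g := g) h

theorem sg_summable_conv {ι : Type*} [AddCommMonoid ι] [Finset.HasAntidiagonal ι] {f g : ι → ℝ}
    (hf : Summable fun n => |f n|) (hg : Summable fun n => |g n|) :
    Summable (fun n => |∑ kl ∈ Finset.HasAntidiagonal.antidiagonal n, f kl.1 * g kl.2|) ∧
    (∑' n, |∑ kl ∈ Finset.HasAntidiagonal.antidiagonal n, f kl.1 * g kl.2|) ≤ (∑' n, |f n|) * ∑' n, |g n| := by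
  have h : Summable fun x : ι × ι => |f x.1| * |g x.2| :=
    hf.mul_of_nonneg hg (fun _ => abs_nonneg _) (fun _ => abs_nonneg _)
  have h1 : Summable fun n : ι => ∑ kl ∈ Finset.HasAntidiagonal.antidiagonal n, |f kl.1| * |g kl.2| :=
    sg_aux (f := fun n => |f n|) (g := fun n => |g n|) h
  have hle : ∀ n : ι, |∑ kl ∈ Finset.HasAntidiagonal.antidiagonal n, f kl.1 * g kl.2| ≤
      ∑ kl ∈ Finset.HasAntidiagonal.antidiagonal n, |f kl.1| * |g kl.2| := fun n =>
    (Finset.abs_sum_le_sum_abs _ _).trans (le_of_eq (Finset.sum_congr rfl fun _ _ => abs_mul _ _))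
  have h2 : Summable (fun n => |∑ kl ∈ Finset.HasAntidiagonal.antidiagonal n, f kl.1 * g kl.2|) :=
    Summable.of_nonneg_of_le (fun _ => abs_nonneg _) hle h1
  refine ⟨h2, ?_⟩
  rw [hf.tsum_mul_tsum_eq_tsum_sum_antidiagonal hg h]
  exact h2.tsum_le_tsum hle h1

theorem sg_tsum_conv {ι : Type*} [AddCommMonoid ι] [Finset.HasAntidiagonal ι] {f g : ι → ℂ}
    (hf : Summable fun n => ‖f n‖) (hg : Summable fun n => ‖g n‖) :
    (∑' n, f n) * ∑' n, g n = ∑' n, ∑ kl ∈ Finset.HasAntidiagonal.antidiagonal n, f kl.1 * g kl.2 :=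
  hf.of_norm.tsum_mul_tsum_eq_tsum_sum_antidiagonal hg.of_norm
      (summable_mul_of_summable_norm hf hg)

/-- The algebra of absolutely summable power series in two variables. -/
noncomputable def SGsub : Subalgebra ℝ (MvPowerSeries (Fin 2) ℝ) where
  carrier := {f | Summable fun n => |MvPowerSeries.coeff n f|}
  mul_mem' := by
    intro f g hf hg
    have := (sg_summable_conv hf hg).1
    simpa [MvPowerSeries.coeff_mul] using this
  add_mem' := by
    intro f g hf hg
    exact Summable.of_nonneg_of_le (fun _ => abs_nonneg _)
      (fun n => by rw [map_add]; exact abs_add_le _ _) (Summable.add hf hg)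
  algebraMap_mem' := by
    intro r
    refine summable_of_ne_finset_zero (s := {0}) ?_
    intro n hn
    rw [MvPowerSeries.algebraMap_apply, MvPowerSeries.coeff_C]
    simp at hn
    simp [hn]

/-- The algebra as a type. -/
def SGA : Type := SGsub

noncomputable instance SGcr : CommRing SGA := inferInstanceAs (CommRing SGsub)

noncomputable instance SGalg : Algebra ℝ SGA := inferInstanceAs (Algebra ℝ SGsub)

/-- coercion to power series -/
noncomputable def SGval : SGA →ₐ[ℝ] MvPowerSeries (Fin 2) ℝ := SGsub.val

/-- coefficients -/
noncomputable def SGc (n : SGI) (u : SGA) : ℝ := MvPowerSeries.coeff n (SGval u)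

theorem SGc_summable (u : SGA) : Summable fun n => |SGc n u| := Subtype.property (p := (· ∈ SGsub)) u

theorem SGc_ext {u v : SGA} (h : ∀ n, SGc n u = SGc n v) : u = v :=
  Subtype.ext (MvPowerSeries.ext h)

theorem SGc_add (n : SGI) (u v : SGA) : SGc n (u + v) = SGc n u + SGc n v := by simp [SGc]
theorem SGc_sub (n : SGI) (u v : SGA) : SGc n (u - v) = SGc n u - SGc n v := by simp [SGc]
theorem SGc_neg (n : SGI) (u : SGA) : SGc n (-u) = - SGc n u := by simp [SGc]
theorem SGc_zero (n : SGI) : SGc n 0 = 0 := by simp [SGc]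
theorem SGc_smul (n : SGI) (c : ℝ) (u : SGA) : SGc n (c • u) = c * SGc n u := by simp [SGc]
theorem SGc_one (n : SGI) : SGc n 1 = if n = 0 then 1 else 0 := by
  simp [SGc, MvPowerSeries.coeff_one]
theorem SGc_mul (n : SGI) (u v : SGA) :
    SGc n (u * v) = ∑ kl ∈ Finset.HasAntidiagonal.antidiagonal n, SGc kl.1 u * SGc kl.2 v := by
  simp [SGc, MvPowerSeries.coeff_mul]

/-- build an element from coefficients -/
noncomputable def SGmk (f : SGI → ℝ) (hf : Summable fun n => |f n|) : SGA :=
  (⟨fun n => f n, hf⟩ : SGsub)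

theorem SGc_mk (f : SGI → ℝ) (hf : Summable fun n => |f n|) (n : SGI) : SGc n (SGmk f hf) = f n := rfl

/-- map to l1 -/
noncomputable def SGtoLp : SGA →+ lp (fun _ : SGI => ℝ) 1 where
  toFun u := ⟨fun n => SGc n u, by
    apply memℓp_gen
    simpa using SGc_summable u⟩
  map_zero' := by ext n; simp [SGc_zero]
  map_add' u v := by ext n; exact SGc_add n u v

theorem SGtoLp_inj : Function.Injective SGtoLp := by
  intro u v h
  apply SGc_ext
  intro n
  have := congrArg (fun w : lp (fun _ : SGI => ℝ) 1 => w n) h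
  exact this

noncomputable instance SGnacg : NormedAddCommGroup SGA := NormedAddCommGroup.induced _ _ SGtoLp SGtoLp_inj

theorem SG_norm (u : SGA) : ‖u‖ = ∑' n, |SGc n u| := by
  have : ‖u‖ = ‖SGtoLp u‖ := rfl
  rw [this, lp.norm_eq_tsum_rpow (by simp)]
  simp [SGtoLp]

noncomputable instance SGncr : NormedCommRing SGA :=
  { SGnacg, SGcr with
    norm_mul_le := by
      intro u v
      rw [SG_norm, SG_norm, SG_norm]
      simp only [SGc_mul]
      exact (sg_summable_conv (SGc_summable u) (SGc_summable v)).2 }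

noncomputable instance SGna : NormedAlgebra ℝ SGA :=
  { SGalg with
    norm_smul_le := by
      intro c u
      rw [SG_norm, SG_norm]
      simp only [SGc_smul, abs_mul]
      rw [tsum_mul_left]; rfl }

instance SGcomplete : CompleteSpace SGA := by
  have hi : Isometry (SGtoLp : SGA → lp (fun _ : SGI => ℝ) 1) := by
    intro x y; rfl
  have hs : Function.Surjective SGtoLp := by
    intro w
    have hw := lp.memℓp w
    rw [memℓp_gen_iff (by simp)] at hw
    refine ⟨SGmk (fun n => w n) (by simpa using hw), ?_⟩
    ext n
    rfl
  exact (IsometryEquiv.mk' _ (Function.surjInv hs) (Function.surjInv_eq hs) hi).completeSpace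

theorem SGc_le (n : SGI) (u : SGA) : |SGc n u| ≤ ‖u‖ := by
  rw [SG_norm]
  exact (SGc_summable u).le_tsum n (fun _ _ => abs_nonneg _)

/-- coefficient functional -/
noncomputable def SGcL (n : SGI) : SGA →L[ℝ] ℝ :=
  LinearMap.mkContinuous
    { toFun := SGc n
      map_add' := SGc_add n
      map_smul' := fun c u => by simp [SGc_smul] } 1 (by
    intro u; simpa using SGc_le n u)

theorem SGcL_apply (n : SGI) (u : SGA) : SGcL n u = SGc n u := rfl

/-- multiplier estimates -/
theorem SG_mult_summable (d : SGI → ℝ) (K : ℝ) (hd : ∀ n, |d n| ≤ K) (u : SGA) :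
    Summable fun n => |d n * SGc n u| := by
  refine Summable.of_nonneg_of_le (fun _ => abs_nonneg _) (fun n => ?_) ((SGc_summable u).mul_left K)
  rw [abs_mul]
  exact mul_le_mul_of_nonneg_right (hd n) (abs_nonneg _)

/-- diagonal operators -/
noncomputable def SGdiag (d : SGI → ℝ) (K : ℝ) (hd : ∀ n, |d n| ≤ K) : SGA →L[ℝ] SGA :=
  LinearMap.mkContinuous
    { toFun := fun u => SGmk (fun n => d n * SGc n u) (SG_mult_summable d K hd u)
      map_add' := fun u v => SGc_ext fun n => by simp only [SGc_mk, SGc_add]; ring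
      map_smul' := fun c u => SGc_ext fun n => by
        simp only [SGc_mk, SGc_smul, RingHom.id_apply]; ring } K (by
    intro u
    rw [SG_norm, SG_norm, ← tsum_mul_left]
    refine Summable.tsum_le_tsum (fun n => ?_) (SG_mult_summable d K hd u)
      ((SGc_summable u).mul_left K)
    show |d n * SGc n u| ≤ _
    rw [abs_mul]
    exact mul_le_mul_of_nonneg_right (hd n) (abs_nonneg _))

theorem SGc_diag (d : SGI → ℝ) (K : ℝ) (hd : ∀ n, |d n| ≤ K) (n : SGI) (u : SGA) :
    SGc n (SGdiag d K hd u) = d n * SGc n u := rfl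

theorem SGdiag_norm (d : SGI → ℝ) (K : ℝ) (hd : ∀ n, |d n| ≤ K) (u : SGA) :
    ‖SGdiag d K hd u‖ ≤ K * ‖u‖ := by
  refine ContinuousLinearMap.le_of_opNorm_le _ ?_ u
  exact LinearMap.mkContinuous_norm_le _ ((abs_nonneg _).trans (hd 0)) _

/-- monomial -/
noncomputable def SGchi (X Y : ℂ) (n : SGI) : ℂ := X ^ n 0 * Y ^ n 1

theorem SGchi_add (X Y : ℂ) (n m : SGI) : SGchi X Y (n + m) = SGchi X Y n * SGchi X Y m := by
  simp only [SGchi, Finsupp.add_apply, pow_add]; ring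

theorem SGchi_norm {X Y : ℂ} (hX : ‖X‖ ≤ 1) (hY : ‖Y‖ ≤ 1) (n : SGI) : ‖SGchi X Y n‖ ≤ 1 := by
  rw [SGchi, norm_mul, norm_pow, norm_pow]
  exact mul_le_one₀ (pow_le_one₀ (norm_nonneg _) hX) (by positivity) (pow_le_one₀ (norm_nonneg _) hY)

theorem SGev_summable {X Y : ℂ} (hX : ‖X‖ ≤ 1) (hY : ‖Y‖ ≤ 1) (u : SGA) :
    Summable fun n => ‖(SGc n u : ℂ) * SGchi X Y n‖ := by
  refine Summable.of_nonneg_of_le (fun _ => norm_nonneg _) (fun n => ?_) (SGc_summable u)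
  rw [norm_mul, Complex.norm_real, Real.norm_eq_abs]
  exact mul_le_of_le_one_right (abs_nonneg _) (SGchi_norm hX hY n)

/-- evaluation homomorphism -/
noncomputable def SGev (X Y : ℂ) (hX : ‖X‖ ≤ 1) (hY : ‖Y‖ ≤ 1) : SGA →ₐ[ℝ] ℂ where
  toFun u := ∑' n, (SGc n u : ℂ) * SGchi X Y n
  map_one' := by
    rw [tsum_eq_single 0]
    · simp [SGc_one, SGchi]
    · intro n hn; simp [SGc_one, hn]
  map_zero' := by simp [SGc_zero]
  map_add' u v := by
    rw [← Summable.tsum_add (SGev_summable hX hY u).of_norm (SGev_summable hX hY v).of_norm]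
    refine tsum_congr fun n => ?_
    rw [SGc_add]; push_cast; ring
  map_mul' u v := by
    have hu := SGev_summable hX hY u
    have hv := SGev_summable hX hY v
    rw [sg_tsum_conv hu hv]
    refine tsum_congr fun n => ?_
    rw [SGc_mul]; push_cast
    rw [Finset.sum_mul]
    refine Finset.sum_congr rfl fun kl hkl => ?_
    rw [← Finset.HasAntidiagonal.mem_antidiagonal.1 hkl, SGchi_add]; ring
  commutes' c := by
    have h1 : ∀ n, SGc n (algebraMap ℝ SGA c) = if n = 0 then c else 0 := by
      intro n
      rw [Algebra.algebraMap_eq_smul_one, SGc_smul, SGc_one]; simp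
    rw [tsum_eq_single 0]
    · simp [h1, SGchi]
    · intro n hn; simp [h1, hn]

theorem SGev_apply (X Y : ℂ) (hX : ‖X‖ ≤ 1) (hY : ‖Y‖ ≤ 1) (u : SGA) :
    SGev X Y hX hY u = ∑' n, (SGc n u : ℂ) * SGchi X Y n := rfl

theorem SGev_norm (X Y : ℂ) (hX : ‖X‖ ≤ 1) (hY : ‖Y‖ ≤ 1) (u : SGA) :
    ‖SGev X Y hX hY u‖ ≤ ‖u‖ := by
  rw [SGev_apply, SG_norm]
  refine (norm_tsum_le_tsum_norm (SGev_summable hX hY u)).trans ?_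
  refine Summable.tsum_le_tsum (fun n => ?_) (SGev_summable hX hY u) (SGc_summable u)
  rw [norm_mul, Complex.norm_real, Real.norm_eq_abs]
  exact mul_le_of_le_one_right (abs_nonneg _) (SGchi_norm hX hY n)

theorem SGev_continuous (X Y : ℂ) (hX : ‖X‖ ≤ 1) (hY : ‖Y‖ ≤ 1) :
    Continuous (SGev X Y hX hY) :=
  AddMonoidHomClass.continuous_of_bound (SGev X Y hX hY) 1 (by simpa using SGev_norm X Y hX hY)

section ps
variable {A : Type*} [NormedCommRing A] [NormedAlgebra ℝ A]

/-- power series starting at order two -/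
noncomputable def SGps (c : ℕ → ℝ) (w : A) : A := ∑' m, c m • w ^ (m + 2)

/-- a numerical constant -/
noncomputable def SGK : ℝ := ∑' m : ℕ, ((m : ℝ) + 2) * (1 / 2) ^ m

theorem SGK_summable : Summable fun m : ℕ => ((m : ℝ) + 2) * (1 / 2) ^ m := by
  have h1 := summable_pow_mul_geometric_of_norm_lt_one (R := ℝ) 1 (r := 1 / 2) (by norm_num)
  have h2 := summable_geometric_of_lt_one (r := (1 / 2 : ℝ)) (by norm_num) (by norm_num)
  refine (h1.add (h2.mul_left 2)).congr fun m => ?_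
  ring

theorem SGK_nonneg : 0 ≤ SGK := tsum_nonneg fun m => by positivity

theorem sg_norm_pow_le (w : A) (m : ℕ) : ‖w ^ (m + 1)‖ ≤ ‖w‖ ^ (m + 1) :=
  norm_pow_le' w (Nat.succ_pos m)

theorem sg_pow_diff {M : ℝ} {w w' : A} (hw : ‖w‖ ≤ M) (hw' : ‖w'‖ ≤ M) (m : ℕ) :
    ‖w ^ (m + 1) - w' ^ (m + 1)‖ ≤ (m + 1) * M ^ m * ‖w - w'‖ := by
  have hM : 0 ≤ M := (norm_nonneg _).trans hw
  induction m with
  | zero => simp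
  | succ m ih =>
    have e : w ^ (m + 1 + 1) - w' ^ (m + 1 + 1) = w * (w ^ (m + 1) - w' ^ (m + 1)) + (w - w') * w' ^ (m + 1) := by
      ring
    rw [e]
    refine (norm_add_le _ _).trans ?_
    have h1 := norm_mul_le w (w ^ (m + 1) - w' ^ (m + 1))
    have h2 := norm_mul_le (w - w') (w' ^ (m + 1))
    have h3 : ‖w' ^ (m + 1)‖ ≤ M ^ (m + 1) :=
      (sg_norm_pow_le w' m).trans (pow_le_pow_left₀ (norm_nonneg _) hw' _)
    have h4 : ‖w‖ * ‖w ^ (m + 1) - w' ^ (m + 1)‖ ≤ M * ((m + 1) * M ^ m * ‖w - w'‖) :=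
      mul_le_mul hw ih (norm_nonneg _) hM
    have h5 : ‖w - w'‖ * ‖w' ^ (m + 1)‖ ≤ ‖w - w'‖ * M ^ (m + 1) :=
      mul_le_mul_of_nonneg_left h3 (norm_nonneg _)
    push_cast
    calc _ ≤ M * ((m + 1) * M ^ m * ‖w - w'‖) + ‖w - w'‖ * M ^ (m + 1) := by linarith
      _ = _ := by ring

theorem SGps_summable_norm {c : ℕ → ℝ} (hc : ∀ m, |c m| ≤ 1) {w : A} (hw : ‖w‖ ≤ 1 / 2) :
    Summable fun m => ‖c m • w ^ (m + 2)‖ := by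
  have h2 := summable_geometric_of_lt_one (r := (1 / 2 : ℝ)) (by norm_num) (by norm_num)
  refine Summable.of_nonneg_of_le (fun _ => norm_nonneg _) (fun m => ?_) h2
  rw [norm_smul, Real.norm_eq_abs]
  have h3 : ‖w ^ (m + 2)‖ ≤ (1 / 2) ^ (m + 2) :=
      (sg_norm_pow_le w (m + 1)).trans (pow_le_pow_left₀ (norm_nonneg _) hw _)
  calc |c m| * ‖w ^ (m + 2)‖ ≤ 1 * (1 / 2) ^ (m + 2) :=
        mul_le_mul (hc m) h3 (norm_nonneg _) (by norm_num)
    _ ≤ (1 / 2) ^ m := by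
        rw [one_mul]
        exact pow_le_pow_of_le_one (by norm_num) (by norm_num) (by omega)

theorem SGps_summable [CompleteSpace A] {c : ℕ → ℝ} (hc : ∀ m, |c m| ≤ 1) {w : A} (hw : ‖w‖ ≤ 1 / 2) :
    Summable fun m => c m • w ^ (m + 2) := (SGps_summable_norm hc hw).of_norm

theorem SGps_zero (c : ℕ → ℝ) : SGps c (0 : A) = 0 := by simp [SGps]

theorem SGps_lip [CompleteSpace A] {c : ℕ → ℝ} (hc : ∀ m, |c m| ≤ 1) {M : ℝ} (hM : M ≤ 1 / 2) {w w' : A}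
    (hw : ‖w‖ ≤ M) (hw' : ‖w'‖ ≤ M) : ‖SGps c w - SGps c w'‖ ≤ SGK * M * ‖w - w'‖ := by
  have hM0 : 0 ≤ M := (norm_nonneg _).trans hw
  rw [SGps, SGps, ← (SGps_summable hc (hw.trans hM)).tsum_sub (SGps_summable hc (hw'.trans hM))]
  have hb : ∀ m, ‖c m • w ^ (m + 2) - c m • w' ^ (m + 2)‖ ≤
      ((m : ℝ) + 2) * (1 / 2) ^ m * (M * ‖w - w'‖) := by
    intro m
    rw [← smul_sub, norm_smul, Real.norm_eq_abs]
    have h1 := sg_pow_diff hw hw' (m + 1)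
    push_cast at h1
    have h2 : |c m| * ‖w ^ (m + 2) - w' ^ (m + 2)‖ ≤ 1 * ‖w ^ (m + 2) - w' ^ (m + 2)‖ :=
      mul_le_mul_of_nonneg_right (hc m) (norm_nonneg _)
    have h3 : M ^ m ≤ (1 / 2) ^ m := pow_le_pow_left₀ hM0 hM m
    have h4 : ((m : ℝ) + 1 + 1) * M ^ (m + 1) * ‖w - w'‖ =
        (((m : ℝ) + 2) * M ^ m) * (M * ‖w - w'‖) := by ring
    have h5 : (((m : ℝ) + 2) * M ^ m) * (M * ‖w - w'‖) ≤
        ((m : ℝ) + 2) * (1 / 2) ^ m * (M * ‖w - w'‖) := by gcongr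
    rw [one_mul] at h2
    exact h2.trans (h1.trans (h4.le.trans h5))
  have hs := SGK_summable.mul_right (M * ‖w - w'‖)
  refine (tsum_of_norm_bounded hs.hasSum hb).trans (le_of_eq ?_)
  rw [tsum_mul_right, SGK]; ring

theorem SGps_map {B : Type*} [NormedCommRing B] [NormedAlgebra ℝ B] [CompleteSpace A]
    (f : A →ₐ[ℝ] B) (hf : Continuous f) {c : ℕ → ℝ} (hc : ∀ m, |c m| ≤ 1) {w : A} (hw : ‖w‖ ≤ 1 / 2) :
    f (SGps c w) = SGps c (f w) := by
  rw [SGps, SGps, (SGps_summable hc hw).map_tsum f hf]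
  simp

end ps

/-- coefficients of exp(-x) -/
noncomputable def SGce (m : ℕ) : ℝ := (-1) ^ m / (m + 2).factorial
/-- coefficients of log(1+x) -/
noncomputable def SGcl (m : ℕ) : ℝ := (-1) ^ (m + 1) / (m + 2)

theorem SGce_le (m : ℕ) : |SGce m| ≤ 1 := by
  rw [SGce, abs_div, abs_pow, abs_neg, abs_one, one_pow, Nat.abs_cast]
  apply div_le_one_of_le₀ _ (by positivity)
  exact_mod_cast Nat.factorial_pos _

theorem SGcl_le (m : ℕ) : |SGcl m| ≤ 1 := by
  rw [SGcl, abs_div, abs_pow, abs_neg, abs_one, one_pow]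
  apply div_le_one_of_le₀ _ (by positivity)
  rw [abs_of_nonneg (by positivity)]
  have : (0 : ℝ) ≤ m := by positivity
  linarith

theorem SGps_exp (x : ℝ) : Real.exp (-x) = 1 - x + SGps SGce x := by
  have h := NormedSpace.expSeries_div_hasSum_exp (𝔸 := ℝ) (-x)
  rw [← Real.exp_eq_exp_ℝ] at h
  have h2 := h.summable.sum_add_tsum_nat_add 2
  rw [h.tsum_eq] at h2
  rw [← h2, SGps]
  simp only [Finset.sum_range_succ, Finset.sum_range_zero, smul_eq_mul, SGce]
  congr 1
  · simp; ring
  · refine tsum_congr fun m => ?_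
    rw [neg_pow, pow_add]; ring

theorem SGps_log {x : ℝ} (hx : |x| < 1) : Real.log (1 + x) = x + SGps SGcl x := by
  have h := (Real.hasSum_pow_div_log_of_abs_lt_one (x := -x) (by rwa [abs_neg])).neg
  rw [neg_neg, sub_neg_eq_add] at h
  have h2 := h.summable.sum_add_tsum_nat_add 1
  rw [h.tsum_eq] at h2
  rw [← h2, SGps]
  simp only [Finset.sum_range_succ, Finset.sum_range_zero, smul_eq_mul, SGcl]
  congr 1
  · simp
  · refine tsum_congr fun m => ?_
    rw [neg_pow, show m + 1 + 1 = m + 2 from rfl, pow_succ (-1 : ℝ) (m + 1)]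
    push_cast
    ring

/-- parameters -/
structure SGpar where
  /-- scale -/
  ell : ℝ
  /-- inverse temperature -/
  be : ℝ
  h1 : 1 < ell
  h0 : 0 < be
  h2 : be < 2

namespace SGpar
variable (P : SGpar)

/-- contraction factor -/
noncomputable def q : ℝ := P.ell ^ (-(2 - P.be))

theorem q_pos : 0 < P.q := Real.rpow_pos_of_pos (by linarith [P.h1]) _
theorem q_lt : P.q < 1 := Real.rpow_lt_one_of_one_lt_of_neg P.h1 (by linarith [P.h2])

/-- dilation multiplier -/
noncomputable def dD (n : SGI) : ℝ := P.q ^ (n 0 + n 1)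
/-- Gaussian multiplier -/
noncomputable def dE (n : SGI) : ℝ := P.ell ^ (-(P.be * ((n 0 : ℝ) - n 1) ^ 2))
/-- projection multiplier -/
noncomputable def dP (n : SGI) : ℝ := if n 0 = n 1 ∨ n 0 + n 1 < 2 then 0 else 1

theorem dD_le (n : SGI) : |P.dD n| ≤ 1 := by
  rw [dD, abs_of_nonneg (pow_nonneg P.q_pos.le _)]
  exact pow_le_one₀ P.q_pos.le P.q_lt.le

theorem dE_le (n : SGI) : |P.dE n| ≤ 1 := by
  rw [dE, abs_of_nonneg (Real.rpow_nonneg (by linarith [P.h1]) _)]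
  apply Real.rpow_le_one_of_one_le_of_nonpos P.h1.le
  have := P.h0
  have : 0 ≤ P.be * ((n 0 : ℝ) - n 1) ^ 2 := by positivity
  linarith

theorem dP_le (n : SGI) : |dP n| ≤ 1 := by
  rw [dP]; split_ifs <;> simp

/-- linear part multiplier -/
noncomputable def dT (n : SGI) : ℝ := P.ell ^ 2 * P.dE n * P.dD n

theorem dT_eq (n : SGI) : P.dT n =
    P.ell ^ (2 - P.be * ((n 0 : ℝ) - n 1) ^ 2 - (2 - P.be) * ((n 0 : ℝ) + n 1)) := by
  have hl : 0 < P.ell := by linarith [P.h1]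
  rw [dT, dE, dD, q, ← Real.rpow_natCast (_ ^ _), ← Real.rpow_mul hl.le, ← Real.rpow_natCast P.ell 2,
    ← Real.rpow_add hl, ← Real.rpow_add hl]
  congr 1
  push_cast; ring

theorem dT_one (n : SGI) (hn : n 0 + n 1 = 1) : P.dT n = 1 := by
  rw [dT_eq]
  have h : (n 0 = 0 ∧ n 1 = 1) ∨ (n 0 = 1 ∧ n 1 = 0) := by omega
  rcases h with ⟨a, b⟩ | ⟨a, b⟩
  all_goals
    rw [a, b]
    rw [show (2 - P.be * _ - _ : ℝ) = 0 by push_cast; ring, Real.rpow_zero]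

theorem dPT_le (n : SGI) : |dP n * P.dT n| ≤ P.q := by
  rw [dP]
  split_ifs with h
  · simpa using P.q_pos.le
  · push Not at h
    rw [one_mul, dT_eq, abs_of_nonneg (Real.rpow_nonneg (by linarith [P.h1]) _), q]
    apply Real.rpow_le_rpow_of_exponent_le P.h1.le
    have h1 : (1 : ℝ) ≤ ((n 0 : ℝ) - n 1) ^ 2 := by
      have hz : ((n 0 : ℤ) - n 1) ≠ 0 := by have := h.1; omega
      have h3 : (1 : ℤ) ≤ ((n 0 : ℤ) - n 1) ^ 2 := by
        have := pow_pos (abs_pos.2 hz) 2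
        rw [sq_abs] at this
        omega
      exact_mod_cast h3
    have h2 : (2 : ℝ) ≤ (n 0 : ℝ) + n 1 := by exact_mod_cast h.2
    have := P.h0
    have := P.h2
    nlinarith

/-- dilation operator -/
noncomputable def D : SGA →L[ℝ] SGA := SGdiag P.dD 1 P.dD_le
/-- Gaussian operator -/
noncomputable def E : SGA →L[ℝ] SGA := SGdiag P.dE 1 P.dE_le
/-- projection operator -/
noncomputable def Pr : SGA →L[ℝ] SGA := SGdiag dP 1 dP_le
/-- contracting linear part -/
noncomputable def Li : SGA →L[ℝ] SGA := SGdiag (fun n => dP n * P.dT n) P.q P.dPT_le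

theorem D_norm (u : SGA) : ‖P.D u‖ ≤ ‖u‖ := (SGdiag_norm P.dD 1 P.dD_le u).trans_eq (one_mul _)
theorem E_norm (u : SGA) : ‖P.E u‖ ≤ ‖u‖ := (SGdiag_norm P.dE 1 P.dE_le u).trans_eq (one_mul _)
theorem Pr_norm (u : SGA) : ‖Pr u‖ ≤ ‖u‖ := (SGdiag_norm dP 1 dP_le u).trans_eq (one_mul _)
theorem Li_norm (u : SGA) : ‖P.Li u‖ ≤ P.q * ‖u‖ := SGdiag_norm _ _ _ u

/-- fluctuation integral minus one -/
noncomputable def Y (u : SGA) : SGA := P.E (- P.D u + SGps SGce (P.D u))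
/-- RG map on the algebra -/
noncomputable def T (u : SGA) : SGA := (-(P.ell ^ 2)) • (P.Y u + SGps SGcl (P.Y u))
/-- nonlinear part of the RG map -/
noncomputable def NL (u : SGA) : SGA :=
  (-(P.ell ^ 2)) • (P.E (SGps SGce (P.D u)) + SGps SGcl (P.Y u))

theorem T_eq (u : SGA) : P.T u = (P.ell ^ 2) • P.E (P.D u) + P.NL u := by
  rw [T, NL, Y, map_add, map_neg]
  module

/-- constant -/
noncomputable def K2 : ℝ := P.ell ^ 2 * (SGK + SGK * (1 + SGK) ^ 2)

theorem K2_nonneg : 0 ≤ P.K2 := by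
  have := SGK_nonneg
  rw [K2]; positivity

theorem Y_lip {M : ℝ} (hM : (1 + SGK) * M ≤ 1 / 2) {u u' : SGA} (hu : ‖u‖ ≤ M) (hu' : ‖u'‖ ≤ M) :
    ‖P.Y u - P.Y u'‖ ≤ (1 + SGK) * ‖u - u'‖ := by
  have hK := SGK_nonneg
  have hM0 : 0 ≤ M := (norm_nonneg _).trans hu
  have hM1 : M ≤ 1 / 2 := by nlinarith
  have e : P.Y u - P.Y u' = P.E (- P.D (u - u') + (SGps SGce (P.D u) - SGps SGce (P.D u'))) := by
    rw [Y, Y, ← map_sub, map_sub P.D]; congr 1; abel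
  rw [e]
  refine (P.E_norm _).trans ((norm_add_le _ _).trans ?_)
  rw [norm_neg]
  have h1 := P.D_norm (u - u')
  have h2 := SGps_lip SGce_le hM1 ((P.D_norm u).trans hu) ((P.D_norm u').trans hu')
  rw [← map_sub] at h2
  have h3 : SGK * M * ‖P.D (u - u')‖ ≤ SGK * 1 * ‖u - u'‖ := by
    gcongr
    linarith
  linarith

theorem Y_zero : P.Y 0 = 0 := by simp [Y, SGps_zero]
theorem NL_zero : P.NL 0 = 0 := by simp [NL, SGps_zero, Y_zero]

theorem Y_norm {M : ℝ} (hM : (1 + SGK) * M ≤ 1 / 2) {u : SGA} (hu : ‖u‖ ≤ M) :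
    ‖P.Y u‖ ≤ (1 + SGK) * M := by
  have hK := SGK_nonneg
  have hM0 : 0 ≤ M := (norm_nonneg _).trans hu
  have := P.Y_lip hM hu (u' := 0) (by simpa using hM0)
  rw [Y_zero, sub_zero, sub_zero] at this
  refine this.trans ?_
  gcongr

theorem NL_lip {M : ℝ} (hM : (1 + SGK) * M ≤ 1 / 2) {u u' : SGA} (hu : ‖u‖ ≤ M) (hu' : ‖u'‖ ≤ M) :
    ‖P.NL u - P.NL u'‖ ≤ P.K2 * M * ‖u - u'‖ := by
  have hK := SGK_nonneg
  have hM0 : 0 ≤ M := (norm_nonneg _).trans hu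
  have hM1 : M ≤ 1 / 2 := by nlinarith
  have e : P.NL u - P.NL u' = (-(P.ell ^ 2)) • (P.E (SGps SGce (P.D u) - SGps SGce (P.D u'))
      + (SGps SGcl (P.Y u) - SGps SGcl (P.Y u'))) := by
    rw [NL, NL, map_sub]; module
  rw [e, norm_smul, norm_neg, Real.norm_of_nonneg (sq_nonneg _)]
  have h2 := SGps_lip SGce_le hM1 ((P.D_norm u).trans hu) ((P.D_norm u').trans hu')
  rw [← map_sub] at h2
  have h3 : SGK * M * ‖P.D (u - u')‖ ≤ SGK * M * ‖u - u'‖ := by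
    gcongr
    exact P.D_norm _
  have h4 := SGps_lip SGcl_le hM (P.Y_norm hM hu) (P.Y_norm hM hu')
  have h5 : SGK * ((1 + SGK) * M) * ‖P.Y u - P.Y u'‖ ≤
      SGK * ((1 + SGK) * M) * ((1 + SGK) * ‖u - u'‖) := by
    gcongr
    exact P.Y_lip hM hu hu'
  have h6 : ‖P.E (SGps SGce (P.D u) - SGps SGce (P.D u'))
      + (SGps SGcl (P.Y u) - SGps SGcl (P.Y u'))‖ ≤
      SGK * M * ‖u - u'‖ + SGK * ((1 + SGK) * M) * ((1 + SGK) * ‖u - u'‖) := by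
    refine (norm_add_le _ _).trans ?_
    have := P.E_norm (SGps SGce (P.D u) - SGps SGce (P.D u'))
    linarith
  calc _ ≤ P.ell ^ 2 * (SGK * M * ‖u - u'‖ + SGK * ((1 + SGK) * M) * ((1 + SGK) * ‖u - u'‖)) := by
        gcongr
    _ = _ := by rw [K2]; ring

/-- low degree coefficients vanish -/
theorem coeff_mul_low {u v : SGA} (hu : SGc 0 u = 0) (hv : SGc 0 v = 0) {n : SGI}
    (hn : n 0 + n 1 ≤ 1) : SGc n (u * v) = 0 := by
  rw [SGc_mul]
  refine Finset.sum_eq_zero fun kl hkl => ?_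
  have h := Finset.HasAntidiagonal.mem_antidiagonal.1 hkl
  have h0 : kl.1 0 + kl.2 0 = n 0 := by rw [← h]; rfl
  have h1 : kl.1 1 + kl.2 1 = n 1 := by rw [← h]; rfl
  have hz : ∀ m : SGI, m 0 = 0 → m 1 = 0 → m = 0 := by
    intro m a b
    ext i
    fin_cases i
    · exact a
    · exact b
  by_cases hk : kl.1 0 = 0 ∧ kl.1 1 = 0
  · rw [hz _ hk.1 hk.2, hu, zero_mul]
  · rw [hz kl.2 (by omega) (by omega), hv, mul_zero]

theorem coeff_pow_zero {u : SGA} (hu : SGc 0 u = 0) (m : ℕ) : SGc 0 (u ^ (m + 1)) = 0 := by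
  rw [pow_succ, SGc_mul]
  simp [hu]

theorem coeff_ps_low {c : ℕ → ℝ} (hc : ∀ m, |c m| ≤ 1) {w : SGA} (hw : ‖w‖ ≤ 1 / 2)
    (hw0 : SGc 0 w = 0) {n : SGI} (hn : n 0 + n 1 ≤ 1) : SGc n (SGps c w) = 0 := by
  rw [← SGcL_apply, SGps, (SGcL n).map_tsum (SGps_summable hc hw)]
  refine (tsum_congr fun m => ?_).trans tsum_zero
  rw [SGcL_apply, SGc_smul, pow_succ' w (m + 1), coeff_mul_low hw0 (coeff_pow_zero hw0 m) hn, mul_zero]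

theorem NL_low {M : ℝ} (hM : (1 + SGK) * M ≤ 1 / 2) {u : SGA} (hu : ‖u‖ ≤ M) (h0 : SGc 0 u = 0)
    {n : SGI} (hn : n 0 + n 1 ≤ 1) : SGc n (P.NL u) = 0 := by
  have hK := SGK_nonneg
  have hM0 : 0 ≤ M := (norm_nonneg _).trans hu
  have hM1 : M ≤ 1 / 2 := by nlinarith
  have hD0 : SGc 0 (P.D u) = 0 := by rw [D, SGc_diag, h0, mul_zero]
  have hDn : ‖P.D u‖ ≤ 1 / 2 := (P.D_norm u).trans (hu.trans hM1)
  have hY0 : SGc 0 (P.Y u) = 0 := by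
    rw [Y, E, SGc_diag, SGc_add, SGc_neg, hD0, coeff_ps_low SGce_le hDn hD0 (by simp)]
    simp
  rw [NL, SGc_smul, SGc_add, E, SGc_diag, coeff_ps_low SGce_le hDn hD0 hn,
    coeff_ps_low SGcl_le ((P.Y_norm hM hu).trans hM) hY0 hn]
  simp

end SGpar

namespace SGpar
variable (P : SGpar)

/-- first degree one index -/
noncomputable def i0 : SGI := Finsupp.single 0 1
/-- second degree one index -/
noncomputable def i1 : SGI := Finsupp.single 1 1

theorem i0_ne_i1 : i0 ≠ i1 := by
  intro h
  have := DFunLike.congr_fun h 0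
  simp [i0, i1] at this

/-- coefficients of the initial potential -/
noncomputable def cu0 (r : ℝ) (n : SGI) : ℝ := if n ∈ ({i0, i1} : Finset SGI) then r / 2 else 0

theorem cu0_summable (r : ℝ) : Summable fun n => |cu0 r n| := by
  refine summable_of_ne_finset_zero (s := {i0, i1}) fun n hn => ?_
  rw [cu0, if_neg hn, abs_zero]

/-- initial potential -/
noncomputable def u0 (r : ℝ) : SGA := SGmk (cu0 r) (cu0_summable r)

theorem u0_norm {r : ℝ} (hr : 0 ≤ r) : ‖u0 r‖ = r := by
  rw [SG_norm, tsum_eq_sum (s := {i0, i1})]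
  · rw [Finset.sum_pair i0_ne_i1]
    simp only [u0, SGc_mk, cu0]
    rw [if_pos (by simp), if_pos (by simp), abs_of_nonneg (by linarith)]; ring
  · intro n hn
    rw [u0, SGc_mk, cu0, if_neg hn, abs_zero]

theorem u0_coeff (r : ℝ) {n : SGI} (hn : n 0 + n 1 ≠ 1) : SGc n (u0 r) = 0 := by
  rw [u0, SGc_mk, cu0, if_neg]
  intro h
  rw [Finset.mem_insert, Finset.mem_singleton] at h
  rcases h with h | h <;> rw [h] at hn <;> simp [i0, i1] at hn

/-- the reduced RG map -/
noncomputable def S (r : ℝ) (d : SGA) : SGA := P.Li d + Pr (P.NL (u0 r + d))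

/-- smallness condition on r -/
def Small (r : ℝ) : Prop :=
  0 < r ∧ r ≤ 1 ∧ (1 + SGK) * (2 * r) ≤ 1 / 2 ∧ 2 * P.K2 * (2 * r) ≤ 1 - P.q

theorem exists_small : ∃ r, P.Small r := by
  have hK := SGK_nonneg
  have hK2 := P.K2_nonneg
  have hq := P.q_lt
  refine ⟨min 1 (min (1 / (4 * (1 + SGK))) ((1 - P.q) / (4 * (P.K2 + 1)))), ?_, ?_, ?_, ?_⟩
  · refine lt_min one_pos (lt_min (by positivity) (div_pos (by linarith) (by positivity)))
  · exact min_le_left _ _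
  · have h : min 1 (min (1 / (4 * (1 + SGK))) ((1 - P.q) / (4 * (P.K2 + 1)))) ≤ 1 / (4 * (1 + SGK)) :=
      (min_le_right _ _).trans (min_le_left _ _)
    rw [le_div_iff₀ (by positivity)] at h
    linarith
  · have h : min 1 (min (1 / (4 * (1 + SGK))) ((1 - P.q) / (4 * (P.K2 + 1)))) ≤
        (1 - P.q) / (4 * (P.K2 + 1)) :=
      (min_le_right _ _).trans (min_le_right _ _)
    have h0 : 0 ≤ min 1 (min (1 / (4 * (1 + SGK))) ((1 - P.q) / (4 * (P.K2 + 1)))) :=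
      le_min zero_le_one (le_min (by positivity) (div_nonneg (by linarith) (by positivity)))
    rw [le_div_iff₀ (by positivity)] at h
    linarith

variable {P} {r : ℝ}

theorem u0d_norm (hr : P.Small r) {d : SGA} (hd : ‖d‖ ≤ r) : ‖u0 r + d‖ ≤ 2 * r := by
  refine (norm_add_le _ _).trans ?_
  rw [u0_norm hr.1.le]; linarith

theorem S_lip (hr : P.Small r) {d d' : SGA} (hd : ‖d‖ ≤ r) (hd' : ‖d'‖ ≤ r) :
    ‖P.S r d - P.S r d'‖ ≤ (1 + P.q) / 2 * ‖d - d'‖ := by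
  have e : P.S r d - P.S r d' = P.Li (d - d') + Pr (P.NL (u0 r + d) - P.NL (u0 r + d')) := by
    rw [S, S, map_sub, map_sub]; abel
  rw [e]
  have h1 := P.Li_norm (d - d')
  have h2 := Pr_norm (P.NL (u0 r + d) - P.NL (u0 r + d'))
  have h3 := P.NL_lip hr.2.2.1 (u0d_norm hr hd) (u0d_norm hr hd')
  rw [add_sub_add_left_eq_sub] at h3
  have h4 : P.K2 * (2 * r) * ‖d - d'‖ ≤ (1 - P.q) / 2 * ‖d - d'‖ := by
    gcongr
    linarith [hr.2.2.2]
  refine (norm_add_le _ _).trans ?_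
  linarith

theorem S_ball (hr : P.Small r) {d : SGA} (hd : ‖d‖ ≤ r) : ‖P.S r d‖ ≤ r := by
  have h1 := P.Li_norm d
  have h2 := Pr_norm (P.NL (u0 r + d))
  have h3 := P.NL_lip hr.2.2.1 (u0d_norm hr hd) (u' := 0) (by rw [norm_zero]; linarith [hr.1])
  rw [P.NL_zero, sub_zero, sub_zero] at h3
  have h4 : P.K2 * (2 * r) * ‖u0 r + d‖ ≤ (1 - P.q) / 2 * (2 * r) := by
    have := P.K2_nonneg
    have := hr.1
    apply mul_le_mul _ (u0d_norm hr hd) (norm_nonneg _) (by linarith [P.q_lt])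
    linarith [hr.2.2.2]
  have h5 : P.q * ‖d‖ ≤ P.q * r := mul_le_mul_of_nonneg_left hd P.q_pos.le
  refine (norm_add_le _ _).trans ?_
  linarith

theorem iter_ball (hr : P.Small r) (j : ℕ) : ‖(P.S r)^[j] 0‖ ≤ r := by
  induction j with
  | zero => simpa using hr.1.le
  | succ j ih => rw [Function.iterate_succ_apply']; exact S_ball hr ih

theorem exists_fixed (hr : P.Small r) : ∃ d : SGA, ‖d‖ ≤ r ∧ P.S r d = d ∧
    Tendsto (fun j => (P.S r)^[j] 0) atTop (nhds d) := by
  have hq : (1 + P.q) / 2 < 1 := by linarith [P.q_lt]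
  have hq0 : 0 ≤ (1 + P.q) / 2 := by linarith [P.q_pos]
  have hg : ∀ j, dist ((P.S r)^[j] 0) ((P.S r)^[j + 1] 0) ≤ r * ((1 + P.q) / 2) ^ j := by
    intro j
    induction j with
    | zero =>
      rw [dist_comm, dist_eq_norm]
      simpa using iter_ball hr 1
    | succ j ih =>
      rw [Function.iterate_succ_apply', Function.iterate_succ_apply' _ (j + 1), dist_eq_norm]
      refine (S_lip hr (iter_ball hr j) (iter_ball hr (j + 1))).trans ?_
      rw [dist_eq_norm] at ih
      calc _ ≤ (1 + P.q) / 2 * (r * ((1 + P.q) / 2) ^ j) := by gcongr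
        _ = _ := by ring
  have hc := cauchySeq_of_le_geometric _ _ hq hg
  obtain ⟨d, hd⟩ := cauchySeq_tendsto_of_complete hc
  have hdr : ‖d‖ ≤ r := le_of_tendsto hd.norm (Eventually.of_forall (iter_ball hr))
  refine ⟨d, hdr, ?_, hd⟩
  have h1 : Tendsto (fun j => P.S r ((P.S r)^[j] 0)) atTop (nhds (P.S r d)) := by
    rw [tendsto_iff_norm_sub_tendsto_zero] at hd ⊢
    refine squeeze_zero (fun _ => norm_nonneg _) (fun j => S_lip hr (iter_ball hr j) hdr) ?_
    simpa using hd.const_mul ((1 + P.q) / 2)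
  have h2 : Tendsto (fun j => (P.S r)^[j + 1] 0) atTop (nhds d) := hd.comp (tendsto_add_atTop_nat 1)
  simp only [Function.iterate_succ_apply'] at h2
  exact tendsto_nhds_unique h1 h2

theorem S_coeff (d : SGA) {n : SGI} (hn : n 0 = n 1 ∨ n 0 + n 1 < 2) : SGc n (P.S r d) = 0 := by
  rw [S, SGc_add, Li, Pr, SGc_diag, SGc_diag, dP, if_pos hn]; simp

theorem T_coeff (hr : P.Small r) {d : SGA} (hd : ‖d‖ ≤ r) (hd0 : ∀ n : SGI, (n 0 = n 1 ∨ n 0 + n 1 < 2) → SGc n d = 0)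
    {n : SGI} (hn : n 0 ≠ n 1) : SGc n (P.T (u0 r + d)) = SGc n (u0 r + P.S r d) := by
  rw [T_eq, SGc_add, SGc_smul, E, SGc_diag, D, SGc_diag, SGc_add]
  by_cases h : n 0 + n 1 < 2
  · have h1 : n 0 + n 1 = 1 := by omega
    have h00 : SGc 0 (u0 r + d) = 0 := by
      rw [SGc_add, u0_coeff r (by simp), hd0 0 (by simp), add_zero]
    rw [SGc_add, S_coeff d (Or.inr h), hd0 n (Or.inr h), P.NL_low hr.2.2.1 (u0d_norm hr hd) h00 h1.le]
    have := P.dT_one n h1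
    rw [dT] at this
    rw [add_zero, add_zero, ← mul_assoc, ← mul_assoc, this, one_mul]
  · have h0 := u0_coeff r (n := n) (by omega)
    rw [SGc_add, h0, S, SGc_add, Li, Pr, SGc_diag, SGc_diag, dP, if_neg (by tauto), dT]
    ring

end SGpar

namespace SGpar
variable (P : SGpar)

/-- first variable -/
noncomputable def vX (x φ : ℝ) : ℂ := x * Complex.exp ((Real.sqrt P.be * φ : ℝ) * Complex.I)
/-- second variable -/
noncomputable def vY (x φ : ℝ) : ℂ := x * Complex.exp ((-(Real.sqrt P.be * φ) : ℝ) * Complex.I)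

theorem vX_norm {x : ℝ} (hx : |x| ≤ 1) (φ : ℝ) : ‖P.vX x φ‖ ≤ 1 := by
  rw [vX, norm_mul, Complex.norm_exp_ofReal_mul_I, Complex.norm_real, mul_one]; exact hx
theorem vY_norm {x : ℝ} (hx : |x| ≤ 1) (φ : ℝ) : ‖P.vY x φ‖ ≤ 1 := by
  rw [vY, norm_mul, Complex.norm_exp_ofReal_mul_I, Complex.norm_real, mul_one]; exact hx

/-- evaluation -/
noncomputable def ev (x : ℝ) (hx : |x| ≤ 1) (φ : ℝ) : SGA →ₐ[ℝ] ℂ :=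
  SGev (P.vX x φ) (P.vY x φ) (P.vX_norm hx φ) (P.vY_norm hx φ)

/-- character -/
noncomputable def ch (x φ : ℝ) (n : SGI) : ℂ :=
  ((x ^ (n 0 + n 1) : ℝ) : ℂ) * Complex.exp ((((n 0 : ℝ) - n 1) * Real.sqrt P.be * φ : ℝ) * Complex.I)

theorem chi_eq (x φ : ℝ) (n : SGI) : SGchi (P.vX x φ) (P.vY x φ) n = P.ch x φ n := by
  rw [SGchi, vX, vY, mul_pow, mul_pow, ← Complex.exp_nat_mul, ← Complex.exp_nat_mul, ch]
  rw [mul_mul_mul_comm, ← pow_add, ← Complex.exp_add]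
  push_cast
  congr 2
  ring

theorem ev_apply (x : ℝ) (hx : |x| ≤ 1) (φ : ℝ) (u : SGA) :
    P.ev x hx φ u = ∑' n, (SGc n u : ℂ) * P.ch x φ n := by
  rw [ev, SGev_apply]
  exact tsum_congr fun n => by rw [chi_eq]

theorem ch_norm {x : ℝ} (φ : ℝ) (n : SGI) : ‖P.ch x φ n‖ = |x| ^ (n 0 + n 1) := by
  rw [ch, norm_mul, Complex.norm_exp_ofReal_mul_I, mul_one, Complex.norm_real, norm_pow]; rfl

theorem ev_summable {x : ℝ} (hx : |x| ≤ 1) (φ : ℝ) (u : SGA) :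
    Summable fun n => (SGc n u : ℂ) * P.ch x φ n := by
  have := (SGev_summable (P.vX_norm hx φ) (P.vY_norm hx φ) u).of_norm
  simpa only [chi_eq] using this

theorem ev_norm (x : ℝ) (hx : |x| ≤ 1) (φ : ℝ) (u : SGA) : ‖P.ev x hx φ u‖ ≤ ‖u‖ :=
  SGev_norm _ _ _ _ u

theorem ev_cont (x : ℝ) (hx : |x| ≤ 1) (φ : ℝ) : Continuous (P.ev x hx φ) :=
  SGev_continuous _ _ _ _

theorem ev_D (x : ℝ) (hx : |x| ≤ 1) (hqx : |P.q * x| ≤ 1) (φ : ℝ) (u : SGA) :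
    P.ev (P.q * x) hqx φ u = P.ev x hx φ (P.D u) := by
  rw [ev_apply, ev_apply]
  refine tsum_congr fun n => ?_
  rw [D, SGc_diag, dD, ch, ch, mul_pow]
  push_cast; ring

theorem ch_cont (x : ℝ) (n : SGI) : Continuous fun φ => P.ch x φ n := by
  unfold ch; fun_prop

theorem ev_cont_phi (x : ℝ) (hx : |x| ≤ 1) (u : SGA) : Continuous fun φ => P.ev x hx φ u := by
  simp only [ev_apply]
  refine continuous_tsum (u := fun n => |SGc n u|) (fun n => (P.ch_cont x n).const_mul _) (SGc_summable u)
    (fun n φ => ?_)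
  rw [norm_mul, ch_norm, Complex.norm_real, Real.norm_eq_abs]
  exact mul_le_of_le_one_right (abs_nonneg _) (pow_le_one₀ (abs_nonneg _) hx)

theorem ch_integral (x φ : ℝ) (n : SGI) :
    ∫ z, P.ch x (φ + z) n ∂(gaussianReal 0 (2 * Real.log P.ell).toNNReal) = P.dE n * P.ch x φ n := by
  have h1 : ∀ z, P.ch x (φ + z) n = P.ch x φ n *
      Complex.exp (((((n 0 : ℝ) - n 1) * Real.sqrt P.be : ℝ) : ℂ) * z * Complex.I) := by
    intro z
    rw [ch, ch, mul_assoc (Complex.ofReal (x ^ (n 0 + n 1))), ← Complex.exp_add]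
    congr 2
    push_cast; ring
  simp_rw [h1]
  rw [integral_const_mul, ← charFun_apply_real, charFun_gaussianReal, mul_comm]
  congr 1
  have hl : 0 < P.ell := by linarith [P.h1]
  have hlog : 0 ≤ 2 * Real.log P.ell := by have := Real.log_pos P.h1; linarith
  rw [dE, Real.rpow_def_of_pos hl, Complex.ofReal_exp]
  congr 1
  have hs : ((Real.sqrt P.be : ℝ) : ℂ) ^ 2 = (P.be : ℂ) := by
    rw [← Complex.ofReal_pow, Real.sq_sqrt P.h0.le]
  have hv : (((2 * Real.log P.ell).toNNReal : ℝ) : ℂ) = ((2 * Real.log P.ell : ℝ) : ℂ) := by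
    rw [Real.coe_toNNReal _ hlog]
  rw [hv]
  push_cast
  rw [mul_pow, hs]
  ring

theorem ev_E (x : ℝ) (hx : |x| ≤ 1) (φ : ℝ) (u : SGA) :
    ∫ z, P.ev x hx (φ + z) u ∂(gaussianReal 0 (2 * Real.log P.ell).toNNReal) =
      P.ev x hx φ (P.E u) := by
  simp_rw [ev_apply]
  have hb : ∀ (n : SGI) (z : ℝ), ‖(SGc n u : ℂ) * P.ch x (φ + z) n‖ ≤ |SGc n u| := by
    intro n z
    rw [norm_mul, ch_norm, Complex.norm_real, Real.norm_eq_abs]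
    exact mul_le_of_le_one_right (abs_nonneg _) (pow_le_one₀ (abs_nonneg _) hx)
  have hi : ∀ n : SGI, Integrable (fun z => (SGc n u : ℂ) * P.ch x (φ + z) n)
      (gaussianReal 0 (2 * Real.log P.ell).toNNReal) := by
    intro n
    refine Integrable.of_bound ?_ (|SGc n u|) (Eventually.of_forall (hb n))
    have : Continuous fun z => (SGc n u : ℂ) * P.ch x (φ + z) n :=
      ((P.ch_cont x n).comp (continuous_const.add continuous_id)).const_mul _
    exact this.aestronglyMeasurable
  rw [← integral_tsum_of_summable_integral_norm hi]
  · refine tsum_congr fun n => ?_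
    rw [integral_const_mul, ch_integral, E, SGc_diag]
    push_cast; ring
  · refine Summable.of_nonneg_of_le (fun n => integral_nonneg fun _ => norm_nonneg _) (fun n => ?_)
      (SGc_summable u)
    refine (integral_mono (hi n).norm (integrable_const (|SGc n u|)) (hb n)).trans ?_
    simp

theorem rg_step (L : ℕ) (hL : P.ell = L) {M : ℝ} (hM : (1 + SGK) * M ≤ 1 / 2) {u : SGA} (hu : ‖u‖ ≤ M)
    (x : ℝ) (hx : |x| ≤ 1) (hqx : |P.q * x| ≤ 1) (v : ℝ → ℝ)
    (hv : ∀ φ, (v φ : ℂ) = P.ev (P.q * x) hqx φ u) (φ : ℝ) :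
    (SGRG L v φ : ℂ) = P.ev x hx φ (P.T u) := by
  have hK := SGK_nonneg
  have hM0 : 0 ≤ M := (norm_nonneg _).trans hu
  have hM1 : M ≤ 1 / 2 := by nlinarith
  have hDn : ‖P.D u‖ ≤ 1 / 2 := (P.D_norm u).trans (hu.trans hM1)
  have hYn : ‖P.Y u‖ ≤ 1 / 2 := (P.Y_norm hM hu).trans hM
  have cast_ps : ∀ (c : ℕ → ℝ) (y : ℝ), (∀ m, |c m| ≤ 1) → ‖y‖ ≤ 1 / 2 →
      ((SGps c y : ℝ) : ℂ) = SGps c (y : ℂ) := fun c y hc hy =>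
    SGps_map Complex.ofRealAm Complex.continuous_ofReal hc hy
  have hexp : ∀ ψ, ((Real.exp (-(v ψ)) : ℝ) : ℂ) =
      P.ev x hx ψ (1 + (- P.D u + SGps SGce (P.D u))) := by
    intro ψ
    have hvψ : (v ψ : ℂ) = P.ev x hx ψ (P.D u) := by rw [hv, P.ev_D x hx hqx]
    have hvn : ‖v ψ‖ ≤ 1 / 2 := by
      rw [← Complex.norm_real, hvψ]; exact (P.ev_norm _ _ _ _).trans hDn
    rw [SGps_exp]
    push_cast
    rw [cast_ps _ _ SGce_le hvn, map_add, map_add, map_neg, map_one,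
      SGps_map (P.ev x hx ψ) (P.ev_cont x hx ψ) SGce_le hDn, ← hvψ]
    ring
  set I := ∫ z, Real.exp (-(v (φ + z))) ∂(gaussianReal 0 (2 * Real.log L).toNNReal) with hI
  have hE1 : P.E 1 = 1 := by
    refine SGc_ext fun n => ?_
    rw [E, SGc_diag, SGc_one]
    split_ifs with h
    · rw [h, dE]; simp
    · simp
  have hIc : (I : ℂ) = 1 + P.ev x hx φ (P.Y u) := by
    rw [hI, ← integral_complex_ofReal]
    simp_rw [hexp]
    rw [← hL, ev_E, map_add, map_add, hE1, map_one, Y]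
  have hY : ((I - 1 : ℝ) : ℂ) = P.ev x hx φ (P.Y u) := by
    push_cast; rw [hIc]; ring
  have hYv : ‖I - 1‖ ≤ 1 / 2 := by
    rw [← Complex.norm_real, hY]; exact (P.ev_norm _ _ _ _).trans hYn
  have hlog : Real.log I = (I - 1) + SGps SGcl (I - 1) := by
    rw [← SGps_log (by rw [← Real.norm_eq_abs]; linarith)]
    congr 1; ring
  have : SGRG L v φ = -(P.ell ^ 2) * ((I - 1) + SGps SGcl (I - 1)) := by
    rw [SGRG, ← hlog, hL, hI]
  rw [this, T, map_smul, map_add, SGps_map (P.ev x hx φ) (P.ev_cont x hx φ) SGcl_le hYn, ← hY,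
    ← cast_ps _ _ SGcl_le hYv]
  simp
  ring

theorem ev_neutral {u u' : SGA} (h : ∀ n : SGI, n 0 ≠ n 1 → SGc n u = SGc n u') (x : ℝ) (hx : |x| ≤ 1) :
    ∃ c : ℝ, ∀ φ, P.ev x hx φ u = P.ev x hx φ u' + c := by
  refine ⟨∑' n : SGI, (SGc n u - SGc n u') * x ^ (n 0 + n 1), fun φ => ?_⟩
  rw [← sub_eq_iff_eq_add', ← map_sub, ev_apply, Complex.ofReal_tsum]
  refine tsum_congr fun n => ?_
  rw [SGc_sub]
  by_cases hn : n 0 = n 1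
  · rw [ch, hn]; simp
  · rw [h n hn]; simp

theorem ev_u0 (r x : ℝ) (hx : |x| ≤ 1) (φ : ℝ) :
    P.ev x hx φ (u0 r) = ((r * x * Real.cos (Real.sqrt P.be * φ) : ℝ) : ℂ) := by
  rw [ev_apply, tsum_eq_sum (s := {i0, i1})]
  · rw [Finset.sum_pair i0_ne_i1]
    simp only [u0, SGc_mk, cu0]
    rw [if_pos (by simp), if_pos (by simp)]
    simp only [ch, i0, i1]
    rw [Complex.ofReal_mul _ (Real.cos _), Complex.ofReal_cos, Complex.cos]
    simp
    ring
  · intro n hn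
    rw [u0, SGc_mk, cu0, if_neg hn]; simp

end SGpar

/-- bounded continuous functions -/
def SGgood (f : ℝ → ℝ) : Prop := Continuous f ∧ ∃ M : ℝ, ∀ φ, |f φ| ≤ M

/-- the Gaussian measure -/
noncomputable abbrev SGgam (L : ℕ) : Measure ℝ := gaussianReal 0 (2 * Real.log L).toNNReal

theorem SGgood.integrable {f : ℝ → ℝ} (hf : SGgood f) (L : ℕ) (φ : ℝ) :
    Integrable (fun z => Real.exp (-(f (φ + z)))) (SGgam L) := by
  obtain ⟨hc, M, hM⟩ := hf
  refine Integrable.of_bound (C := Real.exp M) ?_ (Eventually.of_forall fun z => ?_)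
  · have : Continuous fun z => Real.exp (-(f (φ + z))) := by fun_prop
    exact this.aestronglyMeasurable
  · rw [Real.norm_eq_abs, Real.abs_exp]
    exact Real.exp_le_exp.2 (by linarith [neg_abs_le (f (φ + z)), hM (φ + z)])

theorem SGgood.int_bounds {f : ℝ → ℝ} (hf : SGgood f) {M : ℝ} (hM : ∀ φ, |f φ| ≤ M) (L : ℕ) (φ : ℝ) :
    Real.exp (-M) ≤ ∫ z, Real.exp (-(f (φ + z))) ∂(SGgam L) ∧
    ∫ z, Real.exp (-(f (φ + z))) ∂(SGgam L) ≤ Real.exp M := by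
  constructor
  · have := integral_mono (integrable_const (Real.exp (-M))) (hf.integrable L φ)
      (fun z => Real.exp_le_exp.2 (by linarith [le_abs_self (f (φ + z)), hM (φ + z)]))
    simpa using this
  · have := integral_mono (hf.integrable L φ) (integrable_const (Real.exp M))
      (fun z => Real.exp_le_exp.2 (by linarith [neg_abs_le (f (φ + z)), hM (φ + z)]))
    simpa using this

theorem SGgood.int_pos {f : ℝ → ℝ} (hf : SGgood f) (L : ℕ) (φ : ℝ) :
    0 < ∫ z, Real.exp (-(f (φ + z))) ∂(SGgam L) := by
  obtain ⟨M, hM⟩ := hf.2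
  exact (Real.exp_pos _).trans_le (hf.int_bounds hM L φ).1

theorem SGgood.rg {f : ℝ → ℝ} (hf : SGgood f) (L : ℕ) : SGgood (SGRG L f) := by
  obtain ⟨M, hM⟩ := hf.2
  have hc := hf.1
  constructor
  · have h1 : Continuous fun φ => ∫ z, Real.exp (-(f (φ + z))) ∂(SGgam L) := by
      refine continuous_of_dominated (bound := fun _ => Real.exp M) (fun φ => ?_) (fun φ => ?_)
        (integrable_const _) ?_
      · exact (hf.integrable L φ).1
      · refine Eventually.of_forall fun z => ?_
        rw [Real.norm_eq_abs, Real.abs_exp]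
        exact Real.exp_le_exp.2 (by linarith [neg_abs_le (f (φ + z)), hM (φ + z)])
      · refine Eventually.of_forall fun z => ?_
        fun_prop
    exact (h1.log fun φ => (hf.int_pos L φ).ne').const_mul _
  · refine ⟨(L : ℝ) ^ 2 * M, fun φ => ?_⟩
    rw [SGRG, abs_mul, abs_neg, abs_of_nonneg (sq_nonneg (L : ℝ))]
    gcongr
    have hb := hf.int_bounds hM L φ
    rw [abs_le]
    constructor
    · rw [Real.le_log_iff_exp_le (hf.int_pos L φ)]; exact hb.1
    · rw [Real.log_le_iff_le_exp (hf.int_pos L φ)]; exact hb.2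

theorem SGgood.rg_le {f g : ℝ → ℝ} (hf : SGgood f) (hg : SGgood g) (L : ℕ) {e : ℝ}
    (h : ∀ φ, f φ - g φ ≤ e) (φ : ℝ) : SGRG L f φ - SGRG L g φ ≤ (L : ℝ) ^ 2 * e := by
  have h1 : ∫ z, Real.exp (-(g (φ + z))) ∂(SGgam L) ≤
      Real.exp e * ∫ z, Real.exp (-(f (φ + z))) ∂(SGgam L) := by
    rw [← integral_const_mul]
    refine integral_mono (hg.integrable L φ) ((hf.integrable L φ).const_mul _) fun z => ?_
    show _ ≤ Real.exp e * Real.exp (-(f (φ + z)))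
    rw [← Real.exp_add]
    exact Real.exp_le_exp.2 (by linarith [h (φ + z)])
  have h2 := Real.log_le_log (hg.int_pos L φ) h1
  rw [Real.log_mul (Real.exp_pos _).ne' (hf.int_pos L φ).ne', Real.log_exp] at h2
  have h3 := mul_le_mul_of_nonneg_left h2 (sq_nonneg (L : ℝ))
  rw [SGRG, SGRG]
  linarith

theorem SGgood.rg_lip {f g : ℝ → ℝ} (hf : SGgood f) (hg : SGgood g) (L : ℕ) {e : ℝ}
    (h : ∀ φ, |f φ - g φ| ≤ e) (φ : ℝ) : |SGRG L f φ - SGRG L g φ| ≤ (L : ℝ) ^ 2 * e := by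
  rw [abs_sub_le_iff]
  exact ⟨hf.rg_le hg L (fun φ => (abs_sub_le_iff.1 (h φ)).1) φ,
    hg.rg_le hf L (fun φ => (abs_sub_le_iff.1 (h φ)).2) φ⟩

theorem SGgood.sub_const {f : ℝ → ℝ} (hf : SGgood f) (c : ℝ) : SGgood fun φ => f φ - c := by
  obtain ⟨hc, M, hM⟩ := hf
  refine ⟨by fun_prop, M + |c|, fun φ => ?_⟩
  exact (abs_sub _ _).trans (by linarith [hM φ])

theorem SGgood.rg_const {f : ℝ → ℝ} (hf : SGgood f) (L : ℕ) (c φ : ℝ) :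
    SGRG L (fun φ => f φ - c) φ = SGRG L f φ - (L : ℝ) ^ 2 * c := by
  have h1 : ∀ z, Real.exp (-(f (φ + z) - c)) = Real.exp c * Real.exp (-(f (φ + z))) := by
    intro z; rw [← Real.exp_add]; congr 1; ring
  rw [SGRG, SGRG]
  simp_rw [h1]
  rw [integral_const_mul, Real.log_mul (Real.exp_pos _).ne' (hf.int_pos L φ).ne', Real.log_exp]
  ring

theorem SGgood.iter {f : ℝ → ℝ} (hf : SGgood f) (L : ℕ) (j : ℕ) : SGgood ((SGRG L)^[j] f) := by
  induction j with
  | zero => exact hf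
  | succ j ih => rw [Function.iterate_succ_apply']; exact ih.rg L

namespace SGpar
variable {P : SGpar} {r : ℝ}

theorem good_cos (P : SGpar) (b : ℝ) : SGgood fun φ => b * Real.cos (Real.sqrt P.be * φ) := by
  refine ⟨by fun_prop, |b|, fun φ => ?_⟩
  rw [abs_mul]
  exact mul_le_of_le_one_right (abs_nonneg _) (Real.abs_cos_le_one _)

theorem qy {y : ℝ} (P : SGpar) (hy : |y| ≤ 1) : |P.q * y| ≤ 1 := by
  rw [abs_mul, abs_of_pos P.q_pos]
  exact mul_le_one₀ P.q_lt.le (abs_nonneg _) hy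

theorem iter_low (j : ℕ) (n : SGI) (hn : n 0 = n 1 ∨ n 0 + n 1 < 2) : SGc n ((P.S r)^[j] 0) = 0 := by
  cases j with
  | zero => exact SGc_zero n
  | succ j => rw [Function.iterate_succ_apply']; exact S_coeff _ hn

theorem flow (hr : P.Small r) (L : ℕ) (hL : P.ell = L) (j : ℕ) : ∀ (y : ℝ) (hy : |y| ≤ 1),
    ∃ c : ℝ, ∀ φ, (((SGRG L)^[j] (fun φ => r * (P.q ^ j * y) * Real.cos (Real.sqrt P.be * φ)) φ - c : ℝ) : ℂ) =
      P.ev y hy φ (u0 r + (P.S r)^[j] 0) := by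
  induction j with
  | zero =>
    intro y hy
    refine ⟨0, fun φ => ?_⟩
    simp only [Function.iterate_zero, id, add_zero, ev_u0, pow_zero, one_mul, sub_zero]
  | succ j ih =>
    intro y hy
    obtain ⟨c, hc⟩ := ih (P.q * y) (P.qy hy)
    obtain ⟨c2, hc2⟩ := P.ev_neutral (fun n hn => T_coeff hr (iter_ball hr j) (iter_low j) hn) y hy
    refine ⟨(L : ℝ) ^ 2 * c + c2, fun φ => ?_⟩
    have h := P.rg_step L hL hr.2.2.1 (u0d_norm hr (iter_ball hr j)) y hy (P.qy hy) _ hc φ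
    have e : (fun φ => r * (P.q ^ (j + 1) * y) * Real.cos (Real.sqrt P.be * φ)) =
        (fun φ => r * (P.q ^ j * (P.q * y)) * Real.cos (Real.sqrt P.be * φ)) := by
      funext φ; ring
    rw [((P.good_cos _).iter L j).rg_const, hc2] at h
    rw [e, Function.iterate_succ_apply', Function.iterate_succ_apply' (P.S r)]
    rw [← sub_eq_iff_eq_add] at h
    rw [← h]
    push_cast
    ring

/-- limit potential -/
noncomputable def V (P : SGpar) (r : ℝ) (d : SGA) (y : ℝ) (hy : |y| ≤ 1) (φ : ℝ) : ℝ :=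
  (P.ev y hy φ (u0 r + d)).re

theorem V_good (d : SGA) (y : ℝ) (hy : |y| ≤ 1) : SGgood (P.V r d y hy) :=
  ⟨Complex.continuous_re.comp (P.ev_cont_phi y hy _), ‖u0 r + d‖, fun φ =>
    (Complex.abs_re_le_norm _).trans (P.ev_norm _ _ _ _)⟩

theorem V_real (hr : P.Small r) (L : ℕ) (hL : P.ell = L) {d : SGA}
    (hd : Tendsto (fun j => (P.S r)^[j] 0) atTop (nhds d)) (y : ℝ) (hy : |y| ≤ 1) (φ : ℝ) :
    (P.V r d y hy φ : ℂ) = P.ev y hy φ (u0 r + d) := by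
  have h1 : Tendsto (fun j => (P.ev y hy φ (u0 r + (P.S r)^[j] 0)).im) atTop
      (nhds (P.ev y hy φ (u0 r + d)).im) :=
    ((Complex.continuous_im.comp (P.ev_cont y hy φ)).tendsto _).comp (hd.const_add (u0 r))
  have h2 : ∀ j, (P.ev y hy φ (u0 r + (P.S r)^[j] 0)).im = 0 := by
    intro j
    obtain ⟨c, hc⟩ := flow hr L hL j y hy
    rw [← hc φ, Complex.ofReal_im]
  simp only [h2] at h1
  have h3 := tendsto_nhds_unique h1 tendsto_const_nhds
  apply Complex.ext
  · simp [V]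
  · rw [Complex.ofReal_im, h3]

theorem V_rg (hr : P.Small r) (L : ℕ) (hL : P.ell = L) {d : SGA} (hdr : ‖d‖ ≤ r) (hfix : P.S r d = d)
    (hd : Tendsto (fun j => (P.S r)^[j] 0) atTop (nhds d)) (y : ℝ) (hy : |y| ≤ 1) :
    ∃ k : ℝ, ∀ φ, SGRG L (P.V r d (P.q * y) (P.qy hy)) φ - P.V r d y hy φ = k := by
  obtain ⟨c2, hc2⟩ := P.ev_neutral (fun n hn => T_coeff hr hdr
    (fun n hn => by rw [← hfix]; exact S_coeff _ hn) hn) y hy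
  refine ⟨c2, fun φ => ?_⟩
  have h := P.rg_step L hL hr.2.2.1 (u0d_norm hr hdr) y hy (P.qy hy) _
    (V_real hr L hL hd (P.q * y) (P.qy hy)) φ
  rw [hc2, hfix, ← V_real hr L hL hd] at h
  have h' : SGRG L (P.V r d (P.q * y) (P.qy hy)) φ = P.V r d y hy φ + c2 := by exact_mod_cast h
  rw [h']; ring

theorem V_conv (hr : P.Small r) (L : ℕ) (hL : P.ell = L) {d : SGA}
    (hd : Tendsto (fun j => (P.S r)^[j] 0) atTop (nhds d)) (y : ℝ) (hy : |y| ≤ 1) :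
    ∃ c : ℕ → ℝ, ∀ e > 0, ∀ᶠ j in atTop, ∀ φ,
      |P.V r d y hy φ - ((SGRG L)^[j] (fun φ => r * (P.q ^ j * y) * Real.cos (Real.sqrt P.be * φ)) φ - c j)| < e := by
  choose c hc using fun j => flow hr L hL j y hy
  refine ⟨c, fun e he => ?_⟩
  have h1 := (tendsto_iff_norm_sub_tendsto_zero.1 hd).eventually (gt_mem_nhds he)
  filter_upwards [h1] with j hj φ
  have h2 : ‖P.ev y hy φ (u0 r + d) - P.ev y hy φ (u0 r + (P.S r)^[j] 0)‖ < e := by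
    rw [← map_sub, add_sub_add_left_eq_sub]
    refine (P.ev_norm _ _ _ _).trans_lt ?_
    rwa [norm_sub_rev]
  rw [← hc j φ, ← V_real hr L hL hd, ← Complex.ofReal_sub, Complex.norm_real] at h2
  exact h2

/-- charge -/
def kk (n : SGI) : ℕ := ((n 0 : ℤ) - n 1).natAbs

theorem cos_kk (n : SGI) (t φ : ℝ) :
    Real.cos (((n 0 : ℝ) - n 1) * t * φ) = Real.cos ((kk n : ℝ) * t * φ) := by
  have h : ((kk n : ℕ) : ℝ) = |(n 0 : ℝ) - n 1| := by
    rw [kk, Nat.cast_natAbs]; push_cast; rfl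
  rw [h]
  rcases abs_choice ((n 0 : ℝ) - n 1) with h | h
  · rw [h]
  · rw [h, ← Real.cos_neg]; congr 1; ring

theorem modes (hr : P.Small r) {d : SGA} (hdr : ‖d‖ ≤ r) (hfix : P.S r d = d)
    (y : ℝ) (hy0 : 0 ≤ y) (hy : |y| ≤ 1) (p : ℕ) (hp : 1 ≤ p) :
    ∃ (μ : ℕ → ℝ) (w : ℝ → ℝ),
      (∀ φ, P.V r d y hy φ =
        (∑ k ∈ Finset.Icc 1 p, μ k * Real.cos ((k : ℝ) * Real.sqrt P.be * φ)) + w φ) ∧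
      |μ 1 - r * y| ≤ y ^ 2 ∧ (∀ k, 2 ≤ k → |μ k| ≤ y ^ k) ∧ (∀ φ, |w φ| ≤ y ^ p) := by
  have hd1 : ‖d‖ ≤ 1 := hdr.trans hr.2.1
  have hy1 : y ≤ 1 := (le_abs_self y).trans hy
  have hlow : ∀ n : SGI, (n 0 = n 1 ∨ n 0 + n 1 < 2) → SGc n d = 0 := fun n hn => by
    rw [← hfix]; exact S_coeff _ hn
  -- generic bound
  have gen : ∀ (f : SGI → ℝ) (m : ℕ), (∀ n, |f n| ≤ |SGc n d| * y ^ m) →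
      Summable f ∧ |∑' n, f n| ≤ y ^ m := by
    intro f m hf
    have hs := (SGc_summable d).mul_right (y ^ m)
    have hf' : ∀ n, ‖f n‖ ≤ |SGc n d| * y ^ m := hf
    refine ⟨hs.of_norm_bounded hf', ?_⟩
    have h1 : ‖∑' n, f n‖ ≤ ∑' n, |SGc n d| * y ^ m := tsum_of_norm_bounded hs.hasSum hf'
    refine h1.trans ?_
    rw [tsum_mul_right, ← SG_norm]
    exact mul_le_of_le_one_left (pow_nonneg hy0 _) hd1
  have hterm : ∀ (n : SGI) (m : ℕ), m ≤ n 0 + n 1 → |SGc n d * y ^ (n 0 + n 1)| ≤ |SGc n d| * y ^ m := by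
    intro n m hm
    rw [abs_mul, abs_of_nonneg (pow_nonneg hy0 _)]
    exact mul_le_mul_of_nonneg_left (pow_le_pow_of_le_one hy0 hy1 hm) (abs_nonneg _)
  have hkk : ∀ n, kk n ≤ n 0 + n 1 := fun n => by rw [kk]; omega
  let F : ℕ → SGI → ℝ := fun k n => if kk n = k then SGc n d * y ^ (n 0 + n 1) else 0
  let G : ℝ → SGI → ℝ := fun φ n =>
    if p < kk n then SGc n d * y ^ (n 0 + n 1) * Real.cos ((kk n : ℝ) * Real.sqrt P.be * φ) else 0
  have hF : ∀ k n, |F k n| ≤ |SGc n d| * y ^ k := by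
    intro k n
    by_cases h : kk n = k
    · simp only [F, if_pos h]
      exact hterm n k (h ▸ hkk n)
    · simp only [F, if_neg h, abs_zero]; positivity
  have hF1 : ∀ k n, |F k n| ≤ |SGc n d| * y ^ 2 := by
    intro k n
    by_cases h : kk n = k
    · simp only [F, if_pos h]
      by_cases h2 : n 0 + n 1 < 2
      · rw [hlow n (Or.inr h2)]; simp
      · exact hterm n 2 (by omega)
    · simp only [F, if_neg h, abs_zero]; positivity
  have hG : ∀ φ n, |G φ n| ≤ |SGc n d| * y ^ p := by
    intro φ n
    by_cases h : p < kk n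
    · simp only [G, if_pos h]
      rw [abs_mul]
      exact (mul_le_of_le_one_right (abs_nonneg _) (Real.abs_cos_le_one _)).trans
        (hterm n p (h.le.trans (hkk n)))
    · simp only [G, if_neg h, abs_zero]; positivity
  refine ⟨fun k => (if k = 1 then r * y else 0) + ∑' n, F k n, fun φ => ∑' n, G φ n, ?_, ?_, ?_, ?_⟩
  · intro φ
    have hV : P.V r d y hy φ = r * y * Real.cos (Real.sqrt P.be * φ) +
        ∑' n, SGc n d * y ^ (n 0 + n 1) * Real.cos ((kk n : ℝ) * Real.sqrt P.be * φ) := by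
      rw [V, map_add, ev_u0, Complex.add_re, Complex.ofReal_re, ev_apply, Complex.re_tsum (P.ev_summable hy φ d)]
      congr 1
      refine tsum_congr fun n => ?_
      rw [ch, ← mul_assoc, ← Complex.ofReal_mul, Complex.re_ofReal_mul, Complex.exp_ofReal_mul_I_re, cos_kk]
    have hdec : ∀ n, SGc n d * y ^ (n 0 + n 1) * Real.cos ((kk n : ℝ) * Real.sqrt P.be * φ) =
        (∑ k ∈ Finset.Icc 1 p, F k n * Real.cos ((k : ℝ) * Real.sqrt P.be * φ)) + G φ n := by
      intro n
      by_cases h0 : kk n = 0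
      · have : SGc n d = 0 := hlow n (Or.inl (by rw [kk] at h0; omega))
        simp [F, G, this]
      by_cases h : p < kk n
      · have hz : ∑ k ∈ Finset.Icc 1 p, F k n * Real.cos ((k : ℝ) * Real.sqrt P.be * φ) = 0 := by
          refine Finset.sum_eq_zero fun k hk => ?_
          have := (Finset.mem_Icc.1 hk).2
          simp only [F]
          rw [if_neg (by omega), zero_mul]
        rw [hz, zero_add]
        simp only [G, if_pos h]
      · rw [Finset.sum_eq_single (kk n)]
        · simp only [F, G, if_neg h, if_true, add_zero]
        · intro k _ hk
          simp only [F]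
          rw [if_neg (fun h => hk h.symm), zero_mul]
        · intro hk
          exact absurd (Finset.mem_Icc.2 ⟨by omega, by omega⟩) hk
    have hFs : ∀ k, Summable fun n => F k n * Real.cos ((k : ℝ) * Real.sqrt P.be * φ) := fun k =>
      (gen (F k) k (hF k)).1.mul_right _
    rw [hV, tsum_congr hdec, Summable.tsum_add (summable_sum fun k _ => hFs k) (gen (G φ) p (hG φ)).1,
      Summable.tsum_finsetSum fun k _ => hFs k]
    simp only [add_mul, Finset.sum_add_distrib, tsum_mul_right, ite_mul, zero_mul]
    rw [Finset.sum_ite_eq' (Finset.Icc 1 p) 1, if_pos (Finset.mem_Icc.2 ⟨le_rfl, hp⟩)]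
    push_cast
    rw [one_mul]; ring
  · simp only [if_true, add_sub_cancel_left]
    exact (gen (F 1) 2 (hF1 1)).2
  · intro k hk
    simp only [if_neg (show k ≠ 1 by omega), zero_add]
    exact (gen (F k) k (hF k)).2
  · intro φ
    exact (gen (G φ) p (hG φ)).2

end SGpar

theorem SGp_pos {β : ℝ} (hβ2 : β < 2) : 1 ≤ pSG β := by
  have hne : {p : ℕ | 0 < p ∧ 2 < (2 / 3 : ℝ) * p * (2 - β)}.Nonempty := by
    obtain ⟨m, hm⟩ := exists_nat_gt (3 / (2 - β))
    have h2 : 0 < 2 - β := by linarith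
    rw [div_lt_iff₀ h2] at hm
    refine ⟨m, ?_, by linarith⟩
    rcases Nat.eq_zero_or_pos m with h | h
    · subst h; norm_num at hm
    · exact h
  exact (Nat.sInf_mem hne).1

theorem SGv_good (L : ℕ) (β a : ℝ) (N n : ℕ) : SGgood (SGv L β a N n) := by
  refine SGgood.iter ⟨by fun_prop, |a * (L : ℝ) ^ (-(N : ℝ) * (2 - β))|, fun φ => ?_⟩ L _
  rw [abs_mul]
  exact mul_le_of_le_one_right (abs_nonneg _) (Real.abs_cos_le_one _)

theorem SGv_succ (L : ℕ) (β a : ℝ) {N n : ℕ} (h : n + 1 ≤ N) :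
    SGv L β a N n = SGRG L (SGv L β a N (n + 1)) := by
  have e : N - n = (N - (n + 1)) + 1 := by omega
  rw [SGv, SGv, e, Function.iterate_succ_apply']

/-- convergence of the potentials at scale `n` -/
def SGconv (L : ℕ) (β a : ℝ) (n : ℕ) (f : ℝ → ℝ) : Prop :=
  SGgood f ∧ ∃ c : ℕ → ℝ, TendstoUniformly (fun N φ => SGv L β a N n φ - c N) f atTop

theorem SGconv.down {L : ℕ} (hL : 2 ≤ L) {β a : ℝ} {n : ℕ} {f : ℝ → ℝ} (h : SGconv L β a (n + 1) f) :
    SGconv L β a n (SGRG L f) := by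
  obtain ⟨hf, c, hc⟩ := h
  refine ⟨hf.rg L, fun N => (L : ℝ) ^ 2 * c N, ?_⟩
  have hLp : (0 : ℝ) < (L : ℝ) ^ 2 := by
    have : (0 : ℝ) < L := by exact_mod_cast (by omega : 0 < L)
    positivity
  rw [Metric.tendstoUniformly_iff] at hc ⊢
  intro e he
  filter_upwards [hc (e / (2 * (L : ℝ) ^ 2)) (by positivity), eventually_ge_atTop (n + 1)] with N h1 h2 φ
  have hg := SGv_good L β a N (n + 1)
  rw [SGv_succ L β a h2, ← hg.rg_const, Real.dist_eq]
  have h3 := hf.rg_lip (hg.sub_const (c N)) L (e := e / (2 * (L : ℝ) ^ 2)) (fun φ => by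
    have := h1 φ
    rw [Real.dist_eq] at this
    exact this.le) φ
  have e1 : (L : ℝ) ^ 2 * (e / (2 * (L : ℝ) ^ 2)) = e / 2 := by field_simp
  rw [e1] at h3
  linarith

/-- extension of the limit potentials to low scales -/
noncomputable def SGext (L : ℕ) (n0 : ℕ) (U : ℕ → ℝ → ℝ) (n : ℕ) : ℝ → ℝ :=
  (SGRG L)^[n0 - n] (U (n + (n0 - n)))

theorem SGext_ge {L n0 : ℕ} {U : ℕ → ℝ → ℝ} {n : ℕ} (h : n0 ≤ n) : SGext L n0 U n = U n := by
  rw [SGext, Nat.sub_eq_zero_of_le h]; rfl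

theorem SGext_lt {L n0 : ℕ} {U : ℕ → ℝ → ℝ} {n : ℕ} (h : n < n0) :
    SGext L n0 U n = SGRG L (SGext L n0 U (n + 1)) := by
  have e : n0 - n = (n0 - (n + 1)) + 1 := by omega
  have e2 : n + (n0 - (n + 1) + 1) = n + 1 + (n0 - (n + 1)) := by omega
  rw [SGext, SGext, e, Function.iterate_succ_apply', e2]

theorem SGext_conv {L : ℕ} (hL : 2 ≤ L) {β a : ℝ} {n0 : ℕ} {U : ℕ → ℝ → ℝ}
    (h : ∀ n, n0 ≤ n → SGconv L β a n (U n)) (n : ℕ) : SGconv L β a n (SGext L n0 U n) := by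
  rcases le_or_gt n0 n with hn | hn
  · rw [SGext_ge hn]; exact h n hn
  · have key : ∀ i n, n + i = n0 → SGconv L β a n (SGext L n0 U n) := by
      intro i
      induction i with
      | zero => intro n hn; rw [SGext_ge (by omega)]; exact h n (by omega)
      | succ i ih =>
        intro n hn
        rw [SGext_lt (by omega)]
        exact (ih (n + 1) (by omega)).down hL
    exact key (n0 - n) n (by omega)

/-- the mode decomposition with constant `C` -/
def SGdec (β m : ℝ) (p : ℕ) (C : ℝ) (f : ℝ → ℝ) : Prop :=
  ∃ (μ : ℕ → ℝ) (w : ℝ → ℝ),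
    (∀ φ : ℝ, f φ = (∑ k ∈ Finset.Icc 1 p, μ k * Real.cos ((k : ℝ) * Real.sqrt β * φ)) + w φ) ∧
    |μ 1 - m| ≤ C * m ^ ((3 : ℝ) / 2) ∧
    (∀ k, 2 ≤ k → k ≤ p → |μ k| ≤ C * m ^ ((2 * k : ℝ) / 3)) ∧
    (∀ φ, |w φ| ≤ C * m ^ ((2 * p : ℝ) / 3))

theorem SGdec.mono {β m : ℝ} (hm : 0 < m) {p : ℕ} {C C' : ℝ} {f : ℝ → ℝ} (h : SGdec β m p C f)
    (hC : C ≤ C') : SGdec β m p C' f := by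
  obtain ⟨μ, w, h1, h2, h3, h4⟩ := h
  refine ⟨μ, w, h1, h2.trans ?_, fun k hk hk' => (h3 k hk hk').trans ?_, fun φ => (h4 φ).trans ?_⟩ <;>
  exact mul_le_mul_of_nonneg_right hC (Real.rpow_nonneg hm.le _)

theorem SGdec.of_good (β : ℝ) {m : ℝ} (hm : 0 < m) (p : ℕ) {f : ℝ → ℝ} (hf : SGgood f) :
    ∃ C, SGdec β m p C f := by
  obtain ⟨-, M, hM⟩ := hf
  have hM0 : 0 ≤ M := (abs_nonneg _).trans (hM 0)
  have ha : 0 < m ^ ((3 : ℝ) / 2) := Real.rpow_pos_of_pos hm _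
  have hb : 0 < m ^ ((2 * p : ℝ) / 3) := Real.rpow_pos_of_pos hm _
  have h1 : 0 ≤ m / m ^ ((3 : ℝ) / 2) := by positivity
  have h2 : 0 ≤ M / m ^ ((2 * p : ℝ) / 3) := by positivity
  refine ⟨m / m ^ ((3 : ℝ) / 2) + M / m ^ ((2 * p : ℝ) / 3), fun _ => 0, f, fun φ => by simp, ?_,
    fun k _ _ => ?_, fun φ => (hM φ).trans ?_⟩
  · rw [zero_sub, abs_neg, abs_of_pos hm, ← div_le_iff₀ ha]; linarith
  · rw [abs_zero]; exact mul_nonneg (by linarith) (Real.rpow_nonneg hm.le _)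
  · rw [← div_le_iff₀ hb]; linarith

theorem SGpow_bd {r m y : ℝ} (hr : 0 < r) (hr1 : r ≤ 1) (hm : 0 < m) (hy : y = m / r) (hy1 : y ≤ 1)
    (p j : ℕ) {e : ℝ} (he : e ≤ j) (hep : e ≤ p) : y ^ j ≤ (1 / r) ^ p * m ^ e := by
  have hy0 : 0 < y := by rw [hy]; positivity
  have h1 : y ^ j ≤ y ^ e := by
    rw [← Real.rpow_natCast]
    exact Real.rpow_le_rpow_of_exponent_ge hy0 hy1 he
  have h2 : y ^ e = (1 / r) ^ e * m ^ e := by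
    rw [← Real.mul_rpow (by positivity) hm.le, hy]; congr 1; ring
  have h3 : (1 / r) ^ e ≤ (1 / r) ^ p := by
    rw [← Real.rpow_natCast (1 / r) p]
    exact Real.rpow_le_rpow_of_exponent_le (by rw [le_div_iff₀ hr]; linarith) hep
  rw [h2] at h1
  exact h1.trans (mul_le_mul_of_nonneg_right h3 (Real.rpow_nonneg hm.le _))

theorem SGfin_bd {Q : ℕ → ℝ → Prop} (hQ : ∀ n C C', Q n C → C ≤ C' → Q n C')
    (h : ∀ n, ∃ C, Q n C) {n0 : ℕ} {C1 : ℝ} (h1 : ∀ n, n0 ≤ n → Q n C1) :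
    ∃ C, 0 < C ∧ ∀ n, Q n C := by
  choose c hc using h
  refine ⟨∑ i ∈ Finset.range n0, |c i| + |C1| + 1, by positivity, fun n => ?_⟩
  have hs : 0 ≤ ∑ i ∈ Finset.range n0, |c i| := Finset.sum_nonneg fun _ _ => abs_nonneg _
  rcases le_or_gt n0 n with hn | hn
  · exact hQ _ _ _ (h1 n hn) (by linarith [le_abs_self C1])
  · refine hQ _ _ _ (hc n) ?_
    have := Finset.single_le_sum (f := fun i => |c i|) (fun i _ => abs_nonneg _) (Finset.mem_range.2 hn)
    linarith [le_abs_self (c n), abs_nonneg C1]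

theorem SGmain (L : ℕ) (hL : 2 ≤ L) (β a : ℝ) (hβ0 : 0 < β) (hβ2 : β < 2) (ha : 0 < a) (p : ℕ) (hp : 1 ≤ p) :
    ∃ vinf : ℕ → ℝ → ℝ, (∀ n, SGconv L β a n (vinf n)) ∧
      (∀ n, ∃ k : ℝ, ∀ φ, SGRG L (vinf (n + 1)) φ - vinf n φ = k) ∧
      ∃ C : ℝ, 0 < C ∧ ∀ n : ℕ, SGdec β (a * (L : ℝ) ^ (-(n : ℝ) * (2 - β))) p C (vinf n) := by
  have hL1 : (1 : ℝ) < L := by exact_mod_cast (by omega : 1 < L)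
  let P : SGpar := ⟨L, β, hL1, hβ0, hβ2⟩
  have hPL : P.ell = L := rfl
  obtain ⟨r, hr⟩ := P.exists_small
  obtain ⟨d, hdr, hfix, hd⟩ := SGpar.exists_fixed hr
  have hr0 : 0 < r := hr.1
  have hμ : ∀ n : ℕ, a * (L : ℝ) ^ (-(n : ℝ) * (2 - β)) = a * P.q ^ n := by
    intro n
    rw [SGpar.q, ← Real.rpow_mul_natCast (by linarith [P.h1])]
    congr 2
    show _ = -(2 - β) * (n : ℝ)
    ring
  have hq0 := P.q_pos
  have hq1 := P.q_lt
  obtain ⟨n0, hn0⟩ : ∃ n0 : ℕ, P.q ^ n0 < r / a := exists_pow_lt_of_lt_one (by positivity) hq1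
  let x : ℕ → ℝ := fun n => a * P.q ^ n / r
  have hx0 : ∀ n, 0 < x n := fun n => by positivity
  have hxs : ∀ n, x (n + 1) = P.q * x n := fun n => by simp only [x]; ring
  have hx1 : ∀ n, n0 ≤ n → x n ≤ 1 := by
    intro n hn
    simp only [x]
    rw [div_le_one hr0, mul_comm, ← le_div_iff₀ ha]
    exact (pow_le_pow_of_le_one hq0.le hq1.le hn).trans hn0.le
  have hxa : ∀ n, n0 ≤ n → |x n| ≤ 1 := fun n hn => by rw [abs_of_pos (hx0 n)]; exact hx1 n hn
  let U : ℕ → ℝ → ℝ := fun n => if h : |x n| ≤ 1 then P.V r d (x n) h else 0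
  have hU : ∀ n (h : |x n| ≤ 1), U n = P.V r d (x n) h := fun n h => dif_pos h
  have hconv : ∀ n, n0 ≤ n → SGconv L β a n (U n) := by
    intro n hn
    rw [hU n (hxa n hn)]
    refine ⟨SGpar.V_good _ _ _, ?_⟩
    obtain ⟨c, hc⟩ := SGpar.V_conv hr L hPL hd (x n) (hxa n hn)
    refine ⟨fun N => c (N - n), ?_⟩
    rw [Metric.tendstoUniformly_iff]
    intro e he
    filter_upwards [(tendsto_sub_atTop_nat n).eventually (hc e he), eventually_ge_atTop n] with N h1 h2 φ
    have h3 := h1 φ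
    rw [Real.dist_eq, SGv, hμ]
    have e1 : r * (P.q ^ (N - n) * x n) = a * P.q ^ N := by
      have : P.q ^ N = P.q ^ (N - n) * P.q ^ n := by rw [← pow_add]; congr 1; omega
      rw [this]
      simp only [x]
      field_simp
    rw [e1] at h3
    exact h3
  have hall := SGext_conv hL hconv
  refine ⟨SGext L n0 U, hall, ?_, ?_⟩
  · intro n
    rcases le_or_gt n0 n with hn | hn
    · rw [SGext_ge hn, SGext_ge (by omega)]
      obtain ⟨k, hk⟩ := SGpar.V_rg hr L hPL hdr hfix hd (x n) (hxa n hn)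
      refine ⟨k, fun φ => ?_⟩
      rw [← hk φ, hU n (hxa n hn), hU (n + 1) (hxa (n + 1) (by omega))]
      have key : ∀ (y : ℝ) (h : |y| ≤ 1), y = P.q * x n →
          P.V r d y h = P.V r d (P.q * x n) (P.qy (hxa n hn)) := by
        intro y h hy
        subst hy
        rfl
      rw [key _ _ (hxs n)]
    · exact ⟨0, fun φ => by rw [SGext_lt hn, sub_self]⟩
  · refine SGfin_bd (Q := fun n C => SGdec β (a * (L : ℝ) ^ (-(n : ℝ) * (2 - β))) p C (SGext L n0 U n))
      (fun n C C' h hC => h.mono (by rw [hμ]; positivity) hC)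
      (fun n => SGdec.of_good β (by rw [hμ]; positivity) p (hall n).1) (n0 := n0) (C1 := (1 / r) ^ (p + 2)) ?_
    intro n hn
    show SGdec _ _ _ _ _
    rw [hμ, SGext_ge hn, hU n (hxa n hn)]
    have hm : 0 < a * P.q ^ n := by positivity
    obtain ⟨μ, w, h1, h2, h3, h4⟩ := SGpar.modes hr hdr hfix (x n) (hx0 n).le (hxa n hn) p hp
    have hrx : r * x n = a * P.q ^ n := by simp only [x]; field_simp
    have hb : ∀ (j : ℕ) (e : ℝ), e ≤ j → e ≤ (p + 2 : ℕ) → x n ^ j ≤ (1 / r) ^ (p + 2) * (a * P.q ^ n) ^ e :=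
      fun j e h h' => SGpow_bd hr0 hr.2.1 hm rfl (hx1 n hn) (p + 2) j h h'
    have hp0 : (0 : ℝ) ≤ p := Nat.cast_nonneg p
    refine ⟨μ, w, h1, ?_, fun k hk hkp => (h3 k hk).trans (hb _ _ ?_ ?_), fun φ => (h4 φ).trans (hb _ _ ?_ ?_)⟩
    · rw [← hrx]
      refine h2.trans ?_
      rw [hrx]
      refine hb 2 _ (by norm_num) ?_
      push_cast; linarith
    · have : (0 : ℝ) ≤ k := Nat.cast_nonneg k
      linarith
    · have : (k : ℝ) ≤ p := by exact_mod_cast hkp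
      push_cast; linarith
    · linarith
    · push_cast; linarith

theorem stmt0 (L : ℕ) (hL : 2 ≤ L) (β a : ℝ) (hβ0 : 0 < β) (hβ2 : β < 2) (ha : 0 < a) :
    ∃ (vinf : ℕ → ℝ → ℝ) (c : ℕ → ℕ → ℝ),
      -- uniform convergence, up to constants, to bounded continuous limit potentials
      (∀ n, 1 ≤ n →
        Continuous (vinf n) ∧ (∃ M : ℝ, ∀ φ, |vinf n φ| ≤ M) ∧
          TendstoUniformly (fun N φ => SGv L β a N n φ - c n N) (vinf n) atTop) ∧
      -- compatibility under the RG flow, up to additive constants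
      (∀ n, 2 ≤ n → ∃ k : ℝ, ∀ φ, SGRG L (vinf n) φ - vinf (n - 1) φ = k) ∧
      -- decomposition into cosine modes with the stated estimates, `μ_n = a·L^{-n(2-β)}`
      (∃ C : ℝ, 0 < C ∧ ∀ n, 1 ≤ n →
        ∃ (μ : ℕ → ℝ) (w : ℝ → ℝ),
          (∀ φ : ℝ, vinf n φ =
              (∑ k ∈ Finset.Icc 1 (pSG β), μ k * Real.cos ((k : ℝ) * Real.sqrt β * φ)) + w φ) ∧
          |μ 1 - a * (L : ℝ) ^ (-(n : ℝ) * (2 - β))| ≤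
              C * (a * (L : ℝ) ^ (-(n : ℝ) * (2 - β))) ^ ((3 : ℝ) / 2) ∧
          (∀ k, 2 ≤ k → k ≤ pSG β →
            |μ k| ≤ C * (a * (L : ℝ) ^ (-(n : ℝ) * (2 - β))) ^ ((2 * k : ℝ) / 3)) ∧
          (∀ φ, |w φ| ≤
            C * (a * (L : ℝ) ^ (-(n : ℝ) * (2 - β))) ^ ((2 * (pSG β) : ℝ) / 3))) := by
  obtain ⟨vinf, h1, h2, C, hC, h3⟩ := SGmain L hL β a hβ0 hβ2 ha (pSG β) (SGp_pos hβ2)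
  choose hg c hc using h1
  refine ⟨vinf, c, fun n _ => ⟨(hg n).1, (hg n).2, hc n⟩, fun n hn => ?_, C, hC, fun n _ => h3 n⟩
  obtain ⟨m, rfl⟩ : ∃ m, n = m + 1 := ⟨n - 1, by omega⟩
  exact h2 m
end

section
/- Fix an integer L ≥ 2 and β ∈ [1,2), and let p = p(β). There exist constants A > 0, ε > 0 and μ₀ > 0 with the following property. Let 0 < μ ≤ μ₀ and 0 < α < 1, and let v = Σ_{k=1}^p μ_k·c_k + w and ṽ = Σ_{k=1}^p (μ_k + δμ_k)·c_k + w + δw be bounded measurable functions on ℝ, where the reals μ_k, δμ_k and bounded functions w, δw satisfy: |μ_1 − μ| ≤ A·μ², |μ_k| ≤ ε·μ^{2k/3} for 2 ≤ k ≤ p, ‖w‖_∞ ≤ ε·μ^{2p/3}, |δμ_1| ≤ α·μ², |δμ_k| ≤ α·μ^{2k/3} for 2 ≤ k ≤ p, and ‖δw‖_∞ ≤ α·μ^{2p/3}. Then, with μ' := L^{2−β}·μ, there exist real constants c', c̃', reals μ'_k, δμ'_k (1 ≤ k ≤ p) and bounded functions w', δw' such that R(v) − c' = Σ_{k=1}^p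 μ'_k·c_k + w' and R(ṽ) − c̃' = Σ_{k=1}^p (μ'_k + δμ'_k)·c_k + w' + δw', and the same estimates hold at the new scale: |μ'_1 − μ'| ≤ A·μ'², |μ'_k| ≤ ε·μ'^{2k/3} for 2 ≤ k ≤ p, ‖w'‖_∞ ≤ ε·μ'^{2p/3}, |δμ'_1| ≤ α·μ'², |δμ'_k| ≤ α·μ'^{2k/3} for 2 ≤ k ≤ p, and ‖δw'‖_∞ ≤ α·μ'^{2p/3}. -/
open MeasureTheory ProbabilityTheory Filter

/-- The cosine mode `c_k(φ) = cos(k√β φ)`. -/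
noncomputable def cMode (β : ℝ) (k : ℕ) (φ : ℝ) : ℝ := Real.cos ((k : ℝ) * Real.sqrt β * φ)

namespace SGaux

abbrev LPo := AddMonoidAlgebra ℝ ℤ

/-- weighted ℓ¹ norm -/
noncomputable def nrm (r : ℝ) (f : LPo) : ℝ := f.coeff.sum fun k a => |a| * r ^ k.natAbs

lemma nrm_eq (r : ℝ) (f : LPo) (s : Finset ℤ) (h : f.coeff.support ⊆ s) :
    nrm r f = ∑ k ∈ s, |f.coeff k| * r ^ k.natAbs := by
  unfold nrm
  exact Finsupp.sum_of_support_subset _ h _ (by simp)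

lemma nrm_nonneg {r : ℝ} (hr : 0 ≤ r) (f : LPo) : 0 ≤ nrm r f := by
  unfold nrm Finsupp.sum
  positivity

lemma nrm_zero (r : ℝ) : nrm r 0 = 0 := by simp [nrm]

lemma nrm_single (r : ℝ) (k : ℤ) (a : ℝ) :
    nrm r (AddMonoidAlgebra.single k a) = |a| * r ^ k.natAbs := by
  unfold nrm
  rw [AddMonoidAlgebra.coeff_single, Finsupp.sum_single_index (by simp)]

lemma nrm_add {r : ℝ} (hr : 0 ≤ r) (f g : LPo) : nrm r (f + g) ≤ nrm r f + nrm r g := by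
  classical
  rw [nrm_eq r f (f.coeff.support ∪ g.coeff.support) Finset.subset_union_left,
    nrm_eq r g (f.coeff.support ∪ g.coeff.support) Finset.subset_union_right,
    nrm_eq r (f + g) (f.coeff.support ∪ g.coeff.support)
      (by rw [AddMonoidAlgebra.coeff_add]; exact Finsupp.support_add), ← Finset.sum_add_distrib]
  refine Finset.sum_le_sum fun k _ => ?_
  rw [← add_mul]
  gcongr
  rw [AddMonoidAlgebra.coeff_add, Finsupp.add_apply]
  exact abs_add_le _ _

lemma nrm_smul (r : ℝ) (c : ℝ) (f : LPo) : nrm r (c • f) = |c| * nrm r f := by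
  rw [nrm_eq r (c • f) f.coeff.support
      (by rw [AddMonoidAlgebra.coeff_smul]; exact Finsupp.support_smul),
    nrm_eq r f f.coeff.support subset_rfl, Finset.mul_sum]
  refine Finset.sum_congr rfl fun k _ => ?_
  simp [abs_mul, mul_assoc]

lemma nrm_neg (r : ℝ) (f : LPo) : nrm r (-f) = nrm r f := by
  have := nrm_smul r (-1) f
  simpa using this

lemma nrm_sub {r : ℝ} (hr : 0 ≤ r) (f g : LPo) : nrm r (f - g) ≤ nrm r f + nrm r g := by
  rw [sub_eq_add_neg, ← nrm_neg r g]; exact nrm_add hr _ _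

lemma nrm_sum {r : ℝ} (hr : 0 ≤ r) {ι : Type*} (s : Finset ι) (f : ι → LPo) :
    nrm r (∑ i ∈ s, f i) ≤ ∑ i ∈ s, nrm r (f i) := by
  classical
  induction s using Finset.induction_on with
  | empty => simp [nrm_zero]
  | insert a s ha ih =>
    rw [Finset.sum_insert ha, Finset.sum_insert ha]
    exact (nrm_add hr _ _).trans (by gcongr)

lemma nrm_mul {r : ℝ} (hr : 1 ≤ r) (f g : LPo) : nrm r (f * g) ≤ nrm r f * nrm r g := by
  have hr0 : 0 ≤ r := by linarith
  rw [AddMonoidAlgebra.mul_def]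
  unfold Finsupp.sum
  refine (nrm_sum hr0 _ _).trans ?_
  rw [nrm, Finsupp.sum, Finset.sum_mul]
  refine Finset.sum_le_sum fun k _ => ?_
  refine (nrm_sum hr0 _ _).trans ?_
  rw [nrm, Finsupp.sum, Finset.mul_sum]
  refine Finset.sum_le_sum fun l _ => ?_
  rw [nrm_single, abs_mul]
  calc |f.coeff k| * |g.coeff l| * r ^ (k + l).natAbs
      ≤ |f.coeff k| * |g.coeff l| * r ^ (k.natAbs + l.natAbs) := by
        gcongr
        exact Int.natAbs_add_le k l
    _ = _ := by rw [pow_add]; ring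

lemma nrm_pow {r X : ℝ} (hr : 1 ≤ r) {u : LPo} (hu : nrm r u ≤ X) (n : ℕ) :
    nrm r (u ^ (n + 1)) ≤ X ^ (n + 1) := by
  have hr0 : 0 ≤ r := by linarith
  have hX : 0 ≤ X := (nrm_nonneg hr0 u).trans hu
  induction n with
  | zero => simpa using hu
  | succ n ih =>
    rw [pow_succ, pow_succ X]
    exact (nrm_mul hr _ _).trans (mul_le_mul ih hu (nrm_nonneg hr0 _) (by positivity))

lemma nrm_pow_sub {r X : ℝ} (hr : 1 ≤ r) {u v : LPo} (hu : nrm r u ≤ X) (hv : nrm r v ≤ X)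
    (n : ℕ) : nrm r (u ^ (n + 1) - v ^ (n + 1)) ≤ (n + 1) * X ^ n * nrm r (u - v) := by
  have hr0 : 0 ≤ r := by linarith
  have hX : 0 ≤ X := (nrm_nonneg hr0 u).trans hu
  induction n with
  | zero => simp
  | succ n ih =>
    have e : u ^ (n + 1 + 1) - v ^ (n + 1 + 1)
        = u ^ (n + 1) * (u - v) + (u ^ (n + 1) - v ^ (n + 1)) * v := by ring
    rw [e]
    calc _ ≤ _ := nrm_add hr0 _ _
      _ ≤ nrm r (u ^ (n + 1)) * nrm r (u - v) + nrm r (u ^ (n + 1) - v ^ (n + 1)) * nrm r v :=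
        add_le_add (nrm_mul hr _ _) (nrm_mul hr _ _)
      _ ≤ X ^ (n + 1) * nrm r (u - v) + ((n + 1) * X ^ n * nrm r (u - v)) * X := by
        have h0 := nrm_nonneg hr0 (u - v)
        refine add_le_add (mul_le_mul_of_nonneg_right (nrm_pow hr hu n) h0) ?_
        exact mul_le_mul ih hv (nrm_nonneg hr0 _) (by positivity)
      _ = _ := by push_cast; ring

/-- polynomial without constant term -/
noncomputable def Fp {R : Type*} [CommRing R] [Algebra ℝ R] (c : ℕ → ℝ) (N : ℕ) (u : R) : R :=
  ∑ n ∈ Finset.range N, c n • u ^ (n + 1)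

lemma Fp_zero {R : Type*} [CommRing R] [Algebra ℝ R] (c : ℕ → ℝ) (N : ℕ) :
    Fp c N (0 : R) = 0 := by simp [Fp]

lemma geo_le {X : ℝ} (h0 : 0 ≤ X) (h1 : X < 1) (N : ℕ) :
    ∑ n ∈ Finset.range N, X ^ n ≤ 1 / (1 - X) := by
  have := (summable_geometric_of_lt_one h0 h1).sum_le_tsum (Finset.range N)
    (fun i _ => by positivity)
  rw [tsum_geometric_of_lt_one h0 h1] at this
  simpa using this

lemma Fp_sub {r X : ℝ} (hr : 1 ≤ r) {c : ℕ → ℝ} (hc : ∀ n : ℕ, |c n| * (n + 1) ≤ 1) (N : ℕ)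
    {u v : LPo} (hu : nrm r u ≤ X) (hv : nrm r v ≤ X) (hX : X < 1) :
    nrm r (Fp c N u - Fp c N v) ≤ nrm r (u - v) * (1 / (1 - X)) := by
  have hr0 : 0 ≤ r := by linarith
  have hX0 : 0 ≤ X := (nrm_nonneg hr0 u).trans hu
  have h0 := nrm_nonneg hr0 (u - v)
  unfold Fp
  rw [← Finset.sum_sub_distrib]
  refine (nrm_sum hr0 _ _).trans ?_
  refine le_trans ?_ (mul_le_mul_of_nonneg_left (geo_le hX0 hX N) h0)
  rw [Finset.mul_sum]
  refine Finset.sum_le_sum fun n _ => ?_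
  rw [← smul_sub, nrm_smul]
  calc |c n| * nrm r (u ^ (n + 1) - v ^ (n + 1))
      ≤ |c n| * ((n + 1) * X ^ n * nrm r (u - v)) := by
        gcongr; exact nrm_pow_sub hr hu hv n
    _ = (|c n| * (n + 1)) * (X ^ n * nrm r (u - v)) := by ring
    _ ≤ 1 * (X ^ n * nrm r (u - v)) := by gcongr; exact hc n
    _ = _ := by ring

lemma Fp_sub2 {r X : ℝ} (hr : 1 ≤ r) {c : ℕ → ℝ} (hc : ∀ n : ℕ, |c n| * (n + 1) ≤ 1) {N : ℕ}
    (hN : 1 ≤ N)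
    {u v : LPo} (hu : nrm r u ≤ X) (hv : nrm r v ≤ X) (hX : X < 1) :
    nrm r ((Fp c N u - Fp c N v) - c 0 • (u - v)) ≤ nrm r (u - v) * (X * (1 / (1 - X))) := by
  have hr0 : 0 ≤ r := by linarith
  have hX0 : 0 ≤ X := (nrm_nonneg hr0 u).trans hu
  have h0 := nrm_nonneg hr0 (u - v)
  obtain ⟨M, rfl⟩ : ∃ M, N = M + 1 := ⟨N - 1, by omega⟩
  have e : (Fp c (M+1) u - Fp c (M+1) v) - c 0 • (u - v)
      = ∑ n ∈ Finset.range M, c (n+1) • (u ^ (n + 1 + 1) - v ^ (n + 1 + 1)) := by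
    unfold Fp
    rw [Finset.sum_range_succ', Finset.sum_range_succ']
    simp only [smul_sub, Finset.sum_sub_distrib]
    simp
    abel
  rw [e]
  refine (nrm_sum hr0 _ _).trans ?_
  refine le_trans ?_ (mul_le_mul_of_nonneg_left
    (mul_le_mul_of_nonneg_left (geo_le hX0 hX M) hX0) h0)
  rw [Finset.mul_sum, Finset.mul_sum]
  refine Finset.sum_le_sum fun n _ => ?_
  rw [nrm_smul]
  have h1 := hc (n+1)
  calc |c (n+1)| * nrm r (u ^ (n + 1 + 1) - v ^ (n + 1 + 1))
      ≤ |c (n+1)| * (((n+1 : ℕ) + 1) * X ^ (n+1) * nrm r (u - v)) := by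
        gcongr; exact nrm_pow_sub hr hu hv (n+1)
    _ = (|c (n+1)| * ((n+1 : ℕ) + 1)) * (X ^ (n+1) * nrm r (u - v)) := by ring
    _ ≤ 1 * (X ^ (n+1) * nrm r (u - v)) := by gcongr
    _ = _ := by ring

/-- exp coefficients -/
noncomputable def ce (n : ℕ) : ℝ := (-1) ^ (n + 1) / (n + 1).factorial
/-- log coefficients -/
noncomputable def cl (n : ℕ) : ℝ := (-1) ^ n / (n + 1)

lemma hce (n : ℕ) : |ce n| * (n + 1) ≤ 1 := by
  unfold ce
  rw [abs_div, abs_pow, abs_neg, abs_one, one_pow, Nat.factorial_succ]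
  have : (0:ℝ) < n.factorial := by positivity
  have h1 : (1:ℝ) ≤ n.factorial := by exact_mod_cast n.factorial_pos
  push_cast
  rw [abs_of_pos (by positivity)]
  rw [div_mul_eq_mul_div, div_le_one (by positivity)]
  nlinarith

lemma hcl (n : ℕ) : |cl n| * (n + 1) ≤ 1 := by
  unfold cl
  rw [abs_div, abs_pow, abs_neg, abs_one, one_pow]
  rw [abs_of_pos (by positivity)]
  rw [div_mul_eq_mul_div, div_le_one (by positivity)]
  linarith

lemma coeff_le {r : ℝ} (hr : 0 ≤ r) (f : LPo) (s : Finset ℤ) :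
    ∑ k ∈ s, |f.coeff k| * r ^ k.natAbs ≤ nrm r f := by
  classical
  rw [nrm_eq r f (s ∪ f.coeff.support) Finset.subset_union_right]
  exact Finset.sum_le_sum_of_subset_of_nonneg Finset.subset_union_left
    fun _ _ _ => by positivity

/-- Gaussian averaging on coefficients -/
noncomputable def Eop (q : ℝ) (f : LPo) : LPo :=
  AddMonoidAlgebra.ofCoeff (Finsupp.onFinset f.coeff.support
    (fun k => q ^ (k.natAbs ^ 2) * f.coeff k) (by
      intro k hk
      rw [Finsupp.mem_support_iff]
      exact right_ne_zero_of_mul hk))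

lemma Eop_coeff (q : ℝ) (f : LPo) (k : ℤ) :
    (Eop q f).coeff k = q ^ (k.natAbs ^ 2) * f.coeff k := rfl

lemma Eop_support (q : ℝ) (f : LPo) : (Eop q f).coeff.support ⊆ f.coeff.support := by
  intro k hk
  rw [Finsupp.mem_support_iff] at hk ⊢
  rw [Eop_coeff] at hk
  exact right_ne_zero_of_mul hk

lemma Eop_sub (q : ℝ) (f g : LPo) : Eop q (f - g) = Eop q f - Eop q g := by
  ext k
  rw [Eop_coeff, AddMonoidAlgebra.coeff_sub, AddMonoidAlgebra.coeff_sub, Finsupp.sub_apply,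
    Finsupp.sub_apply, Eop_coeff, Eop_coeff]
  ring

lemma Eop_zero (q : ℝ) : Eop q 0 = 0 := by
  ext k
  rw [Eop_coeff]; simp

lemma nrm_Eop_one {q : ℝ} (hq0 : 0 ≤ q) (hq1 : q ≤ 1) (f : LPo) :
    nrm 1 (Eop q f) ≤ nrm 1 f := by
  rw [nrm_eq 1 f f.coeff.support subset_rfl, nrm_eq 1 _ f.coeff.support (Eop_support q f)]
  refine Finset.sum_le_sum fun k _ => ?_
  rw [Eop_coeff, abs_mul, abs_of_nonneg (by positivity)]
  have : q ^ (k.natAbs ^ 2) ≤ 1 := pow_le_one₀ hq0 hq1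
  have h := abs_nonneg (f.coeff k)
  simp only [one_pow, mul_one]
  nlinarith

/-- The key smoothing estimate. -/
lemma nrm_Eop {q Li r : ℝ} (hq0 : 0 ≤ q) (hLi : Li ≤ 1 / 2) (hqL : q ≤ Li) (hr : 1 ≤ r)
    (f : LPo) :
    nrm r (Eop q f) ≤ 16 * Li ^ 4 * nrm (r / 4) f
      + r * (|f.coeff 0| + |f.coeff 1| + |f.coeff (-1)|) := by
  classical
  have hL0 : 0 ≤ Li := hq0.trans hqL
  set S : Finset ℤ := f.coeff.support ∪ {0, 1, -1} with hS
  have hsub : f.coeff.support ⊆ S := Finset.subset_union_left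
  rw [nrm_eq r _ S ((Eop_support q f).trans hsub), nrm_eq (r/4) f S hsub]
  have key : ∀ k ∈ S, |(Eop q f).coeff k| * r ^ k.natAbs ≤
      16 * Li ^ 4 * (|f.coeff k| * (r / 4) ^ k.natAbs) +
        (if k ∈ ({0, 1, -1} : Finset ℤ) then r * |f.coeff k| else 0) := by
    intro k _
    rw [Eop_coeff, abs_mul, abs_of_nonneg (by positivity : 0 ≤ q ^ (k.natAbs ^ 2))]
    by_cases hk : k.natAbs ≤ 1
    · have hmem : k ∈ ({0, 1, -1} : Finset ℤ) := by
        simp only [Finset.mem_insert, Finset.mem_singleton]; omega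
      rw [if_pos hmem]
      have h1 : q ^ (k.natAbs ^ 2) ≤ 1 := pow_le_one₀ hq0 (by linarith)
      have h2 : r ^ k.natAbs ≤ r := by
        calc r ^ k.natAbs ≤ r ^ 1 := pow_le_pow_right₀ hr hk
          _ = r := pow_one r
      have h3 : 0 ≤ 16 * Li ^ 4 * (|f.coeff k| * (r / 4) ^ k.natAbs) := by positivity
      have h4 : q ^ (k.natAbs ^ 2) * |f.coeff k| * r ^ k.natAbs ≤ 1 * |f.coeff k| * r := by
        gcongr
      linarith
    · have h0 : 0 ≤ (if k ∈ ({0, 1, -1} : Finset ℤ) then r * |f.coeff k| else 0) := by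
        split_ifs <;> positivity
      refine le_trans ?_ (le_add_of_nonneg_right h0)
      obtain ⟨j, hj⟩ : ∃ j, k.natAbs = j + 2 := ⟨k.natAbs - 2, by omega⟩
      rw [hj]
      have h1 : q ^ ((j + 2) ^ 2) ≤ Li ^ (2 * (j + 2)) := by
        calc q ^ ((j + 2) ^ 2) ≤ Li ^ ((j+2)^2) := by gcongr
          _ ≤ Li ^ (2 * (j + 2)) := pow_le_pow_of_le_one hL0 (by linarith) (by nlinarith)
      have h2 : Li ^ (2 * (j + 2)) ≤ 16 * Li ^ 4 * (1 / 4) ^ (j + 2) := by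
        have h3 : (Li ^ 2) ^ j ≤ (1 / 4) ^ j := by
          gcongr; nlinarith
        calc Li ^ (2 * (j + 2)) = Li ^ 4 * (Li ^ 2) ^ j := by rw [← pow_mul]; ring
          _ ≤ Li ^ 4 * (1 / 4) ^ j := by gcongr
          _ = _ := by rw [pow_add]; ring
      calc q ^ ((j + 2) ^ 2) * |f.coeff k| * r ^ (j + 2)
          ≤ (16 * Li ^ 4 * (1 / 4) ^ (j + 2)) * |f.coeff k| * r ^ (j + 2) := by
            gcongr; exact h1.trans h2
        _ = _ := by rw [div_pow, div_pow]; ring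
  refine (Finset.sum_le_sum key).trans ?_
  rw [Finset.sum_add_distrib, ← Finset.mul_sum, ← Finset.sum_filter]
  have : S.filter (fun k => k ∈ ({0, 1, -1} : Finset ℤ)) = {0, 1, -1} := by
    ext k
    simp only [hS, Finset.mem_filter, Finset.mem_union]
    tauto
  rw [this]
  rw [Finset.sum_insert (by decide), Finset.sum_insert (by decide), Finset.sum_singleton]
  linarith

/-- evaluation -/
noncomputable def chi (β φ : ℝ) : Multiplicative ℤ →* ℂ where
  toFun k := Complex.exp (((k.toAdd : ℝ) * Real.sqrt β * φ : ℝ) * Complex.I)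
  map_one' := by simp
  map_mul' a b := by
    rw [← Complex.exp_add]
    congr 1
    push_cast [toAdd_mul]
    ring

noncomputable def ev (β φ : ℝ) : LPo →ₐ[ℝ] ℂ := AddMonoidAlgebra.lift ℝ ℂ ℤ (chi β φ)

lemma ev_single (β φ : ℝ) (k : ℤ) (a : ℝ) : ev β φ (AddMonoidAlgebra.single k a)
    = a * Complex.exp (((k : ℝ) * Real.sqrt β * φ : ℝ) * Complex.I) := by
  unfold ev
  rw [AddMonoidAlgebra.lift_single]
  simp [chi]

lemma ev_eq (β φ : ℝ) (f : LPo) (s : Finset ℤ) (h : f.coeff.support ⊆ s) : ev β φ f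
    = ∑ k ∈ s, (f.coeff k : ℂ) * Complex.exp (((k : ℝ) * Real.sqrt β * φ : ℝ) * Complex.I) := by
  unfold ev
  rw [AddMonoidAlgebra.lift_apply, Finsupp.sum_of_support_subset _ h _ (by simp)]
  simp [chi]

lemma norm_ev_le (β φ : ℝ) (f : LPo) : ‖ev β φ f‖ ≤ nrm 1 f := by
  rw [ev_eq β φ f _ subset_rfl, nrm_eq 1 f _ subset_rfl]
  refine (norm_sum_le _ _).trans (Finset.sum_le_sum fun k _ => ?_)
  rw [norm_mul, Complex.norm_exp_ofReal_mul_I]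
  simp

lemma ev_re (β φ : ℝ) (f : LPo) (s : Finset ℤ) (h : f.coeff.support ⊆ s) : (ev β φ f).re
    = ∑ k ∈ s, f.coeff k * Real.cos ((k : ℝ) * Real.sqrt β * φ) := by
  rw [ev_eq β φ f s h, Complex.re_sum]
  refine Finset.sum_congr rfl fun k _ => ?_
  rw [Complex.re_ofReal_mul, Complex.exp_ofReal_mul_I_re]

lemma ev_Fp (β φ : ℝ) (c : ℕ → ℝ) (N : ℕ) (f : LPo) (x : ℝ) (h : ev β φ f = x) :
    ev β φ (Fp c N f) = ((Fp c N x : ℝ) : ℂ) := by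
  unfold Fp
  rw [map_sum]
  push_cast
  refine Finset.sum_congr rfl fun n _ => ?_
  rw [map_smul, map_pow, h]
  simp

/-- cosine polynomial -/
noncomputable def Uc (p : ℕ) (m : ℕ → ℝ) : LPo :=
  ∑ k ∈ Finset.Icc 1 p, (AddMonoidAlgebra.single (k : ℤ) (m k / 2)
    + AddMonoidAlgebra.single (-(k : ℤ)) (m k / 2))

lemma Uc_sub (p : ℕ) (m m' : ℕ → ℝ) : Uc p m - Uc p m' = Uc p (fun k => m k - m' k) := by
  unfold Uc
  rw [← Finset.sum_sub_distrib]
  refine Finset.sum_congr rfl fun k _ => ?_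
  rw [add_sub_add_comm, ← AddMonoidAlgebra.single_sub, ← AddMonoidAlgebra.single_sub, sub_div]

lemma Uc_zero (p : ℕ) : Uc p (fun _ => 0) = 0 := by
  unfold Uc; simp

lemma nrm_Uc {r : ℝ} (hr : 0 ≤ r) (p : ℕ) (m : ℕ → ℝ) :
    nrm r (Uc p m) ≤ ∑ k ∈ Finset.Icc 1 p, |m k| * r ^ k := by
  unfold Uc
  refine (nrm_sum hr _ _).trans (Finset.sum_le_sum fun k _ => ?_)
  refine (nrm_add hr _ _).trans ?_
  rw [nrm_single, nrm_single]
  simp [abs_div]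
  apply le_of_eq; ring

lemma ev_Uc (β φ : ℝ) (p : ℕ) (m : ℕ → ℝ) :
    ev β φ (Uc p m) = ((∑ k ∈ Finset.Icc 1 p, m k * cMode β k φ : ℝ) : ℂ) := by
  unfold Uc
  rw [map_sum]
  push_cast
  refine Finset.sum_congr rfl fun k _ => ?_
  rw [map_add, ev_single, ev_single]
  unfold cMode
  rw [Complex.ofReal_cos, Complex.cos]
  push_cast
  simp only [neg_mul]
  ring

lemma Uc_coeff (p : ℕ) (m : ℕ → ℝ) (j : ℤ) : (Uc p m).coeff j
    = ∑ k ∈ Finset.Icc 1 p, ((if (k : ℤ) = j then m k / 2 else 0)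
      + (if -(k : ℤ) = j then m k / 2 else 0)) := by
  unfold Uc
  rw [AddMonoidAlgebra.coeff_sum, Finsupp.finsetSum_apply]
  refine Finset.sum_congr rfl fun k _ => ?_
  rw [AddMonoidAlgebra.coeff_add, AddMonoidAlgebra.coeff_single, AddMonoidAlgebra.coeff_single,
    Finsupp.add_apply, Finsupp.single_apply, Finsupp.single_apply]

lemma Uc_coeff_zero (p : ℕ) (m : ℕ → ℝ) : (Uc p m).coeff 0 = 0 := by
  rw [Uc_coeff]
  refine Finset.sum_eq_zero fun k hk => ?_
  rw [Finset.mem_Icc] at hk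
  rw [if_neg (by omega), if_neg (by omega), add_zero]

lemma Uc_coeff_one {p : ℕ} (hp : 1 ≤ p) (m : ℕ → ℝ) : (Uc p m).coeff 1 = m 1 / 2 := by
  rw [Uc_coeff, Finset.sum_eq_single_of_mem 1 (by simp [hp])]
  · simp
  · intro k hk hk1
    rw [Finset.mem_Icc] at hk
    rw [if_neg (by omega), if_neg (by omega), add_zero]

lemma Uc_coeff_neg_one {p : ℕ} (hp : 1 ≤ p) (m : ℕ → ℝ) : (Uc p m).coeff (-1) = m 1 / 2 := by
  rw [Uc_coeff, Finset.sum_eq_single_of_mem 1 (by simp [hp])]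
  · simp
  · intro k hk hk1
    rw [Finset.mem_Icc] at hk
    rw [if_neg (by omega), if_neg (by omega), add_zero]

lemma gauss_exp (L : ℕ) (hL : 2 ≤ L) (β φ : ℝ) (hβ : 0 ≤ β) (k : ℤ) :
    ∫ z, Complex.exp (((k : ℝ) * Real.sqrt β * (φ + z) : ℝ) * Complex.I)
      ∂(gaussianReal 0 (2 * Real.log L).toNNReal)
    = ((((L : ℝ) ^ (-β)) ^ (k.natAbs ^ 2) : ℝ) : ℂ)
      * Complex.exp (((k : ℝ) * Real.sqrt β * φ : ℝ) * Complex.I) := by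
  have hL0 : (0:ℝ) < L := by positivity
  have hlog : 0 ≤ Real.log L := Real.log_nonneg (by exact_mod_cast (by omega : 1 ≤ L))
  have h1 : ∀ z : ℝ, Complex.exp (((k : ℝ) * Real.sqrt β * (φ + z) : ℝ) * Complex.I)
      = Complex.exp (((k : ℝ) * Real.sqrt β * φ : ℝ) * Complex.I)
        * Complex.exp ((((k : ℝ) * Real.sqrt β : ℝ) : ℂ) * z * Complex.I) := by
    intro z
    rw [← Complex.exp_add]
    congr 1
    push_cast; ring
  simp_rw [h1]
  rw [integral_const_mul, ← charFun_apply_real, charFun_gaussianReal, mul_comm]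
  congr 1
  have h2 : ((L : ℝ) ^ (-β)) ^ (k.natAbs ^ 2) = Real.exp (-(Real.log L * β * (k:ℝ)^2)) := by
    rw [Real.rpow_def_of_pos hL0, ← Real.exp_nat_mul]
    congr 1
    push_cast [Nat.cast_natAbs]
    rw [sq_abs]
    ring
  rw [h2, Complex.ofReal_exp]
  congr 1
  have h3 : (((2 * Real.log L).toNNReal : NNReal) : ℝ) = 2 * Real.log L :=
    Real.coe_toNNReal _ (by positivity)
  have h4 : ((((2 * Real.log L).toNNReal : NNReal) : ℝ) : ℂ) = 2 * (Real.log L : ℂ) := by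
    rw [h3]; push_cast; rfl
  have h5 : ((Real.sqrt β : ℝ) : ℂ) ^ 2 = (β : ℂ) := by
    rw [← Complex.ofReal_pow, Real.sq_sqrt hβ]
  rw [h4]
  push_cast
  rw [mul_pow, h5]
  ring

lemma gauss_int (L : ℕ) (β φ : ℝ) (k : ℤ) :
    Integrable (fun z : ℝ => Complex.exp (((k : ℝ) * Real.sqrt β * (φ + z) : ℝ) * Complex.I))
      (gaussianReal 0 (2 * Real.log L).toNNReal) := by
  refine Integrable.of_bound (by fun_prop) 1 (Eventually.of_forall fun z => ?_)
  rw [Complex.norm_exp_ofReal_mul_I]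

lemma gauss_ev (L : ℕ) (hL : 2 ≤ L) (β φ : ℝ) (hβ : 0 ≤ β) (f : LPo) :
    ∫ z, ev β (φ + z) f ∂(gaussianReal 0 (2 * Real.log L).toNNReal)
    = ev β φ (Eop ((L : ℝ) ^ (-β)) f) := by
  rw [ev_eq β φ _ _ (Eop_support _ f)]
  simp_rw [ev_eq β _ f _ subset_rfl]
  rw [integral_finsetSum]
  · refine Finset.sum_congr rfl fun k _ => ?_
    rw [integral_const_mul, gauss_exp L hL β φ hβ k, Eop_coeff]
    push_cast; ring
  · intro k _
    exact (gauss_int L β φ k).const_mul _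

lemma sum_sym (g : ℤ → ℝ) (p : ℕ) : ∑ k ∈ Finset.Icc (-(p : ℤ)) p, g k
    = g 0 + ∑ k ∈ Finset.Icc 1 p, (g k + g (-(k : ℤ))) := by
  induction p with
  | zero => simp
  | succ p ih =>
    rw [Finset.sum_Icc_succ_top (by omega), ← add_assoc, ← ih]
    have e : Finset.Icc (-((p + 1 : ℕ) : ℤ)) ((p + 1 : ℕ) : ℤ)
        = insert ((p + 1 : ℕ) : ℤ) (insert (-((p + 1 : ℕ) : ℤ)) (Finset.Icc (-(p : ℤ)) p)) := by
      ext k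
      simp only [Finset.mem_insert, Finset.mem_Icc]
      omega
    rw [e, Finset.sum_insert, Finset.sum_insert]
    · ring
    · simp only [Finset.mem_Icc]; omega
    · simp only [Finset.mem_insert, Finset.mem_Icc]; omega

/-- high modes -/
noncomputable def tl (β : ℝ) (p : ℕ) (f : LPo) (φ : ℝ) : ℝ :=
  (ev β φ f).re - f.coeff 0
    - ∑ k ∈ Finset.Icc 1 p, (f.coeff (k : ℤ) + f.coeff (-(k : ℤ))) * cMode β k φ

lemma tl_sub (β : ℝ) (p : ℕ) (f g : LPo) (φ : ℝ) :
    tl β p (f - g) φ = tl β p f φ - tl β p g φ := by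
  unfold tl
  have : ∀ k : ℤ, (f - g).coeff k = f.coeff k - g.coeff k := fun k => by
    rw [AddMonoidAlgebra.coeff_sub, Finsupp.sub_apply]
  simp only [this, map_sub, Complex.sub_re]
  have e : ∀ k : ℕ, (f.coeff (k : ℤ) - g.coeff (k : ℤ) + (f.coeff (-(k : ℤ)) - g.coeff (-(k : ℤ))))
      * cMode β k φ = (f.coeff (k : ℤ) + f.coeff (-(k : ℤ))) * cMode β k φ
        - (g.coeff (k : ℤ) + g.coeff (-(k : ℤ))) * cMode β k φ := fun k => by ring
  simp only [e, Finset.sum_sub_distrib]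
  ring

lemma tl_bound (β : ℝ) (p : ℕ) (f : LPo) (φ : ℝ) {r : ℝ} (hr : 1 ≤ r) :
    |tl β p f φ| * r ^ (p + 1) ≤ nrm r f := by
  classical
  set S : Finset ℤ := f.coeff.support ∪ Finset.Icc (-(p : ℤ)) p with hS
  have h1 : tl β p f φ = ∑ k ∈ S \ Finset.Icc (-(p : ℤ)) p,
      f.coeff k * Real.cos ((k : ℝ) * Real.sqrt β * φ) := by
    unfold tl
    rw [ev_re β φ f S Finset.subset_union_left,
      ← Finset.sum_sdiff (Finset.subset_union_right : Finset.Icc (-(p : ℤ)) p ⊆ S), sum_sym]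
    have : ∑ k ∈ Finset.Icc 1 p, (f.coeff (k : ℤ) + f.coeff (-(k : ℤ))) * cMode β k φ
        = ∑ k ∈ Finset.Icc 1 p, (f.coeff (k : ℤ) * Real.cos (((k : ℤ) : ℝ) * Real.sqrt β * φ)
          + f.coeff (-(k : ℤ)) * Real.cos (((-(k : ℤ) : ℤ) : ℝ) * Real.sqrt β * φ)) := by
      refine Finset.sum_congr rfl fun k _ => ?_
      unfold cMode
      push_cast
      rw [neg_mul, neg_mul, Real.cos_neg]
      ring
    have h0 : Real.cos (((0 : ℤ) : ℝ) * Real.sqrt β * φ) = 1 := by simp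
    rw [this, h0]
    ring
  rw [h1]
  calc _ ≤ (∑ k ∈ S \ Finset.Icc (-(p : ℤ)) p, |f.coeff k|) * r ^ (p + 1) := by
        gcongr
        refine (Finset.abs_sum_le_sum_abs _ _).trans (Finset.sum_le_sum fun k _ => ?_)
        rw [abs_mul]
        exact mul_le_of_le_one_right (abs_nonneg _) (Real.abs_cos_le_one _)
    _ ≤ ∑ k ∈ S \ Finset.Icc (-(p : ℤ)) p, |f.coeff k| * r ^ k.natAbs := by
        rw [Finset.sum_mul]
        refine Finset.sum_le_sum fun k hk => ?_
        rw [Finset.mem_sdiff, Finset.mem_Icc] at hk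
        have : p + 1 ≤ k.natAbs := by omega
        gcongr
    _ ≤ nrm r f := coeff_le (by linarith) f _

lemma mvt {f f' : ℝ → ℝ} {X C : ℝ} (hf : ∀ x, |x| ≤ X → HasDerivAt f (f' x) x)
    (hb : ∀ x, |x| ≤ X → |f' x| ≤ C) {u v : ℝ} (hu : |u| ≤ X) (hv : |v| ≤ X) :
    |f v - f u| ≤ C * |v - u| := by
  have := Convex.norm_image_sub_le_of_norm_hasDerivWithin_le (f := f) (f' := f')
    (s := Set.Icc (-X) X) (C := C) (x := u) (y := v)
    (fun x hx => (hf x (abs_le.2 hx)).hasDerivWithinAt)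
    (fun x hx => hb x (abs_le.2 hx)) (convex_Icc _ _) (abs_le.1 hu) (abs_le.1 hv)
  simpa using this

lemma Fp_deriv (c : ℕ → ℝ) (N : ℕ) (x : ℝ) :
    HasDerivAt (fun x : ℝ => Fp c N x) (∑ n ∈ Finset.range N, c n * ((n + 1) * x ^ n)) x := by
  unfold Fp
  apply HasDerivAt.fun_sum
  intro n _
  simp only [smul_eq_mul]
  have := (hasDerivAt_pow (n + 1) x).const_mul (c n)
  simpa using this

/-- exponential remainder -/
noncomputable def kap (N : ℕ) (u w : ℝ) : ℝ := Real.exp (-(u + w)) - 1 - Fp ce N u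

lemma kap_bound {N : ℕ} (hN : 1 ≤ N) {X W u u' w w' : ℝ} (hu : |u| ≤ X) (hu' : |u'| ≤ X)
    (hw : |w| ≤ W) (hw' : |w'| ≤ W) (hXW : X + W ≤ 1 / 2) :
    |kap N u' w' - kap N u w| ≤ Real.exp (X + W) * |w' - w| + (4 * W + 2 * X ^ N) * |u' - u| := by
  have hX0 : 0 ≤ X := (abs_nonneg _).trans hu
  have hW0 : 0 ≤ W := (abs_nonneg _).trans hw
  have e : kap N u' w' - kap N u w = (kap N u' w' - kap N u' w) + (kap N u' w - kap N u w) := by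
    ring
  rw [e]
  refine (abs_add_le _ _).trans (add_le_add ?_ ?_)
  · refine mvt (f := fun w => kap N u' w) (f' := fun w => Real.exp (-(u' + w)) * (-1)) (X := W)
      ?_ ?_ hw hw'
    · intro x _
      unfold kap
      have h1 : HasDerivAt (fun w : ℝ => -(u' + w)) (-1) x :=
        ((hasDerivAt_id x).const_add u').neg
      exact (h1.exp.sub_const 1).sub_const _
    · intro x hx
      simp only [mul_neg, mul_one, abs_neg, Real.abs_exp]
      apply Real.exp_le_exp.2
      have := (abs_le.1 hx).1
      have := (abs_le.1 hu').1
      linarith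
  · refine mvt (f := fun u => kap N u w) (X := X) (f' := fun x => Real.exp (-(x + w)) * (-1)
      - ∑ n ∈ Finset.range N, ce n * ((n + 1) * x ^ n)) ?_ ?_ hu hu'
    · intro x _
      unfold kap
      have h1 : HasDerivAt (fun u : ℝ => -(u + w)) (-1) x :=
        ((hasDerivAt_id x).add_const w).neg
      exact (h1.exp.sub_const 1).sub (Fp_deriv ce N x)
    · intro x hx
      have hs : ∑ n ∈ Finset.range N, ce n * ((n + 1) * x ^ n)
          = -∑ n ∈ Finset.range N, (-x) ^ n / n.factorial := by
        rw [← Finset.sum_neg_distrib]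
        refine Finset.sum_congr rfl fun n _ => ?_
        unfold ce
        have : (0:ℝ) < n.factorial := by positivity
        rw [Nat.factorial_succ, neg_pow x]
        push_cast
        field_simp
        ring
      have hexp : Real.exp (-(x + w)) = Real.exp (-x) * Real.exp (-w) := by
        rw [← Real.exp_add]; ring_nf
      have e2 : Real.exp (-(x + w)) * (-1) - ∑ n ∈ Finset.range N, ce n * ((n + 1) * x ^ n)
          = -(Real.exp (-x) * (Real.exp (-w) - 1)
            + (Real.exp (-x) - ∑ n ∈ Finset.range N, (-x) ^ n / n.factorial)) := by
        rw [hs, hexp]; ring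
      rw [e2, abs_neg]
      refine (abs_add_le _ _).trans (add_le_add ?_ ?_)
      · rw [abs_mul, Real.abs_exp]
        have h1 : Real.exp (-x) ≤ 2 := by
          have : -x ≤ 1/2 := by have := (abs_le.1 hx).1; linarith
          calc Real.exp (-x) ≤ Real.exp (1/2) := Real.exp_le_exp.2 this
            _ ≤ 1 / (1 - 1/2) := Real.exp_bound_div_one_sub_of_interval (by norm_num) (by norm_num)
            _ = 2 := by norm_num
        have h2 : |Real.exp (-w) - 1| ≤ 2 * |-w| :=
          Real.abs_exp_sub_one_le (by rw [abs_neg]; linarith)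
        rw [abs_neg] at h2
        calc _ ≤ 2 * (2 * W) := by
              apply mul_le_mul h1 (by linarith) (abs_nonneg _) (by norm_num)
          _ = _ := by ring
      · have h1 := Real.exp_bound (x := -x) (by rw [abs_neg]; linarith) (n := N) (by omega)
        rw [abs_neg] at h1
        refine h1.trans ?_
        have h2 : ((N.succ : ℝ) / (N.factorial * N)) ≤ 2 := by
          have hN' : (1:ℝ) ≤ N := by exact_mod_cast hN
          have hf : (1:ℝ) ≤ N.factorial := by exact_mod_cast N.factorial_pos
          rw [div_le_iff₀ (by positivity)]
          push_cast
          nlinarith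
        calc |x| ^ N * ((N.succ : ℝ) / (N.factorial * N)) ≤ X ^ N * 2 := by gcongr
          _ = _ := by ring

/-- logarithm remainder -/
noncomputable def Phi (N : ℕ) (G D : ℝ) : ℝ := Real.log (1 + G + D) - Fp cl N G

lemma Phi_bound {N : ℕ} {Y B G G' D D' : ℝ} (hG : |G| ≤ Y) (hG' : |G'| ≤ Y)
    (hD : |D| ≤ B) (hD' : |D'| ≤ B) (hYB : Y + B ≤ 1 / 2) :
    |Phi N G' D' - Phi N G D| ≤ 1 / (1 - (Y + B)) * |D' - D| + (4 * B + 2 * Y ^ N) * |G' - G| := by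
  have hY0 : 0 ≤ Y := (abs_nonneg _).trans hG
  have hB0 : 0 ≤ B := (abs_nonneg _).trans hD
  have e : Phi N G' D' - Phi N G D = (Phi N G' D' - Phi N G' D) + (Phi N G' D - Phi N G D) := by
    ring
  rw [e]
  refine (abs_add_le _ _).trans (add_le_add ?_ ?_)
  · refine mvt (f := fun D => Phi N G' D) (f' := fun D => 1 / (1 + G' + D)) (X := B)
      ?_ ?_ hD hD'
    · intro x hx
      unfold Phi
      have h0 : 1 + G' + x ≠ 0 := by
        have := (abs_le.1 hx).1
        have := (abs_le.1 hG').1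
        linarith
      have h1 : HasDerivAt (fun D : ℝ => 1 + G' + D) 1 x := (hasDerivAt_id x).const_add _
      exact (h1.log h0).sub_const _
    · intro x hx
      have := (abs_le.1 hx).1
      have := (abs_le.1 hG').1
      rw [abs_of_pos (by apply div_pos one_pos; linarith)]
      apply one_div_le_one_div_of_le <;> linarith
  · refine mvt (f := fun G => Phi N G D) (X := Y) (f' := fun x => 1 / (1 + x + D)
      - ∑ n ∈ Finset.range N, cl n * ((n + 1) * x ^ n)) ?_ ?_ hG hG'
    · intro x hx
      unfold Phi
      have h0 : 1 + x + D ≠ 0 := by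
        have := (abs_le.1 hx).1
        have := (abs_le.1 hD).1
        linarith
      have h1 : HasDerivAt (fun x : ℝ => 1 + x + D) 1 x :=
        ((hasDerivAt_id x).const_add _).add_const _
      exact (h1.log h0).sub (Fp_deriv cl N x)
    · intro x hx
      have hx1 := (abs_le.1 hx).1
      have hD1 := (abs_le.1 hD).1
      have p1 : 1 / 2 ≤ 1 + x := by linarith
      have p2 : 1 / 2 ≤ 1 + x + D := by linarith
      have hs : ∑ n ∈ Finset.range N, cl n * ((n + 1) * x ^ n)
          = (1 - (-x) ^ N) / (1 + x) := by
        rw [eq_div_iff (by linarith)]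
        have := geom_sum_mul_neg (-x) N
        rw [sub_neg_eq_add] at this
        rw [← this]
        congr 1
        refine Finset.sum_congr rfl fun n _ => ?_
        unfold cl
        rw [neg_pow x]
        have : (n : ℝ) + 1 ≠ 0 := by positivity
        field_simp
      have e2 : 1 / (1 + x + D) - (1 - (-x) ^ N) / (1 + x)
          = -(D * (1 / (1 + x + D) * (1 / (1 + x)))) + (-x) ^ N * (1 / (1 + x)) := by
        have : 1 + x ≠ 0 := by linarith
        have : 1 + x + D ≠ 0 := by linarith
        field_simp
        ring
      have q1 : 1 / (1 + x) ≤ 2 := by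
        rw [div_le_iff₀ (by linarith)]; linarith
      have q2 : 1 / (1 + x + D) ≤ 2 := by
        rw [div_le_iff₀ (by linarith)]; linarith
      have q1' : 0 ≤ 1 / (1 + x) := by apply div_nonneg <;> linarith
      have q2' : 0 ≤ 1 / (1 + x + D) := by apply div_nonneg <;> linarith
      rw [hs, e2]
      refine (abs_add_le _ _).trans (add_le_add ?_ ?_)
      · rw [abs_neg, abs_mul, abs_of_nonneg (mul_nonneg q2' q1')]
        have : 1 / (1 + x + D) * (1 / (1 + x)) ≤ 2 * 2 := mul_le_mul q2 q1 q1' (by norm_num)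
        calc _ ≤ B * (2 * 2) := mul_le_mul hD this (mul_nonneg q2' q1') hB0
          _ = _ := by ring
      · rw [abs_mul, abs_pow, abs_neg, abs_of_nonneg q1']
        calc _ ≤ Y ^ N * 2 := mul_le_mul (by gcongr) q1 q1' (by positivity)
          _ = _ := by ring

lemma geo4 (p : ℕ) (hp : 1 ≤ p) : ∑ k ∈ Finset.Icc 2 p, (1 / 4 : ℝ) ^ k
    = 1 / 12 - 1 / 3 * (1 / 4) ^ p := by
  induction p, hp using Nat.le_induction with
  | base => norm_num
  | succ n hn ih =>
    rw [Finset.sum_Icc_succ_top (by omega), ih, pow_succ]; ring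

lemma sum_split {p : ℕ} (hp : 1 ≤ p) (g : ℕ → ℝ) :
    ∑ k ∈ Finset.Icc 1 p, g k = g 1 + ∑ k ∈ Finset.Icc 2 p, g k :=
  (Finset.add_sum_Ioc_eq_sum_Icc (f := g) hp).symm

/-- size condition on cosine coefficients -/
def Sz (τ : ℝ) (p : ℕ) (a b : ℝ) (m : ℕ → ℝ) : Prop :=
  |m 1| ≤ a * τ ^ 3 ∧ ∀ k, 2 ≤ k → k ≤ p → |m k| ≤ b * τ ^ (2 * k)

lemma Sz_zero {τ : ℝ} (hτ : 0 < τ) {p : ℕ} {a b : ℝ} (ha : 0 ≤ a) (hb : 0 ≤ b) :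
    Sz τ p a b (fun _ => 0) := by
  refine ⟨?_, fun k _ _ => ?_⟩ <;> rw [abs_zero] <;> positivity

lemma nU1 {τ : ℝ} (hτ : 0 < τ) (hτ1 : τ ≤ 1) {p : ℕ} (hp : 1 ≤ p) {a b : ℝ} (hb : 0 ≤ b)
    {m : ℕ → ℝ} (h : Sz τ p a b m) : nrm 1 (Uc p m) ≤ a * τ ^ 3 + b * (p * τ ^ 4) := by
  refine (nrm_Uc zero_le_one p m).trans ?_
  rw [sum_split hp]
  simp only [one_pow, mul_one]
  refine add_le_add h.1 ?_
  calc ∑ k ∈ Finset.Icc 2 p, |m k| ≤ ∑ k ∈ Finset.Icc 2 p, b * τ ^ 4 := by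
        refine Finset.sum_le_sum fun k hk => ?_
        rw [Finset.mem_Icc] at hk
        refine (h.2 k hk.1 hk.2).trans ?_
        gcongr b * ?_
        exact pow_le_pow_of_le_one hτ.le hτ1 (by omega)
    _ = ((p + 1 - 2 : ℕ) : ℝ) * (b * τ ^ 4) := by simp
    _ ≤ p * (b * τ ^ 4) := by
        gcongr; omega
    _ = _ := by ring

lemma nU4 {τ : ℝ} (hτ : 0 < τ) {p : ℕ} (hp : 1 ≤ p) {a b : ℝ} (hb : 0 ≤ b)
    {m : ℕ → ℝ} (h : Sz τ p a b m) :
    nrm ((τ ^ 2)⁻¹ / 4) (Uc p m) ≤ a * τ / 4 + b / 12 := by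
  refine (nrm_Uc (by positivity) p m).trans ?_
  rw [sum_split hp]
  refine add_le_add ?_ ?_
  · calc |m 1| * ((τ ^ 2)⁻¹ / 4) ^ 1 ≤ (a * τ ^ 3) * ((τ ^ 2)⁻¹ / 4) ^ 1 := by
          gcongr; exact h.1
      _ = _ := by field_simp
  · calc ∑ k ∈ Finset.Icc 2 p, |m k| * ((τ ^ 2)⁻¹ / 4) ^ k
        ≤ ∑ k ∈ Finset.Icc 2 p, b * (1 / 4 : ℝ) ^ k := by
          refine Finset.sum_le_sum fun k hk => ?_
          rw [Finset.mem_Icc] at hk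
          calc |m k| * ((τ ^ 2)⁻¹ / 4) ^ k ≤ (b * τ ^ (2 * k)) * ((τ ^ 2)⁻¹ / 4) ^ k := by
                gcongr; exact h.2 k hk.1 hk.2
            _ = _ := by
                rw [pow_mul, div_pow, inv_pow, div_pow]; field_simp; simp
      _ = b * (1 / 12 - 1 / 3 * (1 / 4) ^ p) := by rw [← Finset.mul_sum, geo4 p hp]
      _ ≤ b / 12 := by
          have : 0 ≤ b * (1 / 3 * (1 / 4 : ℝ) ^ p) := by positivity
          linarith

noncomputable def Gl (q : ℝ) (p : ℕ) (m : ℕ → ℝ) : LPo := Eop q (Fp ce p (Uc p m))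
noncomputable def Pl (q : ℝ) (p : ℕ) (m : ℕ → ℝ) : LPo := Fp cl p (Gl q p m)

lemma Gl_zero (q : ℝ) (p : ℕ) : Gl q p (fun _ => 0) = 0 := by
  rw [Gl, Uc_zero, Fp_zero, Eop_zero]

lemma Pl_zero (q : ℝ) (p : ℕ) : Pl q p (fun _ => 0) = 0 := by
  rw [Pl, Gl_zero, Fp_zero]

lemma coeff_sub' (f g : LPo) (k : ℤ) : (f - g).coeff k = f.coeff k - g.coeff k := by
  rw [AddMonoidAlgebra.coeff_sub, Finsupp.sub_apply]

lemma coeff_smul' (c : ℝ) (f : LPo) (k : ℤ) : (c • f).coeff k = c * f.coeff k := rfl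

lemma coeff3 (f : LPo) : |f.coeff 0| + |f.coeff 1| + |f.coeff (-1)| ≤ nrm 1 f := by
  have := coeff_le zero_le_one f {0, 1, -1}
  rw [Finset.sum_insert (by decide), Finset.sum_insert (by decide), Finset.sum_singleton] at this
  simp only [one_pow, mul_one] at this
  linarith

lemma nU1' {τ : ℝ} {p : ℕ} (hτ : 0 < τ) (hτ1 : 1000 * τ ≤ 1) (hp : 1 ≤ p)
    (hpτ : 10 * (p * τ) ≤ 1)
    {a b : ℝ} (hb : 0 ≤ b) {m : ℕ → ℝ} (h : Sz τ p a b m) :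
    nrm 1 (Uc p m) ≤ (a + b / 2) * τ ^ 3 := by
  refine (nU1 hτ (by linarith) hp hb h).trans ?_
  have : b * (p * τ ^ 4) ≤ b / 2 * τ ^ 3 := by
    have : (p * τ) * (b * τ ^ 3) ≤ (1 / 2) * (b * τ ^ 3) := by
      gcongr; linarith
    linarith [this, (by ring : (p * τ) * (b * τ ^ 3) = b * (p * τ ^ 4))]
  linarith

lemma nU_le {τ : ℝ} {p : ℕ} (hτ : 0 < τ) (hτ1 : 1000 * τ ≤ 1) (hp : 1 ≤ p)
    (hpτ : 10 * (p * τ) ≤ 1)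
    {m : ℕ → ℝ} (h : Sz τ p 3 2 m) : nrm 1 (Uc p m) ≤ 4 * τ ^ 3 := by
  have := nU1' hτ hτ1 hp hpτ (by norm_num) h
  linarith

lemma tau3 {τ : ℝ} {p : ℕ} (hτ : 0 < τ) (hτ1 : 1000 * τ ≤ 1) (_hp : 1 ≤ p)
    (_hpτ : 10 * (p * τ) ≤ 1) : τ ^ 3 ≤ τ / 1000000 := by
  have h1 : τ ≤ 1 / 1000 := by linarith
  have h2 : τ ^ 2 ≤ (1 / 1000) ^ 2 := by gcongr
  nlinarith

/-- quadratic part of the exponential, unweighted -/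
lemma hquad {τ : ℝ} {p : ℕ} (hτ : 0 < τ) (hτ1 : 1000 * τ ≤ 1) (hp : 1 ≤ p)
    (hpτ : 10 * (p * τ) ≤ 1)
    {m m' : ℕ → ℝ} (h : Sz τ p 3 2 m) (h' : Sz τ p 3 2 m') :
    nrm 1 ((Fp ce p (Uc p m') - Fp ce p (Uc p m)) - ce 0 • (Uc p m' - Uc p m))
      ≤ nrm 1 (Uc p m' - Uc p m) * (8 * τ ^ 3) := by
  have t3 := tau3 hτ hτ1 hp hpτ
  have hpos : 0 < τ ^ 3 := by positivity
  refine (Fp_sub2 le_rfl hce hp (nU_le hτ hτ1 hp hpτ h') (nU_le hτ hτ1 hp hpτ h)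
    (by linarith)).trans ?_
  have h0 := nrm_nonneg zero_le_one (Uc p m' - Uc p m)
  gcongr nrm 1 (Uc p m' - Uc p m) * ?_
  have : 1 / (1 - 4 * τ ^ 3) ≤ 2 := by
    rw [div_le_iff₀ (by linarith)]; linarith
  nlinarith

lemma n1F {τ : ℝ} {p : ℕ} (hτ : 0 < τ) (hτ1 : 1000 * τ ≤ 1) (hp : 1 ≤ p)
    (hpτ : 10 * (p * τ) ≤ 1)
    {m m' : ℕ → ℝ} (h : Sz τ p 3 2 m) (h' : Sz τ p 3 2 m') :
    nrm 1 (Fp ce p (Uc p m') - Fp ce p (Uc p m)) ≤ nrm 1 (Uc p m' - Uc p m) * 2 := by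
  have t3 := tau3 hτ hτ1 hp hpτ
  refine (Fp_sub le_rfl hce p (nU_le hτ hτ1 hp hpτ h') (nU_le hτ hτ1 hp hpτ h)
    (by linarith)).trans ?_
  have h0 := nrm_nonneg zero_le_one (Uc p m' - Uc p m)
  gcongr nrm 1 (Uc p m' - Uc p m) * ?_
  rw [div_le_iff₀ (by linarith)]; linarith


lemma n1G {τ Li q : ℝ} {p : ℕ} (hτ : 0 < τ) (hτ1 : 1000 * τ ≤ 1) (hp : 1 ≤ p)
    (hpτ : 10 * (p * τ) ≤ 1) (hq0 : 0 ≤ q) (hLi : Li ≤ 1 / 2) (hqL : q ≤ Li)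
    {m m' : ℕ → ℝ} (h : Sz τ p 3 2 m) (h' : Sz τ p 3 2 m') :
    nrm 1 (Gl q p m' - Gl q p m) ≤ nrm 1 (Uc p m' - Uc p m) * 2 := by
  unfold Gl
  rw [← Eop_sub]
  exact (nrm_Eop_one hq0 (by linarith) _).trans (n1F hτ hτ1 hp hpτ h h')

lemma n1G0 {τ Li q : ℝ} {p : ℕ} (hτ : 0 < τ) (hτ1 : 1000 * τ ≤ 1) (hp : 1 ≤ p)
    (hpτ : 10 * (p * τ) ≤ 1) (hq0 : 0 ≤ q) (hLi : Li ≤ 1 / 2) (hqL : q ≤ Li)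
    {m : ℕ → ℝ} (h : Sz τ p 3 2 m) : nrm 1 (Gl q p m) ≤ 8 * τ ^ 3 := by
  have := n1G hτ hτ1 hp hpτ hq0 hLi hqL (Sz_zero hτ (by norm_num) (by norm_num)) h
  rw [Gl_zero, Uc_zero, sub_zero, sub_zero] at this
  linarith [nU_le hτ hτ1 hp hpτ h]

lemma nG {τ Li q : ℝ} {p : ℕ} (hτ : 0 < τ) (hτ1 : 1000 * τ ≤ 1) (hp : 1 ≤ p)
    (hpτ : 10 * (p * τ) ≤ 1) (hq0 : 0 ≤ q) (hLi : Li ≤ 1 / 2) (hqL : q ≤ Li)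
    {a b : ℝ} (hb : 0 ≤ b) {m m' : ℕ → ℝ} (h : Sz τ p 3 2 m)
    (h' : Sz τ p 3 2 m') (hd : Sz τ p a b (fun k => m' k - m k)) :
    nrm (τ ^ 2)⁻¹ (Gl q p m' - Gl q p m) ≤ 20 * Li ^ 4 * (a * τ / 4 + b / 12)
      + (2 * a + b) * τ := by
  have t3 := tau3 hτ hτ1 hp hpτ
  have hpos : 0 < τ ^ 3 := by positivity
  have hL0 : 0 ≤ Li := hq0.trans hqL
  have hr4 : 1 ≤ (τ ^ 2)⁻¹ / 4 := by
    rw [le_div_iff₀ (by norm_num), ← one_div, le_div_iff₀ (by positivity)]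
    nlinarith
  have hr : 1 ≤ (τ ^ 2)⁻¹ := by linarith
  have ha : 0 ≤ a := by
    have := (abs_nonneg _).trans hd.1
    exact nonneg_of_mul_nonneg_left this hpos
  unfold Gl
  rw [← Eop_sub]
  refine (nrm_Eop hq0 hLi hqL hr _).trans ?_
  have s1 : nrm ((τ ^ 2)⁻¹ / 4) (Fp ce p (Uc p m') - Fp ce p (Uc p m))
      ≤ (a * τ / 4 + b / 12) * (5 / 4) := by
    have b1 := nU4 hτ hp (by norm_num) h
    have b2 := nU4 hτ hp (by norm_num) h'
    refine (Fp_sub (X := 1 / 5) hr4 hce p (by linarith) (by linarith) (by norm_num)).trans ?_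
    have := nU4 hτ hp hb hd
    rw [← Uc_sub] at this
    have e : (1 / (1 - 1 / 5) : ℝ) = 5 / 4 := by norm_num
    rw [e]
    gcongr
  set f := Fp ce p (Uc p m') - Fp ce p (Uc p m) with hf
  have s2 : |f.coeff 0| + |f.coeff 1| + |f.coeff (-1)| ≤ (2 * a + b) * τ ^ 3 := by
    have hh := (coeff3 _).trans (hquad hτ hτ1 hp hpτ h h')
    rw [← hf] at hh
    have hn := nU1' hτ hτ1 hp hpτ hb hd
    rw [← Uc_sub] at hn
    have hc0 : ce 0 = -1 := by simp [ce]
    have hn0 := nrm_nonneg zero_le_one (Uc p m' - Uc p m)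
    have c0 : (Uc p m' - Uc p m).coeff 0 = 0 := by rw [Uc_sub, Uc_coeff_zero]
    have c1 : (Uc p m' - Uc p m).coeff 1 = (m' 1 - m 1) / 2 := by rw [Uc_sub, Uc_coeff_one hp]
    have c2 : (Uc p m' - Uc p m).coeff (-1) = (m' 1 - m 1) / 2 := by
      rw [Uc_sub, Uc_coeff_neg_one hp]
    simp only [coeff_sub' f, coeff_smul', hc0, c0, c1, c2] at hh
    have q0 : |f.coeff 0| = |f.coeff 0 - -1 * 0| := by simp
    have q1 : |f.coeff 1| ≤ |f.coeff 1 - -1 * ((m' 1 - m 1) / 2)| + |m' 1 - m 1| / 2 := by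
      have := abs_sub (f.coeff 1 - -1 * ((m' 1 - m 1) / 2)) ((m' 1 - m 1) / 2)
      rw [abs_div, abs_two] at this
      refine le_trans (le_of_eq ?_) this
      congr 1; ring
    have q2 : |f.coeff (-1)| ≤ |f.coeff (-1) - -1 * ((m' 1 - m 1) / 2)| + |m' 1 - m 1| / 2 := by
      have := abs_sub (f.coeff (-1) - -1 * ((m' 1 - m 1) / 2)) ((m' 1 - m 1) / 2)
      rw [abs_div, abs_two] at this
      refine le_trans (le_of_eq ?_) this
      congr 1; ring
    have hd1 : |m' 1 - m 1| ≤ a * τ ^ 3 := hd.1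
    have hx : nrm 1 (Uc p m' - Uc p m) * (8 * τ ^ 3) ≤ (a + b / 2) * τ ^ 3 * 1 :=
      mul_le_mul hn (by linarith) (by positivity) (by positivity)
    have hbb : 0 ≤ b * τ ^ 3 := by positivity
    rw [← q0] at hh
    have e1 : (2 * a + b) * τ ^ 3 = 2 * (a * τ ^ 3) + b * τ ^ 3 := by ring
    have e2 : (a + b / 2) * τ ^ 3 * 1 = a * τ ^ 3 + b * τ ^ 3 / 2 := by ring
    rw [e1]
    rw [e2] at hx
    have hh2 := hh.trans hx
    clear hh hx hn hf s1 hd h h'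
    generalize |f.coeff 0| = x0 at *
    generalize |f.coeff 1| = x1 at *
    generalize |f.coeff (-1)| = x2 at *
    generalize |f.coeff 1 - -1 * ((m' 1 - m 1) / 2)| = y1 at *
    generalize |f.coeff (-1) - -1 * ((m' 1 - m 1) / 2)| = y2 at *
    generalize |m' 1 - m 1| = y3 at *
    linarith
  have s3 : (τ ^ 2)⁻¹ * (|f.coeff 0| + |f.coeff 1| + |f.coeff (-1)|) ≤ (2 * a + b) * τ := by
    calc _ ≤ (τ ^ 2)⁻¹ * ((2 * a + b) * τ ^ 3) := by gcongr
      _ = _ := by field_simp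
  have s4 : 16 * Li ^ 4 * nrm ((τ ^ 2)⁻¹ / 4) f
      ≤ 16 * Li ^ 4 * ((a * τ / 4 + b / 12) * (5 / 4)) := by gcongr
  linarith

lemma nP {τ Li q : ℝ} {p : ℕ} (hτ : 0 < τ) (hτ1 : 1000 * τ ≤ 1) (hp : 1 ≤ p)
    (hpτ : 10 * (p * τ) ≤ 1) (hq0 : 0 ≤ q) (hLi : Li ≤ 1 / 2) (hqL : q ≤ Li)
    {L α : ℝ} (hL0 : 0 < L) (hLL : Li = 1 / L) (hα : 0 ≤ α) (hLτ : 1000 * (L ^ 2 * τ) ≤ 1)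
    {m m' : ℕ → ℝ} (h : Sz τ p 3 2 m)
    (h' : Sz τ p 3 2 m') (hd : Sz τ p (2 * α) α (fun k => m' k - m k)) :
    L ^ 2 * nrm (τ ^ 2)⁻¹ (Pl q p m' - Pl q p m) ≤ α := by
  have hr : 1 ≤ (τ ^ 2)⁻¹ := by
    rw [← one_div, le_div_iff₀ (by positivity)]
    nlinarith
  have hL0' : 0 ≤ Li := hq0.trans hqL
  have hL4 : Li ^ 4 ≤ 1 / 16 := by
    calc Li ^ 4 ≤ (1 / 2) ^ 4 := by gcongr
      _ = _ := by norm_num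
  have hG0 : ∀ m, Sz τ p 3 2 m → nrm (τ ^ 2)⁻¹ (Gl q p m) ≤ 3 / 10 := by
    intro m hm
    have := nG hτ hτ1 hp hpτ hq0 hLi hqL (a := 3) (b := 2) (by norm_num)
      (Sz_zero hτ (by norm_num) (by norm_num)) hm (by simpa using hm)
    rw [Gl_zero, sub_zero] at this
    have h2 : 20 * Li ^ 4 * (3 * τ / 4 + 2 / 12) ≤ 20 * (1 / 16) * (3 * τ / 4 + 2 / 12) := by
      gcongr
    linarith
  have hG := nG hτ hτ1 hp hpτ hq0 hLi hqL hα h h' hd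
  have hF := Fp_sub (X := 3 / 10) hr hcl p (hG0 _ h') (hG0 _ h) (by norm_num)
  have e : Pl q p m' - Pl q p m = Fp cl p (Gl q p m') - Fp cl p (Gl q p m) := rfl
  rw [e]
  have hLL2 : L ^ 2 * Li ^ 4 ≤ 1 / 4 := by
    have : L ^ 2 * Li ^ 4 = Li ^ 2 := by rw [hLL]; field_simp
    rw [this]; nlinarith
  calc L ^ 2 * nrm (τ ^ 2)⁻¹ (Fp cl p (Gl q p m') - Fp cl p (Gl q p m))
      ≤ L ^ 2 * ((20 * Li ^ 4 * (2 * α * τ / 4 + α / 12) + (2 * (2 * α) + α) * τ)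
          * (1 / (1 - 3 / 10))) := by
        refine mul_le_mul_of_nonneg_left (hF.trans ?_) (by positivity)
        gcongr
    _ = ((L ^ 2 * Li ^ 4) * (20 * (τ / 2 + 1 / 12)) + 5 * (L ^ 2 * τ)) * (10 / 7) * α := by
        ring
    _ ≤ ((1 / 4) * (20 * (τ / 2 + 1 / 12)) + 5 * (L ^ 2 * τ)) * (10 / 7) * α := by gcongr
    _ ≤ 1 * α := by
        gcongr
        linarith
    _ = α := one_mul _

lemma mode1 {τ Li q : ℝ} {p : ℕ} (hτ : 0 < τ) (hτ1 : 1000 * τ ≤ 1) (hp : 1 ≤ p)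
    (hpτ : 10 * (p * τ) ≤ 1) (hq0 : 0 ≤ q) (hLi : Li ≤ 1 / 2) (hqL : q ≤ Li)
    {m m' : ℕ → ℝ} (h : Sz τ p 3 2 m) (h' : Sz τ p 3 2 m') :
    |((Pl q p m').coeff 1 + (Pl q p m').coeff (-1)) - ((Pl q p m).coeff 1 + (Pl q p m).coeff (-1))
      + q * (m' 1 - m 1)| ≤ 40 * nrm 1 (Uc p m' - Uc p m) * τ ^ 3 := by
  have t3 := tau3 hτ hτ1 hp hpτ
  have hpos : 0 < τ ^ 3 := by positivity
  set nd := nrm 1 (Uc p m' - Uc p m) with hnd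
  have hn0 : 0 ≤ nd := nrm_nonneg zero_le_one _
  have hh := (coeff3 _).trans (hquad hτ hτ1 hp hpτ h h')
  rw [← hnd] at hh
  set f := Fp ce p (Uc p m') - Fp ce p (Uc p m) with hf
  have hc0 : ce 0 = -1 := by simp [ce]
  have hl0 : cl 0 = 1 := by simp [cl]
  have c1 : (Uc p m' - Uc p m).coeff 1 = (m' 1 - m 1) / 2 := by rw [Uc_sub, Uc_coeff_one hp]
  have c2 : (Uc p m' - Uc p m).coeff (-1) = (m' 1 - m 1) / 2 := by
    rw [Uc_sub, Uc_coeff_neg_one hp]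
  simp only [coeff_sub' f, coeff_smul', hc0, c1, c2] at hh
  have gG : ∀ k : ℤ, (Gl q p m' - Gl q p m).coeff k = q ^ (k.natAbs ^ 2) * f.coeff k := by
    intro k
    unfold Gl
    rw [← Eop_sub, Eop_coeff]
  have g1 := gG 1
  have g2 := gG (-1)
  simp only [Int.natAbs_one, Int.natAbs_neg, one_pow, pow_one] at g1 g2
  have hP := Fp_sub2 (X := 8 * τ ^ 3) le_rfl hcl hp (n1G0 hτ hτ1 hp hpτ hq0 hLi hqL h')
    (n1G0 hτ hτ1 hp hpτ hq0 hLi hqL h) (by linarith)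
  have hP' := (coeff3 _).trans hP
  have e : Pl q p m' - Pl q p m = Fp cl p (Gl q p m') - Fp cl p (Gl q p m) := rfl
  rw [← e] at hP'
  simp only [coeff_sub' (Pl q p m' - Pl q p m), coeff_smul', hl0, g1, g2, one_mul] at hP'
  have hG := n1G hτ hτ1 hp hpτ hq0 hLi hqL h h'
  rw [← hnd] at hG
  have hb : nrm 1 (Gl q p m' - Gl q p m) * (8 * τ ^ 3 * (1 / (1 - 8 * τ ^ 3)))
      ≤ (nd * 2) * (8 * τ ^ 3 * 2) := by
    have : 1 / (1 - 8 * τ ^ 3) ≤ 2 := by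
      rw [div_le_iff₀ (by linarith)]; linarith
    exact mul_le_mul hG (mul_le_mul_of_nonneg_left this (by positivity))
      (mul_nonneg (by positivity) (div_nonneg zero_le_one (by linarith))) (by positivity)
  simp only [coeff_sub'] at hP'
  have a0 := abs_nonneg ((Pl q p m').coeff 0 - (Pl q p m).coeff 0 - ((Gl q p m').coeff 0 - (Gl q p m).coeff 0))
  have a0' := abs_nonneg (f.coeff 0 - -1 * (Uc p m' - Uc p m).coeff 0)
  simp only [coeff_sub'] at a0'
  set x1 := (Pl q p m').coeff 1 - (Pl q p m).coeff 1 - q * f.coeff 1 with hx1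
  set x2 := (Pl q p m').coeff (-1) - (Pl q p m).coeff (-1) - q * f.coeff (-1) with hx2
  set y1 := f.coeff 1 - -1 * ((m' 1 - m 1) / 2) with hy1
  set y2 := f.coeff (-1) - -1 * ((m' 1 - m 1) / 2) with hy2
  have key : ((Pl q p m').coeff 1 + (Pl q p m').coeff (-1))
      - ((Pl q p m).coeff 1 + (Pl q p m).coeff (-1)) + q * (m' 1 - m 1)
      = x1 + x2 + q * (y1 + y2) := by
    rw [hx1, hx2, hy1, hy2]; ring
  rw [key]
  have b1 : |x1| + |x2| ≤ 32 * nd * τ ^ 3 := by linarith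
  have b2 : |y1| + |y2| ≤ 8 * nd * τ ^ 3 := by
    simp only [coeff_sub'] at hh
    linarith
  have b3 : |q * (y1 + y2)| ≤ |y1| + |y2| := by
    rw [abs_mul, abs_of_nonneg hq0]
    have := abs_add_le y1 y2
    have h4 : q * |y1 + y2| ≤ 1 * |y1 + y2| := by gcongr; linarith
    linarith
  have := abs_add_le (x1 + x2) (q * (y1 + y2))
  have := abs_add_le x1 x2
  linarith


noncomputable def uu (β : ℝ) (p : ℕ) (m : ℕ → ℝ) (φ : ℝ) : ℝ :=
  ∑ k ∈ Finset.Icc 1 p, m k * cMode β k φ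

lemma uu_cont (β : ℝ) (p : ℕ) (m : ℕ → ℝ) : Continuous (uu β p m) := by
  unfold uu cMode
  fun_prop

lemma uu_sub (β : ℝ) (p : ℕ) (m m' : ℕ → ℝ) (φ : ℝ) :
    uu β p m' φ - uu β p m φ = uu β p (fun k => m' k - m k) φ := by
  unfold uu
  rw [← Finset.sum_sub_distrib]
  exact Finset.sum_congr rfl fun k _ => by ring

lemma uu_bound (β : ℝ) (p : ℕ) (m : ℕ → ℝ) (φ : ℝ) : |uu β p m φ| ≤ nrm 1 (Uc p m) := by
  have h := norm_ev_le β φ (Uc p m)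
  rw [ev_Uc, Complex.norm_real] at h
  exact h

noncomputable def Gr (L : ℕ) (β : ℝ) (p : ℕ) (m : ℕ → ℝ) (φ : ℝ) : ℝ :=
  ∫ z, Fp ce p (uu β p m (φ + z)) ∂(gaussianReal 0 (2 * Real.log L).toNNReal)

noncomputable def Dd (L : ℕ) (β : ℝ) (p : ℕ) (m : ℕ → ℝ) (w : ℝ → ℝ) (φ : ℝ) : ℝ :=
  ∫ z, kap p (uu β p m (φ + z)) (w (φ + z)) ∂(gaussianReal 0 (2 * Real.log L).toNNReal)

lemma Gr_ev (L : ℕ) (hL : 2 ≤ L) (β φ : ℝ) (hβ : 0 ≤ β) (p : ℕ) (m : ℕ → ℝ) :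
    ev β φ (Gl ((L : ℝ) ^ (-β)) p m) = ((Gr L β p m φ : ℝ) : ℂ) := by
  unfold Gl Gr
  rw [← gauss_ev L hL β φ hβ, ← integral_complex_ofReal]
  refine integral_congr_ae (Eventually.of_forall fun z => ?_)
  exact ev_Fp β (φ + z) ce p _ _ (ev_Uc β (φ + z) p m)

lemma Gr_sub (L : ℕ) (hL : 2 ≤ L) (β φ : ℝ) (hβ : 0 ≤ β) (p : ℕ) (m m' : ℕ → ℝ) :
    |Gr L β p m' φ - Gr L β p m φ|
      ≤ nrm 1 (Gl ((L : ℝ) ^ (-β)) p m' - Gl ((L : ℝ) ^ (-β)) p m) := by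
  have h := norm_ev_le β φ (Gl ((L : ℝ) ^ (-β)) p m' - Gl ((L : ℝ) ^ (-β)) p m)
  rw [map_sub, Gr_ev L hL β φ hβ, Gr_ev L hL β φ hβ, ← Complex.ofReal_sub,
    Complex.norm_real] at h
  exact h

lemma Fp_cont (c : ℕ → ℝ) (N : ℕ) : Continuous (fun x : ℝ => Fp c N x) :=
  continuous_iff_continuousAt.2 fun x => (Fp_deriv c N x).continuousAt

lemma int_F (L : ℕ) (β : ℝ) (p : ℕ) (m : ℕ → ℝ) (φ : ℝ) :
    Integrable (fun z => Fp ce p (uu β p m (φ + z)))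
      (gaussianReal 0 (2 * Real.log L).toNNReal) := by
  have hc : Continuous (fun z => Fp ce p (uu β p m (φ + z))) :=
    (Fp_cont ce p).comp ((uu_cont β p m).comp (by fun_prop))
  refine Integrable.of_bound hc.aestronglyMeasurable (nrm 1 (Fp ce p (Uc p m)))
    (Eventually.of_forall fun z => ?_)
  have h := norm_ev_le β (φ + z) (Fp ce p (Uc p m))
  rw [ev_Fp β (φ + z) ce p _ _ (ev_Uc β (φ + z) p m), Complex.norm_real] at h
  exact h

lemma int_e (L : ℕ) (β : ℝ) (p : ℕ) (m : ℕ → ℝ) {w : ℝ → ℝ} (hw : Measurable w) {W : ℝ}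
    (hW : ∀ x, |w x| ≤ W) (φ : ℝ) :
    Integrable (fun z => Real.exp (-(uu β p m (φ + z) + w (φ + z))))
      (gaussianReal 0 (2 * Real.log L).toNNReal) := by
  have hu : Measurable (uu β p m) := (uu_cont β p m).measurable
  have hm : Measurable (fun z => Real.exp (-(uu β p m (φ + z) + w (φ + z)))) := by
    fun_prop
  refine Integrable.of_bound hm.aestronglyMeasurable (Real.exp (nrm 1 (Uc p m) + W))
    (Eventually.of_forall fun z => ?_)
  rw [Real.norm_eq_abs, Real.abs_exp]
  apply Real.exp_le_exp.2
  have := (abs_le.1 (uu_bound β p m (φ + z))).1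
  have := (abs_le.1 (hW (φ + z))).1
  linarith

lemma int_k (L : ℕ) (β : ℝ) (p : ℕ) (m : ℕ → ℝ) {w : ℝ → ℝ} (hw : Measurable w) {W : ℝ}
    (hW : ∀ x, |w x| ≤ W) (φ : ℝ) :
    Integrable (fun z => kap p (uu β p m (φ + z)) (w (φ + z)))
      (gaussianReal 0 (2 * Real.log L).toNNReal) := by
  unfold kap
  exact ((int_e L β p m hw hW φ).sub (integrable_const 1)).sub (int_F L β p m φ)

lemma int_split (L : ℕ) (β : ℝ) (p : ℕ) (m : ℕ → ℝ) {w : ℝ → ℝ} (hw : Measurable w) {W : ℝ}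
    (hW : ∀ x, |w x| ≤ W) (φ : ℝ) :
    ∫ z, Real.exp (-(uu β p m (φ + z) + w (φ + z))) ∂(gaussianReal 0 (2 * Real.log L).toNNReal)
      = 1 + Gr L β p m φ + Dd L β p m w φ := by
  unfold Gr Dd
  have h1 := int_F L β p m φ
  have h2 := int_k L β p m hw hW φ
  have e : (1 : ℝ) = ∫ _z : ℝ, (1 : ℝ) ∂(gaussianReal 0 (2 * Real.log L).toNNReal) := by simp
  have h3 : Integrable (fun z => 1 + Fp ce p (uu β p m (φ + z)))
      (gaussianReal 0 (2 * Real.log L).toNNReal) := (integrable_const 1).add h1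
  rw [e, ← integral_add (integrable_const 1) h1, ← integral_add h3 h2]
  refine integral_congr_ae (Eventually.of_forall fun z => ?_)
  simp only [kap]
  ring

/-- the new remainder -/
noncomputable def Wn (L : ℕ) (β : ℝ) (p : ℕ) (m : ℕ → ℝ) (w : ℝ → ℝ) (φ : ℝ) : ℝ :=
  -(L : ℝ) ^ 2 * (Phi p (Gr L β p m φ) (Dd L β p m w φ) + tl β p (Pl ((L : ℝ) ^ (-β)) p m) φ)

/-- the new coefficients -/
noncomputable def Mn (L : ℕ) (β : ℝ) (p : ℕ) (m : ℕ → ℝ) (k : ℕ) : ℝ :=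
  -(L : ℝ) ^ 2 * ((Pl ((L : ℝ) ^ (-β)) p m).coeff (k : ℤ)
    + (Pl ((L : ℝ) ^ (-β)) p m).coeff (-(k : ℤ)))

lemma SGRG_eq (L : ℕ) (hL : 2 ≤ L) (β : ℝ) (hβ : 0 ≤ β) (p : ℕ) (m : ℕ → ℝ) {w : ℝ → ℝ}
    (hw : Measurable w) {W : ℝ} (hW : ∀ x, |w x| ≤ W) (φ : ℝ) :
    SGRG L (fun ψ => uu β p m ψ + w ψ) φ - (-(L : ℝ) ^ 2 * (Pl ((L : ℝ) ^ (-β)) p m).coeff 0)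
      = (∑ k ∈ Finset.Icc 1 p, Mn L β p m k * cMode β k φ) + Wn L β p m w φ := by
  unfold SGRG Wn Mn
  rw [int_split L β p m hw hW φ]
  have hP : (ev β φ (Pl ((L : ℝ) ^ (-β)) p m)).re = Fp cl p (Gr L β p m φ) := by
    unfold Pl
    rw [ev_Fp β φ cl p _ _ (Gr_ev L hL β φ hβ p m), Complex.ofReal_re]
  unfold tl Phi
  rw [hP]
  simp only [mul_assoc, ← Finset.mul_sum]
  ring

lemma Wn_zero (L : ℕ) (β φ : ℝ) (p : ℕ) : Wn L β p (fun _ => 0) (fun _ => 0) φ = 0 := by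
  have h0 : ∀ c : ℕ → ℝ, Fp c p (0 : ℝ) = 0 := fun c => by simp [Fp]
  have hu : ∀ x, uu β p (fun _ => 0) x = 0 := fun x => by simp [uu]
  have hG : Gr L β p (fun _ => 0) φ = 0 := by
    unfold Gr; simp [hu, h0]
  have hD : Dd L β p (fun _ => 0) (fun _ => 0) φ = 0 := by
    unfold Dd kap; simp [hu, h0]
  have ht : tl β p (0 : LPo) φ = 0 := by
    have := tl_sub β p 0 0 φ
    simpa using this
  unfold Wn Phi
  rw [hG, hD, h0, Pl_zero, ht]
  simp

lemma Mn_zero (L : ℕ) (β : ℝ) (p k : ℕ) : Mn L β p (fun _ => 0) k = 0 := by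
  unfold Mn
  rw [Pl_zero]
  simp

lemma Dd_zero (L : ℕ) (β φ : ℝ) (p : ℕ) : Dd L β p (fun _ => 0) (fun _ => 0) φ = 0 := by
  have h0 : ∀ c : ℕ → ℝ, Fp c p (0 : ℝ) = 0 := fun c => by simp [Fp]
  have hu : ∀ x, uu β p (fun _ => 0) x = 0 := fun x => by simp [uu]
  unfold Dd kap; simp [hu, h0]

lemma Dd_sub {τ : ℝ} {p : ℕ} (hτ : 0 < τ) (hτ1 : 1000 * τ ≤ 1) (hp : 1 ≤ p)
    (hpτ : 10 * (p * τ) ≤ 1)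
    (L : ℕ) (β : ℝ) {α : ℝ} (hα : 0 ≤ α) {m m' : ℕ → ℝ} (h : Sz τ p 3 2 m)
    (h' : Sz τ p 3 2 m') (hd : Sz τ p (2 * α) α (fun k => m' k - m k))
    {w w' : ℝ → ℝ} (hw : Measurable w) (hw' : Measurable w')
    (hW : ∀ x, |w x| ≤ 2 * τ ^ (2 * p)) (hW' : ∀ x, |w' x| ≤ 2 * τ ^ (2 * p))
    (hwd : ∀ x, |w' x - w x| ≤ α * τ ^ (2 * p)) (φ : ℝ) :
    |Dd L β p m' w' φ - Dd L β p m w φ| ≤ α * τ ^ (2 * p) * (1 + 2 * τ) := by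
  have t3 := tau3 hτ hτ1 hp hpτ
  have t2 : τ ^ 2 ≤ τ / 1000 := by nlinarith
  set T := τ ^ (2 * p) with hT
  have hT0 : 0 ≤ T := by positivity
  have hT2 : T ≤ τ ^ 2 := pow_le_pow_of_le_one hτ.le (by linarith) (by omega)
  have hXp : (4 * τ ^ 3) ^ p ≤ T := by
    rw [hT, pow_mul]
    gcongr
    nlinarith [sq_nonneg τ]
  have hX : 4 * τ ^ 3 + 2 * T ≤ τ / 100 := by linarith
  have hexp : Real.exp (4 * τ ^ 3 + 2 * T) ≤ 1 + τ := by
    have h0 : 0 ≤ 4 * τ ^ 3 + 2 * T := by positivity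
    have := Real.abs_exp_sub_one_le (x := 4 * τ ^ 3 + 2 * T)
      (by rw [abs_of_nonneg h0]; linarith)
    rw [abs_of_nonneg h0] at this
    linarith [(abs_le.1 this).2]
  unfold Dd
  rw [← integral_sub (int_k L β p m' hw' hW' φ) (int_k L β p m hw hW φ)]
  have key : ∀ z, ‖kap p (uu β p m' (φ + z)) (w' (φ + z)) - kap p (uu β p m (φ + z)) (w (φ + z))‖
      ≤ α * T * (1 + 2 * τ) := by
    intro z
    rw [Real.norm_eq_abs]
    have b1 := (uu_bound β p m (φ + z)).trans (nU_le hτ hτ1 hp hpτ h)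
    have b2 := (uu_bound β p m' (φ + z)).trans (nU_le hτ hτ1 hp hpτ h')
    refine (kap_bound hp b1 b2 (hW (φ + z)) (hW' (φ + z)) (by linarith)).trans ?_
    have b3 : |uu β p m' (φ + z) - uu β p m (φ + z)| ≤ (2 * α + α / 2) * τ ^ 3 := by
      rw [uu_sub]
      exact (uu_bound _ _ _ _).trans (nU1' hτ hτ1 hp hpτ hα hd)
    calc _ ≤ (1 + τ) * (α * T) + (4 * (2 * T) + 2 * T) * ((2 * α + α / 2) * τ ^ 3) := by
          gcongr
          exact hwd _
      _ = α * T * (1 + τ + 25 * τ ^ 3) := by ring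
      _ ≤ _ := mul_le_mul_of_nonneg_left (by linarith) (by positivity)
  have := norm_integral_le_of_norm_le_const (μ := gaussianReal 0 (2 * Real.log L).toNNReal)
    (Eventually.of_forall key)
  simpa using this

lemma Wn_sub {τ : ℝ} {p : ℕ} (hτ : 0 < τ) (hτ1 : 1000 * τ ≤ 1) (hp : 1 ≤ p)
    (hpτ : 10 * (p * τ) ≤ 1)
    (L : ℕ) (hL : 2 ≤ L) (β : ℝ) (hβ1 : 1 ≤ β) (hLτ : 1000 * ((L : ℝ) ^ 2 * τ) ≤ 1)
    {α : ℝ} (hα : 0 ≤ α) {m m' : ℕ → ℝ} (h : Sz τ p 3 2 m)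
    (h' : Sz τ p 3 2 m') (hd : Sz τ p (2 * α) α (fun k => m' k - m k))
    {w w' : ℝ → ℝ} (hw : Measurable w) (hw' : Measurable w')
    (hW : ∀ x, |w x| ≤ 2 * τ ^ (2 * p)) (hW' : ∀ x, |w' x| ≤ 2 * τ ^ (2 * p))
    (hwd : ∀ x, |w' x - w x| ≤ α * τ ^ (2 * p)) (φ : ℝ) :
    |Wn L β p m' w' φ - Wn L β p m w φ|
      ≤ α * τ ^ (2 * p) * ((L : ℝ) ^ 2 + (5 * (L : ℝ) ^ 2 + 1) * τ) := by
  have hL0 : (0 : ℝ) < L := by positivity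
  have hL2 : (2 : ℝ) ≤ L := by exact_mod_cast hL
  have hLi : 1 / (L : ℝ) ≤ 1 / 2 := one_div_le_one_div_of_le (by norm_num) hL2
  have hq0 : 0 ≤ (L : ℝ) ^ (-β) := by positivity
  have hqL : (L : ℝ) ^ (-β) ≤ 1 / L := by
    rw [one_div, ← Real.rpow_neg_one]
    exact Real.rpow_le_rpow_of_exponent_le (by linarith) (by linarith)
  have t3 := tau3 hτ hτ1 hp hpτ
  have t2 : τ ^ 2 ≤ τ / 1000 := by nlinarith
  have z3 : Sz τ p 3 2 (fun _ => 0) := Sz_zero hτ (by norm_num) (by norm_num)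
  have hD := Dd_sub hτ hτ1 hp hpτ L β hα h h' hd hw hw' hW hW' hwd φ
  have hDb : ∀ (m : ℕ → ℝ) (w : ℝ → ℝ), Sz τ p 3 2 m → Measurable w →
      (∀ x, |w x| ≤ 2 * τ ^ (2 * p)) → |Dd L β p m w φ| ≤ 4 * τ ^ (2 * p) := by
    intro m w h hw hW
    have hTT : 0 ≤ τ ^ (2 * p) := by positivity
    have := Dd_sub hτ hτ1 hp hpτ L β (α := 2) (by norm_num) z3 h
      (by
        simp only [sub_zero]
        refine ⟨h.1.trans ?_, h.2⟩
        gcongr; norm_num) (measurable_const (a := (0 : ℝ))) hw (by simpa using hTT) hW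
      (by simpa using hW) φ
    rw [Dd_zero, sub_zero] at this
    refine this.trans ?_
    nlinarith
  have hGb : ∀ m : ℕ → ℝ, Sz τ p 3 2 m → |Gr L β p m φ| ≤ 8 * τ ^ 3 := by
    intro m h
    have h1 := norm_ev_le β φ (Gl ((L : ℝ) ^ (-β)) p m)
    rw [Gr_ev L hL β φ (by linarith), Complex.norm_real] at h1
    exact h1.trans (n1G0 hτ hτ1 hp hpτ hq0 hLi hqL h)
  have hGd : |Gr L β p m' φ - Gr L β p m φ| ≤ 5 * α * τ ^ 3 := by
    refine (Gr_sub L hL β φ (by linarith) p m m').trans ?_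
    refine (n1G hτ hτ1 hp hpτ hq0 hLi hqL h h').trans ?_
    have := nU1' hτ hτ1 hp hpτ hα hd
    rw [← Uc_sub] at this
    linarith
  have hP := nP hτ hτ1 hp hpτ hq0 hLi hqL hL0 rfl hα hLτ h h' hd
  set T := τ ^ (2 * p) with hT
  have hT0 : 0 ≤ T := by positivity
  have hT2 : T ≤ τ ^ 2 := pow_le_pow_of_le_one hτ.le (by linarith) (by omega)
  have hYp : (8 * τ ^ 3) ^ p ≤ T := by
    rw [hT, pow_mul]
    gcongr
    nlinarith [sq_nonneg τ]
  have hYB : 8 * τ ^ 3 + 4 * T ≤ τ / 100 := by linarith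
  have hPhi : |Phi p (Gr L β p m' φ) (Dd L β p m' w' φ) - Phi p (Gr L β p m φ) (Dd L β p m w φ)|
      ≤ α * T * (1 + 5 * τ) := by
    refine (Phi_bound (hGb m h) (hGb m' h') (hDb m w h hw hW) (hDb m' w' h' hw' hW')
      (by linarith)).trans ?_
    have h1 : 1 / (1 - (8 * τ ^ 3 + 4 * T)) ≤ 1 + τ := by
      rw [div_le_iff₀ (by linarith)]
      nlinarith
    calc _ ≤ (1 + τ) * (α * T * (1 + 2 * τ)) + (4 * (4 * T) + 2 * T) * (5 * α * τ ^ 3) := by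
          gcongr
      _ = α * T * (1 + 3 * τ + 2 * τ ^ 2 + 90 * τ ^ 3) := by ring
      _ ≤ _ := mul_le_mul_of_nonneg_left (by linarith) (by positivity)
  have htl : (L : ℝ) ^ 2 * |tl β p (Pl ((L : ℝ) ^ (-β)) p m') φ
      - tl β p (Pl ((L : ℝ) ^ (-β)) p m) φ| ≤ α * T * τ := by
    rw [← tl_sub]
    have hr : 1 ≤ (τ ^ 2)⁻¹ := by
      rw [← one_div, le_div_iff₀ (by positivity)]
      linarith
    have h1 := tl_bound β p (Pl ((L : ℝ) ^ (-β)) p m' - Pl ((L : ℝ) ^ (-β)) p m) φ hr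
    set t := |tl β p (Pl ((L : ℝ) ^ (-β)) p m' - Pl ((L : ℝ) ^ (-β)) p m) φ|
    have h2 : (L : ℝ) ^ 2 * (t * (τ ^ 2)⁻¹ ^ (p + 1)) ≤ α :=
      (mul_le_mul_of_nonneg_left h1 (by positivity)).trans hP
    calc (L : ℝ) ^ 2 * t = (L : ℝ) ^ 2 * (t * (τ ^ 2)⁻¹ ^ (p + 1)) * (τ ^ 2) ^ (p + 1) := by
          rw [inv_pow]; field_simp
      _ ≤ α * (τ ^ 2) ^ (p + 1) := by gcongr
      _ = α * T * τ ^ 2 := by rw [hT, pow_mul]; ring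
      _ ≤ α * T * τ := by gcongr; linarith
  have e : Wn L β p m' w' φ - Wn L β p m w φ = -((L : ℝ) ^ 2 *
      ((Phi p (Gr L β p m' φ) (Dd L β p m' w' φ) - Phi p (Gr L β p m φ) (Dd L β p m w φ))
      + (tl β p (Pl ((L : ℝ) ^ (-β)) p m') φ - tl β p (Pl ((L : ℝ) ^ (-β)) p m) φ))) := by
    unfold Wn; ring
  rw [e, abs_neg, abs_mul, abs_of_nonneg (by positivity : (0 : ℝ) ≤ (L : ℝ) ^ 2)]
  have a1 := abs_add_le (Phi p (Gr L β p m' φ) (Dd L β p m' w' φ) - Phi p (Gr L β p m φ) (Dd L β p m w φ))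
      (tl β p (Pl ((L : ℝ) ^ (-β)) p m') φ - tl β p (Pl ((L : ℝ) ^ (-β)) p m) φ)
  have a2 := mul_le_mul_of_nonneg_left a1 (by positivity : (0 : ℝ) ≤ (L : ℝ) ^ 2)
  have a3 := mul_le_mul_of_nonneg_left hPhi (by positivity : (0 : ℝ) ≤ (L : ℝ) ^ 2)
  refine a2.trans ?_
  rw [mul_add]
  refine (add_le_add a3 htl).trans (le_of_eq ?_)
  ring

lemma Mn_sub {τ : ℝ} {p : ℕ} (hτ : 0 < τ) (hτ1 : 1000 * τ ≤ 1) (hp : 1 ≤ p)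
    (hpτ : 10 * (p * τ) ≤ 1)
    (L : ℕ) (hL : 2 ≤ L) (β : ℝ) (hβ1 : 1 ≤ β) (hLτ : 1000 * ((L : ℝ) ^ 2 * τ) ≤ 1)
    {α : ℝ} (hα : 0 ≤ α) {m m' : ℕ → ℝ} (h : Sz τ p 3 2 m)
    (h' : Sz τ p 3 2 m') (hd : Sz τ p (2 * α) α (fun k => m' k - m k)) (k : ℕ) (hk : 1 ≤ k) :
    |Mn L β p m' k - Mn L β p m k| ≤ α * τ ^ (2 * k) := by
  have hL0 : (0 : ℝ) < L := by positivity
  have hL2 : (2 : ℝ) ≤ L := by exact_mod_cast hL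
  have hLi : 1 / (L : ℝ) ≤ 1 / 2 := one_div_le_one_div_of_le (by norm_num) hL2
  have hq0 : 0 ≤ (L : ℝ) ^ (-β) := by positivity
  have hqL : (L : ℝ) ^ (-β) ≤ 1 / L := by
    rw [one_div, ← Real.rpow_neg_one]
    exact Real.rpow_le_rpow_of_exponent_le (by linarith) (by linarith)
  have hP := nP hτ hτ1 hp hpτ hq0 hLi hqL hL0 rfl hα hLτ h h' hd
  set f := Pl ((L : ℝ) ^ (-β)) p m' - Pl ((L : ℝ) ^ (-β)) p m with hf
  have h1 := coeff_le (r := (τ ^ 2)⁻¹) (by positivity) f {(k : ℤ), -(k : ℤ)}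
  rw [Finset.sum_pair (by omega)] at h1
  simp only [Int.natAbs_neg, Int.natAbs_natCast] at h1
  have e : Mn L β p m' k - Mn L β p m k
      = -((L : ℝ) ^ 2 * (f.coeff (k : ℤ) + f.coeff (-(k : ℤ)))) := by
    rw [hf, coeff_sub', coeff_sub']; unfold Mn; ring
  rw [e, abs_neg, abs_mul, abs_of_nonneg (by positivity : (0 : ℝ) ≤ (L : ℝ) ^ 2)]
  have h2 : (L : ℝ) ^ 2 * (|f.coeff (k : ℤ) + f.coeff (-(k : ℤ))| * (τ ^ 2)⁻¹ ^ k) ≤ α := by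
    refine le_trans (mul_le_mul_of_nonneg_left (le_trans ?_ h1) (by positivity)) hP
    rw [← add_mul]
    gcongr
    exact abs_add_le _ _
  calc _ = (L : ℝ) ^ 2 * (|f.coeff (k : ℤ) + f.coeff (-(k : ℤ))| * (τ ^ 2)⁻¹ ^ k)
        * (τ ^ 2) ^ k := by
          rw [inv_pow]; field_simp
    _ ≤ α * (τ ^ 2) ^ k := by gcongr
    _ = _ := by rw [pow_mul]

lemma Mn_one {τ : ℝ} {p : ℕ} (hτ : 0 < τ) (hτ1 : 1000 * τ ≤ 1) (hp : 1 ≤ p)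
    (hpτ : 10 * (p * τ) ≤ 1)
    (L : ℕ) (hL : 2 ≤ L) (β : ℝ) (hβ1 : 1 ≤ β)
    {m m' : ℕ → ℝ} (h : Sz τ p 3 2 m) (h' : Sz τ p 3 2 m') :
    |(Mn L β p m' 1 - Mn L β p m 1) - (L : ℝ) ^ ((2 : ℝ) - β) * (m' 1 - m 1)|
      ≤ 40 * (L : ℝ) ^ 2 * nrm 1 (Uc p m' - Uc p m) * τ ^ 3 := by
  have hL0 : (0 : ℝ) < L := by positivity
  have hL2 : (2 : ℝ) ≤ L := by exact_mod_cast hL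
  have hLi : 1 / (L : ℝ) ≤ 1 / 2 := one_div_le_one_div_of_le (by norm_num) hL2
  have hq0 : 0 ≤ (L : ℝ) ^ (-β) := by positivity
  have hqL : (L : ℝ) ^ (-β) ≤ 1 / L := by
    rw [one_div, ← Real.rpow_neg_one]
    exact Real.rpow_le_rpow_of_exponent_le (by linarith) (by linarith)
  have hq : (L : ℝ) ^ ((2 : ℝ) - β) = (L : ℝ) ^ 2 * (L : ℝ) ^ (-β) := by
    rw [sub_eq_add_neg, Real.rpow_add hL0, Real.rpow_two]
  have hM := mode1 hτ hτ1 hp hpτ hq0 hLi hqL h h'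
  rw [hq]
  set x := ((Pl ((L : ℝ) ^ (-β)) p m').coeff 1 + (Pl ((L : ℝ) ^ (-β)) p m').coeff (-1))
    - ((Pl ((L : ℝ) ^ (-β)) p m).coeff 1 + (Pl ((L : ℝ) ^ (-β)) p m).coeff (-1))
      + (L : ℝ) ^ (-β) * (m' 1 - m 1) with hx
  have e : (Mn L β p m' 1 - Mn L β p m 1) - (L : ℝ) ^ 2 * (L : ℝ) ^ (-β) * (m' 1 - m 1)
      = -((L : ℝ) ^ 2 * x) := by
    rw [hx]; unfold Mn; push_cast; ring
  rw [e, abs_neg, abs_mul, abs_of_nonneg (by positivity : (0 : ℝ) ≤ (L : ℝ) ^ 2)]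
  refine (mul_le_mul_of_nonneg_left hM (by positivity)).trans (le_of_eq (by ring))


lemma small (c : ℝ) {d : ℝ} (hd : 0 < d) : ∃ t : ℝ, 0 < t ∧ ∀ τ, 0 < τ → τ ≤ t → c * τ ≤ d := by
  refine ⟨d / (|c| + 1), by positivity, fun τ h0 h => ?_⟩
  rw [le_div_iff₀ (by positivity)] at h
  have : c * τ ≤ |c| * τ := by gcongr; exact le_abs_self c
  linarith

lemma pSG_spec {β : ℝ} (hβ2 : β < 2) :
    1 ≤ pSG β ∧ 2 < (2 / 3 : ℝ) * (pSG β) * (2 - β) := by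
  have hne : {p : ℕ | 0 < p ∧ 2 < (2 / 3 : ℝ) * p * (2 - β)}.Nonempty := by
    obtain ⟨n, hn⟩ := exists_nat_gt (3 / (2 - β))
    have h0 : 0 < 2 - β := by linarith
    have hn0 : (0 : ℝ) < n := lt_trans (by positivity) hn
    refine ⟨n, by exact_mod_cast hn0, ?_⟩
    rw [div_lt_iff₀ h0] at hn
    linarith
  exact Nat.sInf_mem hne

lemma core (L : ℕ) (hL : 2 ≤ L) (β : ℝ) (hβ1 : 1 ≤ β) {p : ℕ} (hp : 1 ≤ p)
    {Λ Θ A τ α : ℝ} (hΛ : Λ = (L : ℝ) ^ ((2 : ℝ) - β)) (hΛ1 : 1 < Λ)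
    (hA : A = 160 * (L : ℝ) ^ 2 / (Λ ^ 2 - Λ)) (hτ : 0 < τ)
    (c0 : 1000 * τ ≤ 1) (c1 : 1000 * (L : ℝ) ^ 2 * τ ≤ 1) (c2 : 10 * p * τ ≤ 1) (c3 : A * τ ≤ 1)
    (c4 : 80 * p * (L : ℝ) ^ 2 * τ ≤ Λ ^ 2 - Λ)
    (c5 : (5 * (L : ℝ) ^ 2 + 1) * τ ≤ Θ - (L : ℝ) ^ 2)
    (hα0 : 0 < α) (hα1 : α < 1) {m d : ℕ → ℝ} {w δ : ℝ → ℝ} (hw : Measurable w)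
    (hδ : Measurable δ) (h1 : |m 1 - τ ^ 3| ≤ A * (τ ^ 3) ^ 2)
    (h2 : ∀ k, 2 ≤ k → k ≤ p → |m k| ≤ τ ^ (2 * k)) (h3 : ∀ φ, |w φ| ≤ τ ^ (2 * p))
    (h4 : |d 1| ≤ α * (τ ^ 3) ^ 2) (h5 : ∀ k, 2 ≤ k → k ≤ p → |d k| ≤ α * τ ^ (2 * k))
    (h6 : ∀ φ, |δ φ| ≤ α * τ ^ (2 * p)) :
    ∃ (c' c'' : ℝ) (μk' δμk' : ℕ → ℝ) (w' δw' : ℝ → ℝ),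
      (∀ φ, SGRG L (fun ψ => (∑ k ∈ Finset.Icc 1 p, m k * cMode β k ψ) + w ψ) φ - c'
            = (∑ k ∈ Finset.Icc 1 p, μk' k * cMode β k φ) + w' φ) ∧
      (∀ φ, SGRG L (fun ψ => (∑ k ∈ Finset.Icc 1 p, (m k + d k) * cMode β k ψ)
                  + w ψ + δ ψ) φ - c''
            = (∑ k ∈ Finset.Icc 1 p, (μk' k + δμk' k) * cMode β k φ) + w' φ + δw' φ) ∧
      |μk' 1 - Λ * τ ^ 3| ≤ A * (Λ * τ ^ 3) ^ 2 ∧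
      (∀ k, 2 ≤ k → k ≤ p → |μk' k| ≤ τ ^ (2 * k)) ∧
      (∀ φ, |w' φ| ≤ Θ * τ ^ (2 * p)) ∧
      |δμk' 1| ≤ α * (Λ * τ ^ 3) ^ 2 ∧
      (∀ k, 2 ≤ k → k ≤ p → |δμk' k| ≤ α * τ ^ (2 * k)) ∧
      (∀ φ, |δw' φ| ≤ α * (Θ * τ ^ (2 * p))) := by
  have hL0 : (0 : ℝ) < L := by positivity
  have hΛΛ : 0 < Λ ^ 2 - Λ := by nlinarith
  have hA0 : 0 < A := by rw [hA]; positivity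
  have c1' : 1000 * ((L : ℝ) ^ 2 * τ) ≤ 1 := by linarith
  have c2' : 10 * (p * τ) ≤ 1 := by linarith
  have hτ3 : 0 < τ ^ 3 := by positivity
  have t3 := tau3 hτ c0 hp c2'
  have t6 : (τ ^ 3) ^ 2 ≤ τ ^ 3 * τ := by
    rw [sq]; gcongr; linarith
  have hm1 : |m 1| ≤ 2 * τ ^ 3 := by
    have e1 : A * (τ ^ 3) ^ 2 ≤ τ ^ 3 := by
      calc A * (τ ^ 3) ^ 2 ≤ A * (τ ^ 3 * τ) := by gcongr
        _ = (A * τ) * τ ^ 3 := by ring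
        _ ≤ 1 * τ ^ 3 := by gcongr
        _ = _ := one_mul _
    have e2 := abs_add_le (m 1 - τ ^ 3) (τ ^ 3)
    rw [sub_add_cancel, abs_of_pos hτ3] at e2
    linarith
  have hd1 : |d 1| ≤ α * τ ^ 3 := by
    refine h4.trans ?_
    gcongr
    nlinarith
  have hατ : α * τ ^ 3 ≤ τ ^ 3 := by nlinarith
  have sz : Sz τ p 3 2 m := by
    refine ⟨by linarith, fun k hk hk' => ?_⟩
    have := h2 k hk hk'
    have : 0 < τ ^ (2 * k) := by positivity
    linarith
  have sz' : Sz τ p 3 2 (fun k => m k + d k) := by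
    refine ⟨?_, fun k hk hk' => ?_⟩
    · have := abs_add_le (m 1) (d 1)
      show |m 1 + d 1| ≤ _
      linarith
    · have := h2 k hk hk'
      have := h5 k hk hk'
      have : 0 < τ ^ (2 * k) := by positivity
      have := abs_add_le (m k) (d k)
      show |m k + d k| ≤ _
      nlinarith
  have z3 : Sz τ p 3 2 (fun _ => 0) := Sz_zero hτ (by norm_num) (by norm_num)
  have szd : Sz τ p (2 * α) α (fun k => (fun k => m k + d k) k - m k) := by
    simp only [add_sub_cancel_left]
    refine ⟨by nlinarith, h5⟩
  have szd' : Sz τ p (α * τ ^ 3) α (fun k => (fun k => m k + d k) k - m k) := by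
    simp only [add_sub_cancel_left]
    refine ⟨by linarith, h5⟩
  have szm : Sz τ p (2 * 1) 1 (fun k => m k - (fun _ => 0) k) := by
    simp only [sub_zero, mul_one]
    refine ⟨hm1, by simpa using h2⟩
  have hT : 0 < τ ^ (2 * p) := by positivity
  have hW : ∀ x, |w x| ≤ 2 * τ ^ (2 * p) := fun x => by linarith [h3 x]
  have hW' : ∀ x, |(w x + δ x)| ≤ 2 * τ ^ (2 * p) := fun x => by
    have := abs_add_le (w x) (δ x)
    have := h3 x
    have := h6 x
    nlinarith
  have hm' : Measurable (fun x => w x + δ x) := hw.add hδ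
  have hΘ : (L : ℝ) ^ 2 + (5 * (L : ℝ) ^ 2 + 1) * τ ≤ Θ := by linarith
  refine ⟨-(L : ℝ) ^ 2 * (Pl ((L : ℝ) ^ (-β)) p m).coeff 0,
    -(L : ℝ) ^ 2 * (Pl ((L : ℝ) ^ (-β)) p (fun k => m k + d k)).coeff 0, Mn L β p m, fun k => Mn L β p (fun k => m k + d k) k - Mn L β p m k, Wn L β p m w,
    fun φ => Wn L β p (fun k => m k + d k) (fun x => w x + δ x) φ - Wn L β p m w φ,
    fun φ => SGRG_eq L hL β (by linarith) p m hw hW φ, fun φ => ?_, ?_, ?_, ?_, ?_, ?_, ?_⟩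
  · have := SGRG_eq L hL β (by linarith) p (fun k => m k + d k) hm' hW' φ
    simp only [add_sub_cancel]
    rw [add_assoc, add_sub_cancel]
    simp only [add_assoc] at this ⊢
    exact this
  · have h := Mn_one hτ c0 hp c2' L hL β hβ1 z3 sz
    rw [Mn_zero, sub_zero, sub_zero, Uc_zero, sub_zero, ← hΛ] at h
    have hn := nU_le hτ c0 hp c2' sz
    have hb : 40 * (L : ℝ) ^ 2 * nrm 1 (Uc p m) * τ ^ 3
        ≤ 40 * (L : ℝ) ^ 2 * (4 * τ ^ 3) * τ ^ 3 := by gcongr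
    have e2 := abs_add_le (Mn L β p m 1 - Λ * m 1) (Λ * (m 1 - τ ^ 3))
    have e3 : Mn L β p m 1 - Λ * m 1 + Λ * (m 1 - τ ^ 3) = Mn L β p m 1 - Λ * τ ^ 3 := by ring
    rw [e3, abs_mul, abs_of_pos (by linarith : 0 < Λ)] at e2
    have e4 : Λ * |m 1 - τ ^ 3| ≤ Λ * (A * (τ ^ 3) ^ 2) := by gcongr
    have e5 : A * (Λ ^ 2 - Λ) = 160 * (L : ℝ) ^ 2 := by
      rw [hA]; exact div_mul_cancel₀ _ hΛΛ.ne'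
    calc _ ≤ 160 * (L : ℝ) ^ 2 * (τ ^ 3) ^ 2 + Λ * (A * (τ ^ 3) ^ 2) := by linarith
      _ = A * (Λ ^ 2 - Λ) * (τ ^ 3) ^ 2 + Λ * (A * (τ ^ 3) ^ 2) := by rw [e5]
      _ = _ := by ring
  · intro k hk _
    have := Mn_sub hτ c0 hp c2' L hL β hβ1 c1' zero_le_one z3 sz szm k (by omega)
    rwa [Mn_zero, sub_zero, one_mul] at this
  · intro φ
    have := Wn_sub hτ c0 hp c2' L hL β hβ1 c1' zero_le_one z3 sz szm (measurable_const (a := (0 : ℝ)))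
      hw (by simpa using hT.le) hW (by simpa using h3) φ
    rw [Wn_zero, sub_zero, one_mul] at this
    refine this.trans ?_
    rw [mul_comm]
    gcongr
  · have h := Mn_one hτ c0 hp c2' L hL β hβ1 sz sz'
    rw [← hΛ] at h
    have hn := nU1 hτ (by linarith) hp hα0.le szd'
    rw [← Uc_sub] at hn
    have hp1 : (1 : ℝ) ≤ p := by exact_mod_cast hp
    have hn2 : α * τ ^ 3 * τ ^ 3 + α * (p * τ ^ 4) ≤ 2 * p * α * τ ^ 4 := by
      have : α * τ ^ 3 * τ ^ 3 ≤ α * (p * τ ^ 4) := by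
        calc α * τ ^ 3 * τ ^ 3 = α * (τ ^ 2 * τ ^ 4) := by ring
          _ ≤ _ := by
            gcongr
            nlinarith
      linarith
    have hb := mul_le_mul_of_nonneg_right (mul_le_mul_of_nonneg_left (hn.trans hn2)
      (by positivity : 0 ≤ 40 * (L : ℝ) ^ 2)) hτ3.le
    have h' := h.trans hb
    simp only [add_sub_cancel_left] at h'
    set x := Mn L β p (fun k => m k + d k) 1 - Mn L β p m 1
    have e2 := abs_add_le (x - Λ * d 1) (Λ * d 1)
    rw [sub_add_cancel, abs_mul, abs_of_pos (by linarith : 0 < Λ)] at e2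
    have e4 : Λ * |d 1| ≤ Λ * (α * (τ ^ 3) ^ 2) := by gcongr
    calc |x| ≤ 40 * (L : ℝ) ^ 2 * (2 * p * α * τ ^ 4) * τ ^ 3 + Λ * (α * (τ ^ 3) ^ 2) := by linarith
      _ = (80 * p * (L : ℝ) ^ 2 * τ) * (α * (τ ^ 3) ^ 2) + Λ * (α * (τ ^ 3) ^ 2) := by ring
      _ ≤ (Λ ^ 2 - Λ) * (α * (τ ^ 3) ^ 2) + Λ * (α * (τ ^ 3) ^ 2) := by gcongr
      _ = _ := by ring
  · intro k hk _
    exact Mn_sub hτ c0 hp c2' L hL β hβ1 c1' hα0.le sz sz' szd k (by omega)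
  · intro φ
    have := Wn_sub hτ c0 hp c2' L hL β hβ1 c1' hα0.le sz sz' szd hw hm' hW hW'
      (by intro x; simpa using h6 x) φ
    refine this.trans ?_
    rw [mul_assoc]
    refine mul_le_mul_of_nonneg_left ?_ hα0.le
    rw [mul_comm]
    gcongr

end SGaux

theorem stmt1 (L : ℕ) (hL : 2 ≤ L) (β : ℝ) (hβ1 : 1 ≤ β) (hβ2 : β < 2) :
    ∃ A ε μ₀ : ℝ, 0 < A ∧ 0 < ε ∧ 0 < μ₀ ∧
      ∀ (μ α : ℝ), 0 < μ → μ ≤ μ₀ → 0 < α → α < 1 →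
      ∀ (μk δμk : ℕ → ℝ) (w δw : ℝ → ℝ), Measurable w → Measurable δw →
        |μk 1 - μ| ≤ A * μ ^ 2 →
        (∀ k, 2 ≤ k → k ≤ pSG β → |μk k| ≤ ε * μ ^ ((2 * k : ℝ) / 3)) →
        (∀ φ, |w φ| ≤ ε * μ ^ ((2 * (pSG β) : ℝ) / 3)) →
        |δμk 1| ≤ α * μ ^ 2 →
        (∀ k, 2 ≤ k → k ≤ pSG β → |δμk k| ≤ α * μ ^ ((2 * k : ℝ) / 3)) →
        (∀ φ, |δw φ| ≤ α * μ ^ ((2 * (pSG β) : ℝ) / 3)) →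
        ∃ (c' c'' : ℝ) (μk' δμk' : ℕ → ℝ) (w' δw' : ℝ → ℝ),
          (∀ φ, SGRG L
              (fun ψ => (∑ k ∈ Finset.Icc 1 (pSG β), μk k * cMode β k ψ) + w ψ) φ - c'
            = (∑ k ∈ Finset.Icc 1 (pSG β), μk' k * cMode β k φ) + w' φ) ∧
          (∀ φ, SGRG L
              (fun ψ => (∑ k ∈ Finset.Icc 1 (pSG β), (μk k + δμk k) * cMode β k ψ)
                  + w ψ + δw ψ) φ - c''
            = (∑ k ∈ Finset.Icc 1 (pSG β), (μk' k + δμk' k) * cMode β k φ)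
                + w' φ + δw' φ) ∧
          |μk' 1 - (L : ℝ) ^ ((2 : ℝ) - β) * μ| ≤ A * ((L : ℝ) ^ ((2 : ℝ) - β) * μ) ^ 2 ∧
          (∀ k, 2 ≤ k → k ≤ pSG β →
            |μk' k| ≤ ε * ((L : ℝ) ^ ((2 : ℝ) - β) * μ) ^ ((2 * k : ℝ) / 3)) ∧
          (∀ φ, |w' φ| ≤ ε * ((L : ℝ) ^ ((2 : ℝ) - β) * μ) ^ ((2 * (pSG β) : ℝ) / 3)) ∧
          |δμk' 1| ≤ α * ((L : ℝ) ^ ((2 : ℝ) - β) * μ) ^ 2 ∧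
          (∀ k, 2 ≤ k → k ≤ pSG β →
            |δμk' k| ≤ α * ((L : ℝ) ^ ((2 : ℝ) - β) * μ) ^ ((2 * k : ℝ) / 3)) ∧
          (∀ φ, |δw' φ| ≤ α * ((L : ℝ) ^ ((2 : ℝ) - β) * μ) ^ ((2 * (pSG β) : ℝ) / 3)) := by
  have hL1 : (1 : ℝ) < L := by exact_mod_cast (by omega : 1 < L)
  have hL0 : (0 : ℝ) < L := by linarith
  obtain ⟨hp, hp2⟩ := SGaux.pSG_spec hβ2
  generalize pSG β = p at *
  set Λ : ℝ := (L : ℝ) ^ ((2 : ℝ) - β) with hΛ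
  have hΛ1 : 1 < Λ := Real.one_lt_rpow hL1 (by linarith)
  have hΛ0 : 0 < Λ := by linarith
  have hΛΛ : 0 < Λ ^ 2 - Λ := by nlinarith
  have hΘ : 0 < Λ ^ ((2 * p : ℝ) / 3) - (L : ℝ) ^ 2 := by
    rw [hΛ, ← Real.rpow_mul hL0.le, ← Real.rpow_two, sub_pos]
    apply Real.rpow_lt_rpow_of_exponent_lt hL1
    linarith
  obtain ⟨A, hA⟩ : ∃ A : ℝ, A = 160 * (L : ℝ) ^ 2 / (Λ ^ 2 - Λ) := ⟨_, rfl⟩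
  have hA0 : 0 < A := by rw [hA]; positivity
  obtain ⟨t0, p0, s0⟩ := SGaux.small 1000 one_pos
  obtain ⟨t1, p1, s1⟩ := SGaux.small (1000 * (L : ℝ) ^ 2) one_pos
  obtain ⟨t2, p2, s2⟩ := SGaux.small (10 * (p : ℝ)) one_pos
  obtain ⟨t3, p3, s3⟩ := SGaux.small A one_pos
  obtain ⟨t4, p4, s4⟩ := SGaux.small (80 * p * (L : ℝ) ^ 2) hΛΛ
  obtain ⟨t5, p5, s5⟩ := SGaux.small (5 * (L : ℝ) ^ 2 + 1) hΘ
  obtain ⟨t, ht, ht0, ht1, ht2, ht3, ht4, ht5⟩ : ∃ t : ℝ, 0 < t ∧ t ≤ t0 ∧ t ≤ t1 ∧ t ≤ t2 ∧ t ≤ t3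
      ∧ t ≤ t4 ∧ t ≤ t5 := by
    refine ⟨min t0 (min t1 (min t2 (min t3 (min t4 t5)))), ?_, ?_⟩
    · simp only [lt_min_iff]; exact ⟨p0, p1, p2, p3, p4, p5⟩
    · simpa only [le_min_iff] using le_refl (min t0 (min t1 (min t2 (min t3 (min t4 t5)))))
  refine ⟨A, 1, t ^ 3, hA0, one_pos, by positivity, ?_⟩
  intro μ α hμ hμt hα0 hα1 m d w δ hw hδ h1 h2 h3 h4 h5 h6
  obtain ⟨τ, hτ, hτμ⟩ : ∃ τ : ℝ, 0 < τ ∧ μ = τ ^ 3 := by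
    refine ⟨μ ^ (1 / 3 : ℝ), by positivity, ?_⟩
    rw [← Real.rpow_natCast, ← Real.rpow_mul hμ.le]
    norm_num
  subst hτμ
  have hτt : τ ≤ t := le_of_pow_le_pow_left₀ (by norm_num) ht.le hμt
  have hpow : ∀ k : ℕ, (τ ^ 3) ^ ((2 * k : ℝ) / 3) = τ ^ (2 * k) := by
    intro k
    rw [← Real.rpow_natCast τ 3, ← Real.rpow_mul hτ.le, ← Real.rpow_natCast]
    congr 1
    push_cast
    ring
  have hpow2 : ∀ k : ℕ, (Λ * τ ^ 3) ^ ((2 * k : ℝ) / 3)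
      = Λ ^ ((2 * k : ℝ) / 3) * τ ^ (2 * k) := by
    intro k
    rw [Real.mul_rpow hΛ0.le (by positivity), hpow]
  have hge : ∀ k : ℕ, τ ^ (2 * k) ≤ Λ ^ ((2 * k : ℝ) / 3) * τ ^ (2 * k) := by
    intro k
    exact le_mul_of_one_le_left (by positivity) (Real.one_le_rpow hΛ1.le (by positivity))
  simp only [hpow, one_mul] at h2 h3 h5 h6
  obtain ⟨c', c'', M, D, W, E, g1, g2, g3, g4, g5, g6, g7, g8⟩ :=
    SGaux.core L hL β hβ1 hp hΛ hΛ1 hA hτ (s0 τ hτ (hτt.trans ht0)) (s1 τ hτ (hτt.trans ht1))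
      (s2 τ hτ (hτt.trans ht2)) (s3 τ hτ (hτt.trans ht3)) (s4 τ hτ (hτt.trans ht4))
      (s5 τ hτ (hτt.trans ht5)) hα0 hα1 hw hδ h1 h2 h3 h4 h5 h6
  simp only [hpow2, one_mul]
  exact ⟨c', c'', M, D, W, E, g1, g2, g3, fun k hk hk' => (g4 k hk hk').trans (hge k), g5, g6,
    fun k hk hk' => (g7 k hk hk').trans (mul_le_mul_of_nonneg_left (hge k) hα0.le), g8⟩
end
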